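/- (Non-degeneracy of elliptic measure) Under the setting of degenerate elliptic operators on Ω = ℝⁿ \ Γ with Γ d-AR, d < n−1: there exists C ≥ 1 (depending on C₀, C₃, n, d) such that for every ball B centered on Γ, the elliptic measure ω^X satisfies ω^X(B ∩ Γ) ≥ C⁻¹ for X ∈ Ω ∩ (1/2)B, and ω^Y(Γ \ B) ≥ C⁻¹ for Y ∈ Ω \ 2B. -/

import Mathlib

open MeasureTheory Metric Set Filter
open scoped ENNReal Topology

namespace EMN
/-- the smooth step -/
noncomputable def S (t : ℝ) : ℝ := Real.smoothTransition t

lemma S_smooth : ContDiff ℝ 1 S := Real.smoothTransition.contDiff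
lemma S_nonneg (t : ℝ) : 0 ≤ S t := Real.smoothTransition.nonneg t
lemma S_le_one (t : ℝ) : S t ≤ 1 := Real.smoothTransition.le_one t
lemma S_one {t : ℝ} (h : 1 ≤ t) : S t = 1 := Real.smoothTransition.one_of_one_le h
lemma S_zero {t : ℝ} (h : t ≤ 0) : S t = 0 := Real.smoothTransition.zero_of_nonpos h
lemma S_diff : Differentiable ℝ S := S_smooth.differentiable one_ne_zero
lemma S_deriv_cont : Continuous (deriv S) := S_smooth.continuous_deriv le_rfl
lemma S_pos {t : ℝ} (h : 0 < t) : 0 < S t := Real.smoothTransition.pos_of_pos h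
lemma S_deriv_nonneg (t : ℝ) : 0 ≤ deriv S t :=
  Monotone.deriv_nonneg (g := S) Real.smoothTransition.monotone
lemma S_deriv_zero_left {t : ℝ} (h : t ≤ 0) : deriv S t = 0 := by
  have : IsLocalMin S t := by
    refine Filter.Eventually.of_forall fun x => ?_
    rw [S_zero h]; exact S_nonneg x
  exact this.deriv_eq_zero
lemma S_deriv_zero_right {t : ℝ} (h : 1 ≤ t) : deriv S t = 0 := by
  have : IsLocalMax S t := by
    refine Filter.Eventually.of_forall fun x => ?_
    rw [S_one h]; exact S_le_one x
  exact this.deriv_eq_zero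
lemma S_deriv_bdd : ∃ K : ℝ, 1 ≤ K ∧ ∀ t, deriv S t ≤ K := by
  obtain ⟨x, hx, h⟩ := (isCompact_Icc (a := (0:ℝ)) (b := 1)).exists_isMaxOn
    (by simp) (S_deriv_cont.continuousOn)
  refine ⟨max 1 (deriv S x), le_max_left _ _, fun t => ?_⟩
  by_cases ht : t ∈ Icc (0:ℝ) 1
  · exact (h ht).trans (le_max_right _ _)
  · rw [mem_Icc, not_and_or, not_le, not_le] at ht
    rcases ht with ht | ht
    · rw [S_deriv_zero_left ht.le]; positivity
    · rw [S_deriv_zero_right ht.le]; positivity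

/-- bound on the derivative of the step -/
noncomputable def KS : ℝ := Classical.choose S_deriv_bdd
lemma KS_one : 1 ≤ KS := (Classical.choose_spec S_deriv_bdd).1
lemma KS_bd (t : ℝ) : deriv S t ≤ KS := (Classical.choose_spec S_deriv_bdd).2 t

/-- clamp between levels -/
noncomputable def T (a b t : ℝ) : ℝ := S ((t - a) / (b - a))
lemma T_smooth (a b : ℝ) : ContDiff ℝ 1 (T a b) := by
  unfold T; exact S_smooth.comp (by fun_prop)
lemma T_diff (a b : ℝ) : Differentiable ℝ (T a b) := (T_smooth a b).differentiable one_ne_zero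
lemma T_deriv_cont (a b : ℝ) : Continuous (deriv (T a b)) := (T_smooth a b).continuous_deriv le_rfl
lemma T_deriv (a b t : ℝ) : deriv (T a b) t = deriv S ((t - a) / (b - a)) / (b - a) := by
  have h1 : HasDerivAt (fun t : ℝ => (t - a) / (b - a)) (1 / (b - a)) t :=
    ((hasDerivAt_id t).sub_const a).div_const _
  have h2 := ((S_diff ((t - a) / (b - a))).hasDerivAt.comp t h1).deriv
  have : T a b = S ∘ fun t => (t - a) / (b - a) := rfl
  rw [this, h2]; ring
lemma T_nonneg (a b t : ℝ) : 0 ≤ T a b t := S_nonneg _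
lemma T_le_one (a b t : ℝ) : T a b t ≤ 1 := S_le_one _
lemma T_zero {a b t : ℝ} (hab : a < b) (h : t ≤ a) : T a b t = 0 :=
  S_zero (div_nonpos_of_nonpos_of_nonneg (by linarith) (by linarith))
lemma T_one {a b t : ℝ} (hab : a < b) (h : b ≤ t) : T a b t = 1 :=
  S_one ((one_le_div (by linarith)).2 (by linarith))
lemma T_deriv_nonneg {a b : ℝ} (hab : a < b) (t : ℝ) : 0 ≤ deriv (T a b) t := by
  rw [T_deriv]; exact div_nonneg (S_deriv_nonneg _) (by linarith)
lemma T_deriv_le {a b : ℝ} (hab : a < b) (t : ℝ) : deriv (T a b) t ≤ KS / (b - a) := by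
  rw [T_deriv]; exact div_le_div_of_nonneg_right (KS_bd _) (by linarith)
lemma T_deriv_zero {a b t : ℝ} (hab : a < b) (h : t ≤ a ∨ b ≤ t) : deriv (T a b) t = 0 := by
  rw [T_deriv]
  rcases h with h | h
  · rw [S_deriv_zero_left (div_nonpos_of_nonpos_of_nonneg (by linarith) (by linarith)), zero_div]
  · rw [S_deriv_zero_right ((one_le_div (by linarith)).2 (by linarith)), zero_div]

/-- the Euclidean space -/
abbrev EE (n : ℕ) := EuclideanSpace ℝ (Fin n)

variable {n : ℕ}

/-- radial cutoff -/
noncomputable def cut (c : EE n) (a b : ℝ) (y : EE n) : ℝ :=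
  S ((b ^ 2 - ‖y - c‖ ^ 2) / (b ^ 2 - a ^ 2))

lemma cut_smooth (c : EE n) (a b : ℝ) : ContDiff ℝ 1 (cut c a b) := by
  unfold cut
  refine S_smooth.comp ?_
  refine ContDiff.div_const ?_ _
  exact contDiff_const.sub ((contDiff_id.sub contDiff_const).norm_sq ℝ)

lemma cut_nonneg (c : EE n) (a b : ℝ) (y) : 0 ≤ cut c a b y := S_nonneg _
lemma cut_le_one (c : EE n) (a b : ℝ) (y) : cut c a b y ≤ 1 := S_le_one _
lemma cut_one {c : EE n} {a b : ℝ} (ha : 0 ≤ a) (hab : a < b) {y : EE n} (h : dist y c ≤ a) :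
    cut c a b y = 1 := by
  apply S_one
  rw [dist_eq_norm] at h
  have : 0 < b ^ 2 - a ^ 2 := by nlinarith
  rw [one_le_div this]
  have := norm_nonneg (y - c)
  nlinarith
lemma cut_zero {c : EE n} {a b : ℝ} (ha : 0 ≤ a) (hab : a < b) {y : EE n} (h : b ≤ dist y c) :
    cut c a b y = 0 := by
  apply S_zero
  rw [dist_eq_norm] at h
  have : 0 < b ^ 2 - a ^ 2 := by nlinarith
  apply div_nonpos_of_nonpos_of_nonneg _ this.le
  nlinarith
lemma cut_tsupport {c : EE n} {a b : ℝ} (ha : 0 ≤ a) (hab : a < b) :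
    tsupport (cut c a b) ⊆ closedBall c b := by
  apply closure_minimal _ isClosed_closedBall
  intro y hy
  by_contra h
  rw [mem_closedBall, not_le] at h
  exact hy (cut_zero ha hab h.le)
lemma cut_compact {c : EE n} {a b : ℝ} (ha : 0 ≤ a) (hab : a < b) :
    HasCompactSupport (cut c a b) :=
  (isCompact_closedBall c b).of_isClosed_subset (isClosed_tsupport _) (cut_tsupport ha hab)

lemma cut_fderiv_bd {c : EE n} {a b : ℝ} (ha : 0 ≤ a) (hab : a < b) (y : EE n) :
    ‖fderiv ℝ (cut c a b) y‖ ≤ 2 * KS / (b - a) := by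
  have hK := KS_one
  have hba : 0 < b - a := by linarith
  have hpos : 0 < b ^ 2 - a ^ 2 := by nlinarith
  by_cases hb : dist y c < b
  · have h1 : HasFDerivAt (fun y : EE n => (b ^ 2 - ‖y - c‖ ^ 2) / (b ^ 2 - a ^ 2))
        ((b ^ 2 - a ^ 2)⁻¹ • (-(2 • (innerSL ℝ (y - c) : EE n →L[ℝ] ℝ)) : EE n →L[ℝ] ℝ)) y := by
      have h0 : HasFDerivAt (fun y : EE n => ‖y - c‖ ^ 2) (2 • (innerSL ℝ (y - c))) y := by
        have := (hasStrictFDerivAt_norm_sq (y - c)).hasFDerivAt.comp y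
          ((hasFDerivAt_id y).sub_const c)
        rw [ContinuousLinearMap.comp_id] at this
        exact this
      have := (h0.const_sub (b ^ 2)).const_mul ((b ^ 2 - a ^ 2)⁻¹)
      refine this.congr_of_eventuallyEq (Eventually.of_forall fun z => ?_)
      simp only; rw [div_eq_inv_mul]
    have h2 := ((S_diff _).hasDerivAt.comp_hasFDerivAt y h1).fderiv
    have : cut c a b = S ∘ (fun y : EE n => (b ^ 2 - ‖y - c‖ ^ 2) / (b ^ 2 - a ^ 2)) := rfl
    rw [this, h2, norm_smul, norm_smul, norm_neg]
    have h3 : ‖(2 • (innerSL ℝ (y - c)) : EE n →L[ℝ] ℝ)‖ ≤ 2 * b := by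
      rw [← Nat.cast_smul_eq_nsmul ℝ, norm_smul, innerSL_apply_norm]
      rw [dist_eq_norm] at hb
      simp; linarith
    rw [Real.norm_of_nonneg (S_deriv_nonneg _), Real.norm_of_nonneg (inv_pos.2 hpos).le]
    have h4 : (b ^ 2 - a ^ 2)⁻¹ * ‖(2 • (innerSL ℝ (y - c)) : EE n →L[ℝ] ℝ)‖ ≤ 2 / (b - a) := by
      calc _ ≤ (b ^ 2 - a ^ 2)⁻¹ * (2 * b) := by gcongr
        _ = 2 * b / ((b - a) * (b + a)) := by rw [← div_eq_inv_mul]; congr 1; ring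
        _ ≤ 2 / (b - a) := by
          rw [div_le_div_iff₀ (by nlinarith) hba]
          nlinarith
    calc _ ≤ KS * (2 / (b - a)) := by
          apply mul_le_mul (KS_bd _) h4 (by positivity) (by linarith)
      _ = _ := by ring
  · have : IsLocalMin (cut c a b) y := by
      refine Filter.Eventually.of_forall fun x => ?_
      rw [cut_zero ha hab (not_lt.1 hb)]; exact cut_nonneg _ _ _ x
    rw [this.fderiv_eq_zero, norm_zero]
    positivity

end EMN
open MeasureTheory Metric Set Filter
open scoped ENNReal Topology

namespace EMN
variable {n : ℕ}

lemma lint_scale (ζ : EE n) {t : ℝ} (ht : 0 < t) (h : EE n → ℝ≥0∞) (hm : Measurable h) :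
    ∫⁻ Y, h (ζ + t • (Y - ζ)) = ENNReal.ofReal ((t ^ n)⁻¹) * ∫⁻ y, h y := by
  have e1 : ∫⁻ Y, h (ζ + t • (Y - ζ)) = ∫⁻ Y, h (ζ + t • Y) := by
    rw [← lintegral_sub_right_eq_self (fun Y => h (ζ + t • Y)) ζ]
  have e2 : ∫⁻ Y, h (ζ + t • Y) = ∫⁻ y, h (ζ + y) ∂(Measure.map (t • ·) volume) := by
    rw [lintegral_map]
    · exact hm.comp (by fun_prop)
    · fun_prop
  rw [e1, e2, Measure.map_addHaar_smul _ ht.ne', lintegral_smul_measure,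
    lintegral_add_left_eq_self h ζ]
  simp [abs_of_pos ht]

lemma seg_bound {f : EE n → ℝ} (hf : ContDiff ℝ 1 f) (Y ζ : EE n) :
    ‖f Y - f ζ‖ₑ ≤ ∫⁻ t in Ioo (0:ℝ) 1, ‖fderiv ℝ f (ζ + t • (Y - ζ))‖ₑ * ‖Y - ζ‖ₑ := by
  have hd : ∀ t : ℝ, HasDerivAt (fun t : ℝ => f (ζ + t • (Y - ζ)))
      (fderiv ℝ f (ζ + t • (Y - ζ)) (Y - ζ)) t := by
    intro t
    have h1 : HasDerivAt (fun t : ℝ => ζ + t • (Y - ζ)) (Y - ζ) t := by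
      simpa using ((hasDerivAt_id t).smul_const (Y - ζ)).const_add ζ
    exact ((hf.differentiable one_ne_zero) _).hasFDerivAt.comp_hasDerivAt t h1
  have hc : Continuous fun t : ℝ => fderiv ℝ f (ζ + t • (Y - ζ)) (Y - ζ) := by
    have := hf.continuous_fderiv one_ne_zero
    fun_prop
  have h2 := intervalIntegral.integral_eq_sub_of_hasDerivAt (a := 0) (b := 1)
    (fun t _ => hd t) (hc.intervalIntegrable 0 1)
  simp only [one_smul, add_sub_cancel, zero_smul, add_zero] at h2
  rw [← h2, intervalIntegral.integral_of_le zero_le_one, integral_Ioc_eq_integral_Ioo]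
  refine (enorm_integral_le_lintegral_enorm _).trans (lintegral_mono fun t => ?_)
  exact ContinuousLinearMap.le_opENorm _ _

lemma seg_meas {f : EE n → ℝ} (hf : ContDiff ℝ 1 f) :
    Continuous (fun y => ‖fderiv ℝ f y‖ₑ) := by
  have := hf.continuous_fderiv one_ne_zero
  fun_prop

/-- integration along shrunken copies of a convex set -/
lemma shrink {D : Set (EE n)} (hD : Convex ℝ D) (hDm : MeasurableSet D) {ζ : EE n} (hζ : ζ ∈ D)
    {t : ℝ} (ht : 1 / 2 ≤ t) (ht1 : t ≤ 1) {g : EE n → ℝ≥0∞} (hg : Measurable g) :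
    ∫⁻ Y in D, g (ζ + t • (Y - ζ)) ≤ ENNReal.ofReal (2 ^ n) * ∫⁻ y in D, g y := by
  have h0 : 0 < t := by linarith
  have h1 : ∫⁻ Y in D, g (ζ + t • (Y - ζ)) ≤ ∫⁻ Y, (D.indicator g) (ζ + t • (Y - ζ)) := by
    rw [← lintegral_indicator hDm]
    refine lintegral_mono fun Y => ?_
    by_cases hY : Y ∈ D
    · have : ζ + t • (Y - ζ) ∈ D := by
        have := hD hζ hY (a := 1 - t) (b := t) (by linarith) h0.le (by ring)
        convert this using 1
        module
      simp [hY, this]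
    · simp [hY]
  rw [lint_scale ζ h0 _ (hg.indicator hDm), lintegral_indicator hDm] at h1
  refine h1.trans ?_
  gcongr
  have h3 : (t ^ n)⁻¹ = (t⁻¹) ^ n := by rw [inv_pow]
  rw [h3]
  gcongr
  rw [inv_le_comm₀ h0 two_pos]; linarith

lemma F2raw {D : Set (EE n)} (hD : Convex ℝ D) (hDm : MeasurableSet D) (hDf : volume D ≠ ⊤)
    {L : ℝ} (hL : ∀ x ∈ D, ∀ y ∈ D, dist x y ≤ L) {f : EE n → ℝ} (hf : ContDiff ℝ 1 f) :
    ∫⁻ ζ in D, ∫⁻ Y in D, ‖f Y - f ζ‖ₑ ≤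
      ENNReal.ofReal (2 ^ n * L) * volume D * ∫⁻ y in D, ‖fderiv ℝ f y‖ₑ := by
  set g : EE n → ℝ≥0∞ := fun y => ‖fderiv ℝ f y‖ₑ with hgdef
  have hgc : Continuous g := seg_meas hf
  have hg : Measurable g := hgc.measurable
  have key : ∀ t ∈ Ioo (0:ℝ) 1, ∫⁻ ζ in D, ∫⁻ Y in D, g (ζ + t • (Y - ζ)) ≤
      ENNReal.ofReal (2 ^ n) * volume D * ∫⁻ y in D, g y := by
    intro t ht
    have base : ∀ t : ℝ, 1 / 2 ≤ t → t ≤ 1 → ∫⁻ ζ in D, ∫⁻ Y in D, g (ζ + t • (Y - ζ)) ≤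
      ENNReal.ofReal (2 ^ n) * volume D * ∫⁻ y in D, g y := by
      intro t h1 h2
      calc _ ≤ ∫⁻ ζ in D, ENNReal.ofReal (2 ^ n) * ∫⁻ y in D, g y :=
            setLIntegral_mono' hDm fun ζ hζ => shrink hD hDm hζ h1 h2 hg
        _ = _ := by rw [setLIntegral_const]; ring
    rcases le_total (1 / 2) t with h | h
    · exact base t h ht.2.le
    · rw [lintegral_lintegral_swap]
      · have := base (1 - t) (by linarith) (by linarith [ht.1])
        refine le_trans (le_of_eq ?_) this
        congr 1; ext ζ; congr 1; ext Y; congr 1; module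
      · apply Measurable.aemeasurable
        apply Continuous.measurable
        have : Continuous fun p : EE n × EE n => p.1 + t • (p.2 - p.1) := by fun_prop
        exact hgc.comp this
  have hfin : IsFiniteMeasure (volume.restrict D) := ⟨by simpa using hDf.lt_top⟩
  have hjoint : Measurable fun p : (EE n × EE n) × ℝ => g (p.1.1 + p.2 • (p.1.2 - p.1.1)) :=
    (hgc.comp (by fun_prop)).measurable
  calc _ ≤ ∫⁻ ζ in D, ∫⁻ Y in D, ∫⁻ t in Ioo (0:ℝ) 1, g (ζ + t • (Y - ζ)) * ENNReal.ofReal L := by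
        refine setLIntegral_mono' hDm fun ζ hζ => setLIntegral_mono' hDm fun Y hY => ?_
        refine (seg_bound hf Y ζ).trans (lintegral_mono fun t => ?_)
        simp only
        gcongr
        rw [← ofReal_norm_eq_enorm, ← dist_eq_norm]
        exact ENNReal.ofReal_le_ofReal (hL _ hY _ hζ)
    _ = ∫⁻ ζ in D, ∫⁻ t in Ioo (0:ℝ) 1, ∫⁻ Y in D, g (ζ + t • (Y - ζ)) * ENNReal.ofReal L := by
        congr 1; ext ζ
        rw [lintegral_lintegral_swap]
        apply Measurable.aemeasurable
        exact (hjoint.comp (f := fun p : EE n × ℝ => ((ζ, p.1), p.2)) (by fun_prop)).mul_const _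
    _ = ∫⁻ t in Ioo (0:ℝ) 1, ∫⁻ ζ in D, ∫⁻ Y in D, g (ζ + t • (Y - ζ)) * ENNReal.ofReal L := by
        rw [lintegral_lintegral_swap]
        apply Measurable.aemeasurable
        exact Measurable.lintegral_prod_right' (f := fun q : (EE n × ℝ) × EE n =>
          g (q.1.1 + q.1.2 • (q.2 - q.1.1)) * ENNReal.ofReal L)
          ((hjoint.comp (f := fun q : (EE n × ℝ) × EE n => ((q.1.1, q.2), q.1.2))
            (by fun_prop)).mul_const _)
    _ ≤ ∫⁻ t in Ioo (0:ℝ) 1, (ENNReal.ofReal (2 ^ n) * volume D * ∫⁻ y in D, g y) *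
          ENNReal.ofReal L := by
        refine setLIntegral_mono' measurableSet_Ioo fun t ht => ?_
        have hm : ∀ ζ : EE n, Measurable fun Y => g (ζ + t • (Y - ζ)) := fun ζ =>
          (hgc.comp (by fun_prop)).measurable
        simp_rw [lintegral_mul_const' _ _ ENNReal.ofReal_ne_top]
        gcongr
        exact key t ht
    _ = _ := by
        rw [setLIntegral_const, ENNReal.ofReal_mul (by positivity)]
        simp; ring

/-- pointwise Poincare with Riesz kernel, on a ball -/
lemma Plem {c : EE n} {R : ℝ} (hn : 1 ≤ n) {ζ : EE n} (hζ : ζ ∈ ball c R)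
    {f : EE n → ℝ} (hf : ContDiff ℝ 1 f) :
    ∫⁻ Y in ball c R, ‖f Y - f ζ‖ₑ ≤ ENNReal.ofReal ((2 * R) ^ n) *
      ∫⁻ y in ball c R, ‖fderiv ℝ f y‖ₑ * ENNReal.ofReal (‖y - ζ‖ ^ (1 - (n:ℝ))) := by
  set D := ball c R with hDdef
  have hD : Convex ℝ D := convex_ball c R
  have hDm : MeasurableSet D := measurableSet_ball
  have hR : 0 < R := pos_of_mem_ball hζ
  set g : EE n → ℝ≥0∞ := fun y => ‖fderiv ℝ f y‖ₑ with hgdef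
  have hgc : Continuous g := seg_meas hf
  have hg : Measurable g := hgc.measurable
  have hfin : IsFiniteMeasure (volume.restrict D) := ⟨by simpa using measure_ball_lt_top⟩
  -- the kernel
  let k : ℝ → EE n → ℝ≥0∞ := fun t y => (D ∩ ball ζ (2 * R * t)).indicator
    (fun y => g y * ‖y - ζ‖ₑ) y
  have step : ∀ t ∈ Ioo (0:ℝ) 1, ∫⁻ Y in D, g (ζ + t • (Y - ζ)) * ‖Y - ζ‖ₑ ≤
      ENNReal.ofReal (t ^ (-(n:ℝ) - 1)) * ∫⁻ y, k t y := by
    intro t ht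
    have h0 := ht.1
    have hkm : Measurable (k t) := (hg.mul (by fun_prop)).indicator
      (hDm.inter measurableSet_ball)
    have h1 : ∫⁻ Y in D, g (ζ + t • (Y - ζ)) * ‖Y - ζ‖ₑ ≤
        ∫⁻ Y, ENNReal.ofReal t⁻¹ * k t (ζ + t • (Y - ζ)) := by
      rw [← lintegral_indicator hDm]
      refine lintegral_mono fun Y => ?_
      by_cases hY : Y ∈ D
      · have m1 : ζ + t • (Y - ζ) ∈ D := by
          have := hD hζ hY (a := 1 - t) (b := t) (by linarith [ht.2]) h0.le (by ring)
          convert this using 1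
          module
        have m2 : ζ + t • (Y - ζ) ∈ ball ζ (2 * R * t) := by
          rw [mem_ball, dist_eq_norm, add_sub_cancel_left, norm_smul, Real.norm_of_nonneg h0.le]
          have : ‖Y - ζ‖ < 2 * R := by
            rw [← dist_eq_norm]
            rw [hDdef, mem_ball] at hY hζ
            have := dist_triangle_right Y ζ c
            linarith
          nlinarith
        simp only [k]
        rw [indicator_of_mem hY, indicator_of_mem (mem_inter m1 m2), add_sub_cancel_left,
          enorm_smul]
        have : ENNReal.ofReal t⁻¹ * ‖t‖ₑ = 1 := by
          rw [← ofReal_norm_eq_enorm, Real.norm_of_nonneg h0.le,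
            ← ENNReal.ofReal_mul (by positivity), inv_mul_cancel₀ h0.ne', ENNReal.ofReal_one]
        calc g (ζ + t • (Y - ζ)) * ‖Y - ζ‖ₑ
            = (ENNReal.ofReal t⁻¹ * ‖t‖ₑ) * (g (ζ + t • (Y - ζ)) * ‖Y - ζ‖ₑ) := by
              rw [this, one_mul]
          _ ≤ _ := le_of_eq (by ring)
      · simp [hY]
    rw [lintegral_const_mul' _ _ ENNReal.ofReal_ne_top, lint_scale ζ h0 _ hkm, ← mul_assoc,
      ← ENNReal.ofReal_mul (by positivity)] at h1
    refine h1.trans (le_of_eq ?_)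
    congr 2
    rw [show -(n:ℝ) - 1 = -((n:ℝ) + 1) by ring, Real.rpow_neg h0.le, Real.rpow_add h0,
      Real.rpow_natCast, Real.rpow_one]
    rw [mul_inv]; ring
  have hjoint : Measurable fun p : EE n × ℝ => g (ζ + p.2 • (p.1 - ζ)) * ‖p.1 - ζ‖ₑ := by
    refine Measurable.mul (hgc.comp (by fun_prop)).measurable ?_
    fun_prop
  have hkj : Measurable fun p : ℝ × EE n => ENNReal.ofReal (p.1 ^ (-(n:ℝ) - 1)) * k p.1 p.2 := by
    refine Measurable.mul (by fun_prop) ?_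
    have : (fun p : ℝ × EE n => k p.1 p.2) =
      ({p : ℝ × EE n | p.2 ∈ D} ∩ {p | dist p.2 ζ < 2 * R * p.1}).indicator
        (fun p => g p.2 * ‖p.2 - ζ‖ₑ) := by
      ext p
      simp only [k, indicator_apply]
      rfl
    rw [this]
    refine Measurable.indicator ?_ ?_
    · exact Measurable.mul (hg.comp measurable_snd) (by fun_prop)
    · refine MeasurableSet.inter (measurable_snd hDm) ?_
      exact measurableSet_lt (by fun_prop) (by fun_prop)
  calc _ ≤ ∫⁻ Y in D, ∫⁻ t in Ioo (0:ℝ) 1, g (ζ + t • (Y - ζ)) * ‖Y - ζ‖ₑ :=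
        lintegral_mono fun Y => seg_bound hf Y ζ
    _ = ∫⁻ t in Ioo (0:ℝ) 1, ∫⁻ Y in D, g (ζ + t • (Y - ζ)) * ‖Y - ζ‖ₑ := by
        rw [lintegral_lintegral_swap]
        exact hjoint.aemeasurable
    _ ≤ ∫⁻ t in Ioo (0:ℝ) 1, ∫⁻ y, ENNReal.ofReal (t ^ (-(n:ℝ) - 1)) * k t y := by
        refine setLIntegral_mono' measurableSet_Ioo fun t ht => (step t ht).trans (le_of_eq ?_)
        rw [lintegral_const_mul' _ _ ENNReal.ofReal_ne_top]
    _ = ∫⁻ y, ∫⁻ t in Ioo (0:ℝ) 1, ENNReal.ofReal (t ^ (-(n:ℝ) - 1)) * k t y := by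
        rw [lintegral_lintegral_swap]
        exact hkj.aemeasurable
    _ ≤ ∫⁻ y in D, ENNReal.ofReal ((2 * R) ^ n) *
          (g y * ENNReal.ofReal (‖y - ζ‖ ^ (1 - (n:ℝ)))) := by
        rw [← lintegral_indicator hDm]
        refine lintegral_mono fun y => ?_
        by_cases hy : y ∈ D
        swap
        · have : ∀ t, k t y = 0 := fun t => by simp [k, hy]
          simp [this]
        rw [indicator_of_mem hy]
        rcases eq_or_ne y ζ with rfl | hne
        · have : ∀ t, k t y = 0 := fun t => by
            simp [k, indicator_apply]
          simp [this]
        have hpos : 0 < ‖y - ζ‖ := norm_pos_iff.2 (sub_ne_zero.2 hne)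
        set s := ‖y - ζ‖ with hs
        have hn' : (1:ℝ) ≤ n := by exact_mod_cast hn
        have hint : ∫⁻ t in Ioi (s / (2 * R)), ENNReal.ofReal (t ^ (-(n:ℝ) - 1)) ≤
            ENNReal.ofReal ((s / (2 * R)) ^ (-(n:ℝ))) := by
          have hc : 0 < s / (2 * R) := by positivity
          rw [← ofReal_integral_eq_lintegral_ofReal
            (integrableOn_Ioi_rpow_of_lt (by linarith) hc)
            ((ae_restrict_mem measurableSet_Ioi).mono fun t ht =>
              Real.rpow_nonneg (hc.trans ht).le _),
            integral_Ioi_rpow_of_lt (by linarith) hc]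
          apply ENNReal.ofReal_le_ofReal
          rw [show -(n:ℝ) - 1 + 1 = -(n:ℝ) by ring, neg_div_neg_eq]
          exact div_le_self (by positivity) hn'
        calc ∫⁻ t in Ioo (0:ℝ) 1, ENNReal.ofReal (t ^ (-(n:ℝ) - 1)) * k t y
            ≤ ∫⁻ t in Ioi (s / (2 * R)), ENNReal.ofReal (t ^ (-(n:ℝ) - 1)) * (g y * ‖y - ζ‖ₑ) := by
              rw [← lintegral_indicator measurableSet_Ioo, ← lintegral_indicator measurableSet_Ioi]
              refine lintegral_mono fun t => ?_
              by_cases ht : t ∈ Ioo (0:ℝ) 1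
              swap
              · simp [ht]
              rw [indicator_of_mem ht]
              by_cases hb : y ∈ ball ζ (2 * R * t)
              · have : t ∈ Ioi (s / (2 * R)) := by
                  rw [mem_Ioi, div_lt_iff₀ (by positivity), hs, ← dist_eq_norm]
                  rw [mem_ball] at hb; linarith
                rw [indicator_of_mem this]
                simp only [k]
                rw [indicator_of_mem (mem_inter hy hb)]
              · simp [k, hb]
          _ = (∫⁻ t in Ioi (s / (2 * R)), ENNReal.ofReal (t ^ (-(n:ℝ) - 1))) * (g y * ‖y - ζ‖ₑ) := by
              rw [lintegral_mul_const _ (by fun_prop)]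
          _ ≤ ENNReal.ofReal ((s / (2 * R)) ^ (-(n:ℝ))) * (g y * ‖y - ζ‖ₑ) := by gcongr
          _ = _ := by
              have e1 : ‖y - ζ‖ₑ = ENNReal.ofReal s := by rw [hs, ofReal_norm_eq_enorm]
              have e2 : ENNReal.ofReal ((s / (2 * R)) ^ (-(n:ℝ))) * ENNReal.ofReal s =
                  ENNReal.ofReal ((2 * R) ^ n) * ENNReal.ofReal (s ^ (1 - (n:ℝ))) := by
                rw [← ENNReal.ofReal_mul (by positivity), ← ENNReal.ofReal_mul (by positivity)]
                congr 1
                rw [Real.div_rpow hpos.le (by positivity), Real.rpow_neg (by positivity) (n:ℝ),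
                  Real.rpow_neg (by positivity) (n:ℝ), Real.rpow_natCast, Real.rpow_natCast,
                  Real.rpow_sub hpos, Real.rpow_one, Real.rpow_natCast]
                field_simp
              calc _ = g y * (ENNReal.ofReal ((s / (2 * R)) ^ (-(n:ℝ))) * ENNReal.ofReal s) := by
                    rw [e1]; ring
                _ = _ := by rw [e2]; ring
    _ = _ := by rw [lintegral_const_mul' _ _ ENNReal.ofReal_ne_top]

end EMN
open MeasureTheory Metric Set Filter
open scoped ENNReal Topology

namespace EMN
variable {n : ℕ}

/-- Ahlfors regular setting -/
structure AR (n : ℕ) (d C₀ : ℝ) (Γ : Set (EE n)) : Prop where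
  hd0 : 0 ≤ d
  hd : d < (n:ℝ) - 1
  hC : 0 < C₀
  closed : IsClosed Γ
  ne : Γ.Nonempty
  ar : ∀ x ∈ Γ, ∀ r : ℝ, 0 < r →
      ENNReal.ofReal (C₀⁻¹ * r ^ d) ≤ μH[d] (Γ ∩ ball x r) ∧
      μH[d] (Γ ∩ ball x r) ≤ ENNReal.ofReal (C₀ * r ^ d)

/-- weight -/
noncomputable def wt (d : ℝ) (Γ : Set (EE n)) (X : EE n) : ℝ :=
  Metric.infDist X Γ ^ (d + 1 - (n : ℝ))

/-- weighted measure -/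
noncomputable def nu (d : ℝ) (Γ : Set (EE n)) : Measure (EE n) :=
  volume.withDensity (fun X => ENNReal.ofReal (wt d Γ X))

lemma wt_nonneg (d : ℝ) (Γ : Set (EE n)) (X : EE n) : 0 ≤ wt d Γ X :=
  Real.rpow_nonneg infDist_nonneg _
lemma wt_meas (d : ℝ) (Γ : Set (EE n)) : Measurable (wt d Γ) := by
  unfold wt
  have : Measurable fun X : EE n => Metric.infDist X Γ := (continuous_infDist_pt Γ).measurable
  fun_prop

lemma shells {α : Type*} [MeasurableSpace α] {μ : Measure α} {f : α → ℝ≥0∞} {A : Set α}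
    (hA : MeasurableSet A)
    {B : ℕ → Set α} (hB : ∀ k, MeasurableSet (B k)) (hcov : ∀ x ∈ A, f x ≠ 0 → ∃ k, x ∈ B k)
    {a b : ℕ → ℝ≥0∞} (ha : ∀ k, ∀ x ∈ B k, f x ≤ a k) (hb : ∀ k, μ (B k) ≤ b k) :
    ∫⁻ x in A, f x ∂μ ≤ ∑' k, a k * b k := by
  calc ∫⁻ x in A, f x ∂μ ≤ ∫⁻ x in ⋃ k, B k, f x ∂μ := by
        rw [← lintegral_indicator hA, ← lintegral_indicator (MeasurableSet.iUnion hB)]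
        refine lintegral_mono fun x => ?_
        by_cases hx : x ∈ A
        · by_cases h0 : f x = 0
          · simp [hx, h0]
          · rw [indicator_of_mem hx, indicator_of_mem (mem_iUnion.2 (hcov x hx h0))]
        · simp [hx]
    _ ≤ ∑' k, ∫⁻ x in B k, f x ∂μ := lintegral_iUnion_le _ _
    _ ≤ ∑' k, a k * b k := by
        refine ENNReal.tsum_le_tsum fun k => ?_
        calc _ ≤ ∫⁻ x in B k, a k ∂μ := setLIntegral_mono' (hB k) (ha k)
          _ = a k * μ (B k) := setLIntegral_const _ _
          _ ≤ _ := by gcongr; exact hb k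

lemma meas_ann {α : Type*} [MeasurableSpace α] {f : α → ℝ} (hf : Measurable f) (a b : ℝ) :
    MeasurableSet {x | a ≤ f x ∧ f x < b} :=
  (measurableSet_le measurable_const hf).inter (measurableSet_lt hf measurable_const)

/-- volume of the unit ball -/
noncomputable def vb (n : ℕ) : ℝ := (volume (ball (0 : EE n) 1)).toReal
lemma vb_pos : 0 < vb n := ENNReal.toReal_pos (measure_ball_pos _ _ one_pos).ne'
  measure_ball_lt_top.ne
lemma vol_ball (x : EE n) {r : ℝ} (hr : 0 < r) :
    volume (ball x r) = ENNReal.ofReal (r ^ n * vb n) := by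
  rw [Measure.addHaar_ball_of_pos _ _ hr, ENNReal.ofReal_mul (by positivity), vb,
      ENNReal.ofReal_toReal measure_ball_lt_top.ne]
  simp

lemma tsum_geo {c q : ℝ} (hc : 0 ≤ c) (hq : 0 ≤ q) (hq1 : q < 1) :
    ∑' k : ℕ, ENNReal.ofReal (c * q ^ k) = ENNReal.ofReal (c * (1 - q)⁻¹) := by
  rw [← ENNReal.ofReal_tsum_of_nonneg (fun k => by positivity)
    ((summable_geometric_of_lt_one hq hq1).mul_left c), tsum_mul_left,
    tsum_geometric_of_lt_one hq hq1]

namespace AR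
variable {d C₀ : ℝ} {Γ : Set (EE n)}

lemma two_le (h : AR n d C₀ Γ) : 2 ≤ n := by
  have h1 := h.hd0
  have h2 := h.hd
  have : (1:ℝ) < n := by linarith
  have : 1 < n := by exact_mod_cast this
  omega

lemma infDist_pos (h : AR n d C₀ Γ) {y : EE n} (hy : y ∉ Γ) : 0 < infDist y Γ :=
  (h.closed.notMem_iff_infDist_pos h.ne).1 hy

lemma vol_zero (h : AR n d C₀ Γ) : volume Γ = 0 := by
  have hd : d < (Module.finrank ℝ (EE n) : ℝ) := by
    have := h.hd; simp; linarith
  obtain ⟨x, hx⟩ := h.ne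
  have h1 : ∀ k : ℕ, (μH[(Module.finrank ℝ (EE n) : ℝ)] : Measure (EE n)) (Γ ∩ ball x (k + 1)) = 0 := by
    intro k
    refine (Measure.hausdorffMeasure_zero_or_top hd _).resolve_right fun ht => ?_
    have := (h.ar x hx (k + 1) (by positivity)).2
    rw [ht] at this
    exact absurd this (by simp)
  have h2 : Γ ⊆ ⋃ k : ℕ, Γ ∩ ball x (k + 1) := by
    intro y hy
    obtain ⟨k, hk⟩ := exists_nat_gt (dist y x)
    exact mem_iUnion.2 ⟨k, hy, by rw [mem_ball]; linarith⟩
  have h3 : (μH[(Module.finrank ℝ (EE n) : ℝ)] : Measure (EE n)) Γ = 0 :=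
    measure_mono_null h2 (measure_iUnion_null h1)
  exact Measure.absolutelyContinuous_isAddHaarMeasure (volume : Measure (EE n))
    (μH[(Module.finrank ℝ (EE n) : ℝ)]) h3

lemma potential (h : AR n d C₀ Γ) : ∃ C : ℝ, 0 < C ∧ ∀ y ∉ Γ,
    ∫⁻ ζ in Γ, ENNReal.ofReal (‖y - ζ‖ ^ (1 - (n:ℝ))) ∂μH[d] ≤ ENNReal.ofReal (C * wt d Γ y) := by
  have hd := h.hd
  have hC := h.hC
  set q : ℝ := 2 ^ (d + 1 - (n:ℝ)) with hq
  have hq0 : 0 < q := by positivity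
  have hq1 : q < 1 := Real.rpow_lt_one_of_one_lt_of_neg (by norm_num) (by linarith)
  have hq2 : 0 < (1 - q)⁻¹ := inv_pos.2 (by linarith)
  refine ⟨C₀ * 4 ^ d * (1 - q)⁻¹, by positivity, fun y hy => ?_⟩
  have hs := h.infDist_pos hy
  set s := infDist y Γ with hsdef
  obtain ⟨p, hp, hps⟩ := h.closed.exists_infDist_eq_dist h.ne y
  let B : ℕ → Set (EE n) := fun k => Γ ∩ {ζ | 2 ^ k * s ≤ dist y ζ ∧ dist y ζ < 2 ^ (k + 1) * s}
  have hB : ∀ k, MeasurableSet (B k) := fun k => h.closed.measurableSet.inter (meas_ann (by fun_prop) _ _)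
  refine (shells (a := fun k => ENNReal.ofReal ((2 ^ k * s) ^ (1 - (n:ℝ))))
    (b := fun k => ENNReal.ofReal (C₀ * (4 * 2 ^ k * s) ^ d)) h.closed.measurableSet hB ?_ ?_ ?_).trans ?_
  · intro ζ hζ _
    have : 1 ≤ dist y ζ / s := by
      rw [one_le_div hs]; exact infDist_le_dist_of_mem hζ
    obtain ⟨k, h1, h2⟩ := exists_nat_pow_near this (one_lt_two)
    rw [le_div_iff₀ hs] at h1
    rw [div_lt_iff₀ hs] at h2
    exact ⟨k, hζ, h1, h2⟩
  · intro k ζ hζ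
    apply ENNReal.ofReal_le_ofReal
    rw [← dist_eq_norm]
    exact Real.rpow_le_rpow_of_nonpos (by positivity) hζ.2.1 (by have := h.hd0; linarith)
  · intro k
    refine le_trans (measure_mono ?_) (h.ar p hp _ (by positivity)).2
    intro ζ hζ
    refine ⟨hζ.1, ?_⟩
    rw [mem_ball]
    have h1 := hζ.2.2
    have h2 : dist ζ p ≤ dist y ζ + dist y p := dist_triangle_left ζ p y
    have h3 : (1:ℝ) ≤ 2 ^ k := one_le_pow₀ (by norm_num)
    rw [pow_succ] at h1
    nlinarith
  · rw [show (∑' k : ℕ, ENNReal.ofReal ((2 ^ k * s) ^ (1 - (n:ℝ))) *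
      ENNReal.ofReal (C₀ * (4 * 2 ^ k * s) ^ d)) =
      ∑' k : ℕ, ENNReal.ofReal ((C₀ * 4 ^ d * s ^ (d + 1 - (n:ℝ))) * q ^ k) from ?_]
    · rw [tsum_geo (by positivity) hq0.le hq1]
      apply le_of_eq; congr 1
      rw [wt]; ring
    · congr 1; ext k
      rw [← ENNReal.ofReal_mul (by positivity)]
      congr 1
      rw [Real.mul_rpow (by positivity) hs.le, Real.mul_rpow (by positivity) hs.le,
        Real.mul_rpow (by positivity) (by positivity), show d + 1 - (n:ℝ) = (1 - (n:ℝ)) + d by ring,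
        Real.rpow_add hs, hq, ← Real.rpow_natCast (2 ^ (d + 1 - (n:ℝ)) : ℝ) k, ← Real.rpow_mul (by norm_num),
        ← Real.rpow_natCast 2 k, ← Real.rpow_mul (by norm_num), ← Real.rpow_mul (by norm_num),
        show (d + 1 - (n:ℝ)) * k = (k:ℝ) * (1 - (n:ℝ)) + k * d by ring, Real.rpow_add (by norm_num)]
      ring

lemma leb_potential (hn : 2 ≤ n) : ∃ C : ℝ, 0 < C ∧ ∀ (ζ : EE n) (R : ℝ), 0 < R →
    ∫⁻ y in ball ζ R, ENNReal.ofReal (‖y - ζ‖ ^ (1 - (n:ℝ))) ≤ ENNReal.ofReal (C * R) := by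
  have hvb := vb_pos (n := n)
  have hn' : (2:ℝ) ≤ n := by exact_mod_cast hn
  refine ⟨2 ^ n * vb n * 2, by positivity, fun ζ R hR => ?_⟩
  let B : ℕ → Set (EE n) := fun k => {y | R / 2 ^ (k + 1) ≤ dist y ζ ∧ dist y ζ < R / 2 ^ k}
  have hB : ∀ k, MeasurableSet (B k) := fun k => meas_ann (by fun_prop) _ _
  refine (shells (a := fun k => ENNReal.ofReal ((R / 2 ^ (k + 1)) ^ (1 - (n:ℝ))))
    (b := fun k => ENNReal.ofReal ((R / 2 ^ k) ^ n * vb n)) measurableSet_ball hB ?_ ?_ ?_).trans ?_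
  · intro y hy hne
    have hpos : 0 < dist y ζ := by
      rw [dist_pos]; rintro rfl
      apply hne
      rw [sub_self, norm_zero, Real.zero_rpow (by linarith), ENNReal.ofReal_zero]
    rw [mem_ball] at hy
    have h1 : 1 ≤ R / dist y ζ := by rw [one_le_div hpos]; exact hy.le
    obtain ⟨k, h1, h2⟩ := exists_nat_pow_near h1 (one_lt_two)
    rw [le_div_iff₀ hpos] at h1
    rw [div_lt_iff₀ hpos] at h2
    rcases h1.lt_or_eq with h1 | h1
    · exact ⟨k, by rw [div_le_iff₀ (by positivity)]; linarith, by
        rw [lt_div_iff₀ (by positivity)]; linarith⟩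
    · rcases k with _ | k
      · simp at h1; linarith
      · refine ⟨k, ?_, ?_⟩
        · rw [div_le_iff₀ (by positivity)]; linarith
        · rw [lt_div_iff₀ (by positivity), ← h1, pow_succ]
          have : (0:ℝ) < 2 ^ k := by positivity
          nlinarith
  · intro k y hy
    apply ENNReal.ofReal_le_ofReal
    rw [← dist_eq_norm]
    exact Real.rpow_le_rpow_of_nonpos (by positivity) hy.1 (by linarith)
  · intro k
    rw [← vol_ball ζ (by positivity)]
    exact measure_mono fun y hy => hy.2
  · rw [show (∑' k : ℕ, ENNReal.ofReal ((R / 2 ^ (k + 1)) ^ (1 - (n:ℝ))) *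
      ENNReal.ofReal ((R / 2 ^ k) ^ n * vb n)) =
      ∑' k : ℕ, ENNReal.ofReal ((2 ^ n / 2 * vb n * R) * (1 / 2) ^ k) from ?_]
    · rw [tsum_geo (by positivity) (by norm_num) (by norm_num)]
      apply ENNReal.ofReal_le_ofReal
      have : 0 < 2 ^ n * vb n * R := by positivity
      norm_num
      nlinarith
    · congr 1; ext k
      rw [← ENNReal.ofReal_mul (by positivity)]
      congr 1
      have hx : 0 < R / 2 ^ k := by positivity
      rw [pow_succ, ← div_div, Real.div_rpow hx.le (by norm_num), Real.rpow_sub hx, Real.rpow_one,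
        Real.rpow_sub (by norm_num), Real.rpow_one, Real.rpow_natCast, Real.rpow_natCast]
      field_simp
      simp

lemma nu_ball (h : AR n d C₀ Γ) : ∃ C : ℝ, 0 < C ∧ ∀ x ∈ Γ, ∀ R : ℝ, 0 < R →
    nu d Γ (ball x R) ≤ ENNReal.ofReal (C * R ^ (d + 1)) := by
  obtain ⟨C1, hC1, hpot⟩ := leb_potential h.two_le
  have hC := h.hC
  have hd0 := h.hd0
  have hd := h.hd
  refine ⟨C₀ * 2 ^ n * (C₀ * 3 ^ d) * (C1 * 4), by positivity, fun x hx R hR => ?_⟩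
  have hkc : Measurable fun p : EE n × EE n => ENNReal.ofReal (‖p.1 - p.2‖ ^ (1 - (n:ℝ))) := by
    fun_prop
  have hfinm : μH[d] (Γ ∩ ball x (3 * R)) < ⊤ :=
    (h.ar x hx _ (by positivity)).2.trans_lt ENNReal.ofReal_lt_top
  have hfin : IsFiniteMeasure ((μH[d] : Measure (EE n)).restrict (Γ ∩ ball x (3 * R))) :=
    ⟨by simpa using hfinm⟩
  have hmeas : MeasurableSet (Γ ∩ ball x (3 * R)) := h.closed.measurableSet.inter measurableSet_ball
  rw [nu, withDensity_apply _ measurableSet_ball]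
  calc ∫⁻ y in ball x R, ENNReal.ofReal (wt d Γ y)
      ≤ ∫⁻ y in ball x R, ENNReal.ofReal (C₀ * 2 ^ n) * ∫⁻ ζ in Γ ∩ ball x (3 * R),
          ENNReal.ofReal (‖y - ζ‖ ^ (1 - (n:ℝ))) ∂μH[d] := by
        refine setLIntegral_mono' measurableSet_ball fun y hy => ?_
        by_cases hyΓ : y ∈ Γ
        · rw [wt, infDist_zero_of_mem hyΓ, Real.zero_rpow (by linarith)]; simp
        have hs := h.infDist_pos hyΓ
        set s := infDist y Γ with hsdef
        obtain ⟨p, hp, hps⟩ := h.closed.exists_infDist_eq_dist h.ne y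
        have hsR : s < R := lt_of_le_of_lt (infDist_le_dist_of_mem hx) hy
        have hsub : Γ ∩ ball p s ⊆ Γ ∩ ball x (3 * R) := by
          intro ζ hζ
          refine ⟨hζ.1, ?_⟩
          have h1 := hζ.2
          rw [mem_ball] at h1 hy ⊢
          have h2 := dist_triangle4 ζ p y x
          rw [dist_comm p y] at h2
          linarith
        have hlow : ENNReal.ofReal ((2 * s) ^ (1 - (n:ℝ)) * (C₀⁻¹ * s ^ d)) ≤
            ∫⁻ ζ in Γ ∩ ball x (3 * R), ENNReal.ofReal (‖y - ζ‖ ^ (1 - (n:ℝ))) ∂μH[d] := by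
          calc _ = ENNReal.ofReal ((2 * s) ^ (1 - (n:ℝ))) * ENNReal.ofReal (C₀⁻¹ * s ^ d) :=
                ENNReal.ofReal_mul (by positivity)
            _ ≤ ENNReal.ofReal ((2 * s) ^ (1 - (n:ℝ))) * μH[d] (Γ ∩ ball p s) := by
                gcongr; exact (h.ar p hp s hs).1
            _ = ∫⁻ ζ in Γ ∩ ball p s, ENNReal.ofReal ((2 * s) ^ (1 - (n:ℝ))) ∂μH[d] := by
                rw [setLIntegral_const]
            _ ≤ ∫⁻ ζ in Γ ∩ ball p s, ENNReal.ofReal (‖y - ζ‖ ^ (1 - (n:ℝ))) ∂μH[d] := by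
                refine setLIntegral_mono' (h.closed.measurableSet.inter measurableSet_ball)
                  fun ζ hζ => ?_
                apply ENNReal.ofReal_le_ofReal
                rw [← dist_eq_norm]
                have h1 := hζ.2
                rw [mem_ball] at h1
                have h2 : s ≤ dist y ζ := infDist_le_dist_of_mem hζ.1
                have h3 := dist_triangle_right y ζ p
                exact Real.rpow_le_rpow_of_nonpos (by linarith) (by linarith) (by linarith)
            _ ≤ _ := lintegral_mono_set hsub
        calc ENNReal.ofReal (wt d Γ y) ≤ ENNReal.ofReal ((C₀ * 2 ^ n) *
              ((2 * s) ^ (1 - (n:ℝ)) * (C₀⁻¹ * s ^ d))) := by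
              apply ENNReal.ofReal_le_ofReal
              rw [wt, ← hsdef, Real.mul_rpow (by norm_num) hs.le,
                show d + 1 - (n:ℝ) = (1 - (n:ℝ)) + d by ring, Real.rpow_add hs,
                Real.rpow_sub (by norm_num : (0:ℝ) < 2), Real.rpow_one, Real.rpow_natCast]
              have : 0 < s ^ (1 - (n:ℝ)) * s ^ d := by positivity
              field_simp
              linarith
          _ ≤ _ := by
              rw [ENNReal.ofReal_mul (by positivity)]
              gcongr
    _ = ENNReal.ofReal (C₀ * 2 ^ n) * ∫⁻ ζ in Γ ∩ ball x (3 * R), ∫⁻ y in ball x R,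
          ENNReal.ofReal (‖y - ζ‖ ^ (1 - (n:ℝ))) ∂volume ∂μH[d] := by
        rw [lintegral_const_mul' _ _ ENNReal.ofReal_ne_top, lintegral_lintegral_swap]
        exact hkc.aemeasurable
    _ ≤ ENNReal.ofReal (C₀ * 2 ^ n) * ∫⁻ ζ in Γ ∩ ball x (3 * R), ENNReal.ofReal (C1 * (4 * R)) ∂μH[d] := by
        refine mul_le_mul' le_rfl ?_
        refine setLIntegral_mono' hmeas fun ζ hζ => ?_
        refine le_trans (lintegral_mono_set ?_) (hpot ζ (4 * R) (by positivity))
        apply ball_subset_ball'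
        have := hζ.2
        rw [mem_ball, dist_comm] at this
        linarith
    _ ≤ ENNReal.ofReal (C₀ * 2 ^ n) * (ENNReal.ofReal (C1 * (4 * R)) * ENNReal.ofReal (C₀ * (3 * R) ^ d)) := by
        rw [setLIntegral_const]
        gcongr
        exact (h.ar x hx _ (by positivity)).2
    _ = _ := by
        rw [← ENNReal.ofReal_mul (by positivity), ← ENNReal.ofReal_mul (by positivity)]
        congr 1
        rw [Real.mul_rpow (by norm_num) hR.le, Real.rpow_add hR, Real.rpow_one]
        ring

lemma ae_notMem (h : AR n d C₀ Γ) : ∀ᵐ x : EE n, x ∉ Γ := by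
  rw [ae_iff]; simpa using h.vol_zero

lemma F3raw (h : AR n d C₀ Γ) : ∃ C : ℝ, 0 < C ∧ ∀ z ∈ Γ, ∀ R : ℝ, 0 < R → ∀ f : EE n → ℝ,
    ContDiff ℝ 1 f → (∀ ζ ∈ Γ ∩ ball z R, f ζ = 0) →
    ∫⁻ y in ball z R, ‖f y‖ₑ ≤
      ENNReal.ofReal (C * R ^ ((n:ℝ) - d)) * ∫⁻ y in ball z R, ‖fderiv ℝ f y‖ₑ ∂(nu d Γ) := by
  obtain ⟨C1, hC1, hpot⟩ := h.potential
  have hC := h.hC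
  refine ⟨C₀ * 2 ^ n * C1, by positivity, fun z hz R hR f hf hf0 => ?_⟩
  have hmeas : MeasurableSet (Γ ∩ ball z R) := h.closed.measurableSet.inter measurableSet_ball
  have hfinm : μH[d] (Γ ∩ ball z R) < ⊤ :=
    (h.ar z hz _ (by positivity)).2.trans_lt ENNReal.ofReal_lt_top
  have hfin : IsFiniteMeasure ((μH[d] : Measure (EE n)).restrict (Γ ∩ ball z R)) :=
    ⟨by simpa using hfinm⟩
  set g : EE n → ℝ≥0∞ := fun y => ‖fderiv ℝ f y‖ₑ with hgdef
  have hgm : Measurable g := (seg_meas hf).measurable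
  have hkc : Measurable fun p : EE n × EE n => g p.2 * ENNReal.ofReal (‖p.2 - p.1‖ ^ (1 - (n:ℝ))) :=
    (hgm.comp measurable_snd).mul (by fun_prop)
  have key : ENNReal.ofReal (C₀⁻¹ * R ^ d) * ∫⁻ y in ball z R, ‖f y‖ₑ ≤
      ENNReal.ofReal ((2 * R) ^ n * C1) * ∫⁻ y in ball z R, g y ∂(nu d Γ) := by
    calc _ ≤ μH[d] (Γ ∩ ball z R) * ∫⁻ y in ball z R, ‖f y‖ₑ := by
          gcongr; exact (h.ar z hz R hR).1
      _ = ∫⁻ ζ in Γ ∩ ball z R, (∫⁻ y in ball z R, ‖f y‖ₑ) ∂μH[d] := by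
          rw [setLIntegral_const, mul_comm]
      _ ≤ ∫⁻ ζ in Γ ∩ ball z R, ENNReal.ofReal ((2 * R) ^ n) *
            ∫⁻ y in ball z R, g y * ENNReal.ofReal (‖y - ζ‖ ^ (1 - (n:ℝ))) ∂volume ∂μH[d] := by
          refine setLIntegral_mono' hmeas fun ζ hζ => ?_
          have := Plem (by have := h.two_le; omega) hζ.2 hf
          simpa only [hf0 ζ hζ, sub_zero] using this
      _ = ENNReal.ofReal ((2 * R) ^ n) * ∫⁻ y in ball z R, ∫⁻ ζ in Γ ∩ ball z R,
            g y * ENNReal.ofReal (‖y - ζ‖ ^ (1 - (n:ℝ))) ∂μH[d] := by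
          rw [lintegral_const_mul' _ _ ENNReal.ofReal_ne_top, lintegral_lintegral_swap]
          exact hkc.aemeasurable
      _ ≤ ENNReal.ofReal ((2 * R) ^ n) * ∫⁻ y in ball z R,
            ENNReal.ofReal C1 * (ENNReal.ofReal (wt d Γ y) * g y) := by
          refine mul_le_mul' le_rfl ?_
          refine lintegral_mono_ae ?_
          filter_upwards [ae_restrict_of_ae h.ae_notMem] with y hy
          rw [lintegral_const_mul _ (by fun_prop)]
          calc _ ≤ g y * ENNReal.ofReal (C1 * wt d Γ y) := by
                gcongr
                exact (lintegral_mono_set inter_subset_left).trans (hpot y hy)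
            _ = _ := by rw [ENNReal.ofReal_mul hC1.le]; ring
      _ = _ := by
          rw [lintegral_const_mul' _ _ ENNReal.ofReal_ne_top, nu,
            setLIntegral_withDensity_eq_setLIntegral_mul _ (wt_meas d Γ).ennreal_ofReal hgm
              measurableSet_ball, ENNReal.ofReal_mul (by positivity)]
          simp only [Pi.mul_apply]
          ring
  have h1 : ENNReal.ofReal (C₀ * R ^ (-d)) * ENNReal.ofReal (C₀⁻¹ * R ^ d) = 1 := by
    rw [← ENNReal.ofReal_mul (by positivity), Real.rpow_neg hR.le, ← ENNReal.ofReal_one]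
    congr 1
    have : 0 < R ^ d := by positivity
    field_simp
  calc ∫⁻ y in ball z R, ‖f y‖ₑ = ENNReal.ofReal (C₀ * R ^ (-d)) *
        (ENNReal.ofReal (C₀⁻¹ * R ^ d) * ∫⁻ y in ball z R, ‖f y‖ₑ) := by
        rw [← mul_assoc, h1, one_mul]
    _ ≤ ENNReal.ofReal (C₀ * R ^ (-d)) *
        (ENNReal.ofReal ((2 * R) ^ n * C1) * ∫⁻ y in ball z R, g y ∂(nu d Γ)) := by gcongr
    _ = _ := by
        rw [← mul_assoc, ← ENNReal.ofReal_mul (by positivity)]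
        congr 2
        rw [mul_pow, Real.rpow_sub hR, Real.rpow_natCast, Real.rpow_neg hR.le]
        have : 0 < R ^ d := by positivity
        field_simp

end AR
end EMN
open MeasureTheory Metric Set Filter
open scoped ENNReal Topology

namespace EMN
variable {n : ℕ}

lemma exists_mean {α : Type*} [MeasurableSpace α] (μ : Measure α) :
    ∃ M : (α → ℝ) →ₗ[ℝ] ℝ, (∀ f, Integrable f μ → M f = ∫ x, f x ∂μ) ∧
      ∀ h F : α → ℝ, Integrable F μ → (∀ᵐ x ∂μ, 0 ≤ h x) → (∀ᵐ x ∂μ, h x ≤ F x) → 0 ≤ M h := by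
  let V : Submodule ℝ (α → ℝ) :=
    { carrier := {h | ∃ F : α → ℝ, Integrable F μ ∧ ∀ᵐ x ∂μ, |h x| ≤ F x}
      add_mem' := by
        rintro a b ⟨F, hF, ha⟩ ⟨G, hG, hb⟩
        refine ⟨F + G, hF.add hG, ?_⟩
        filter_upwards [ha, hb] with x h1 h2
        exact (abs_add_le _ _).trans (add_le_add h1 h2)
      zero_mem' := ⟨0, integrable_zero _ _ _, by simp⟩
      smul_mem' := by
        rintro c a ⟨F, hF, ha⟩
        refine ⟨|c| • F, hF.smul _, ?_⟩
        filter_upwards [ha] with x h1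
        simp only [Pi.smul_apply, smul_eq_mul, abs_mul]
        gcongr }
  let I : Submodule ℝ V :=
    { carrier := {h | Integrable (h : α → ℝ) μ}
      add_mem' := by intro a b ha hb; exact Integrable.add ha hb
      zero_mem' := integrable_zero _ _ _
      smul_mem' := by intro c a ha; exact Integrable.smul c ha }
  let f : V →ₗ.[ℝ] ℝ := ⟨I,
    { toFun := fun h => ∫ x, (h : V).1 x ∂μ
      map_add' := by intro a b; exact integral_add a.2 b.2
      map_smul' := by intro c a; exact integral_smul c _ }⟩
  let s : PointedCone ℝ V :=
    { carrier := {h | ∀ᵐ x ∂μ, 0 ≤ (h : α → ℝ) x}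
      add_mem' := by
        intro a b ha hb
        change ∀ᵐ x ∂μ, 0 ≤ a.1 x + b.1 x
        filter_upwards [ha, hb] with x h1 h2
        exact add_nonneg h1 h2
      zero_mem' := by simp
      smul_mem' := by
        intro c a ha
        change ∀ᵐ x ∂μ, 0 ≤ c.1 * a.1 x
        filter_upwards [ha] with x h1
        exact mul_nonneg c.2 h1 }
  obtain ⟨g, hg1, hg2⟩ := riesz_extension s f
    (by
      intro x hx
      exact integral_nonneg_of_ae hx)
    (by
      rintro ⟨y, F, hF, hy⟩
      refine ⟨⟨⟨F, F, hF, ?_⟩, hF⟩, ?_⟩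
      · filter_upwards [hy] with x hx
        rw [abs_of_nonneg ((abs_nonneg _).trans hx)]
      · change ∀ᵐ x ∂μ, 0 ≤ F x + y x
        filter_upwards [hy] with x hx
        linarith [(abs_le.1 hx).1])
  obtain ⟨M, hM⟩ := LinearMap.exists_extend g
  have hMV : ∀ h : V, M h.1 = g h := fun h => by rw [← hM]; rfl
  refine ⟨M, fun h hh => ?_, fun h F hF h0 hF' => ?_⟩
  · have hV : h ∈ V := ⟨fun x => |h x|, hh.abs, by simp⟩
    have := hg1 ⟨⟨h, hV⟩, hh⟩
    rw [hMV ⟨h, hV⟩]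
    exact this
  · have hV : h ∈ V := by
      refine ⟨F, hF, ?_⟩
      filter_upwards [h0, hF'] with x h1 h2
      rwa [abs_of_nonneg h1]
    rw [hMV ⟨h, hV⟩]
    exact hg2 _ h0

/-- positive extension of the integral -/
structure Mean {α : Type*} [MeasurableSpace α] (μ : Measure α) where
  M : (α → ℝ) →ₗ[ℝ] ℝ
  int : ∀ f, Integrable f μ → M f = ∫ x, f x ∂μ
  pos : ∀ h F : α → ℝ, Integrable F μ → (∀ᵐ x ∂μ, 0 ≤ h x) → (∀ᵐ x ∂μ, h x ≤ F x) → 0 ≤ M h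

namespace Mean
variable {α : Type*} [MeasurableSpace α] {μ : Measure α} (m : Mean μ)

lemma bound {h F : α → ℝ} (hF : Integrable F μ) (hb : ∀ᵐ x ∂μ, |h x| ≤ F x) :
    |m.M h| ≤ ∫ x, F x ∂μ := by
  rw [← m.int F hF, abs_le]
  constructor
  · have := m.pos (F + h) (F + F) (hF.add hF)
      (by filter_upwards [hb] with x hx; simp; linarith [(abs_le.1 hx).1])
      (by filter_upwards [hb] with x hx; simp; linarith [(abs_le.1 hx).2])
    rw [map_add] at this; linarith
  · have := m.pos (F - h) (F + F) (hF.add hF)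
      (by filter_upwards [hb] with x hx; simp; linarith [(abs_le.1 hx).2])
      (by filter_upwards [hb] with x hx; simp; linarith [(abs_le.1 hx).1])
    rw [map_sub] at this; linarith

lemma congr {h k : α → ℝ} (hk : ∀ᵐ x ∂μ, h x = k x) : m.M h = m.M k := by
  have := m.bound (h := h - k) (F := 0) (integrable_zero _ _ _)
    (by filter_upwards [hk] with x hx; simp [hx])
  simp only [Pi.zero_apply, integral_zero] at this
  have := abs_nonpos_iff.1 this
  rw [map_sub] at this; linarith

/-- lower bound by an integrable function -/
lemma le_of {h f F : α → ℝ} (hf : Integrable f μ) (hF : Integrable F μ)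
    (h1 : ∀ᵐ x ∂μ, f x ≤ h x) (h2 : ∀ᵐ x ∂μ, h x ≤ F x) : ∫ x, f x ∂μ ≤ m.M h := by
  have := m.pos (h - f) (F - f) (hF.sub hf)
      (by filter_upwards [h1] with x hx; simpa using hx)
      (by filter_upwards [h2] with x hx; simpa using hx)
  rw [map_sub, m.int f hf] at this; linarith
end Mean

section LM
variable {α E : Type*} [MeasurableSpace α] {μ : Measure α} [NormedAddCommGroup E]
  [InnerProductSpace ℝ E]

lemma int_norm_mul (F H : Lp E 2 μ) : Integrable (fun x => ‖F x‖ * ‖H x‖) μ ∧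
    ∫ x, ‖F x‖ * ‖H x‖ ∂μ ≤ ‖F‖ * ‖H‖ := by
  have hF := (Lp.memLp F).norm
  have hH := (Lp.memLp H).norm
  refine ⟨hF.integrable_mul hH, ?_⟩
  have h1 := real_inner_le_norm (hF.toLp _) (hH.toLp _)
  rw [Lp.norm_toLp, Lp.norm_toLp, eLpNorm_norm, eLpNorm_norm, ← Lp.norm_def, ← Lp.norm_def,
    L2.inner_def] at h1
  refine le_trans (le_of_eq (integral_congr_ae ?_)) h1
  filter_upwards [hF.coeFn_toLp, hH.coeFn_toLp] with x e1 e2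
  rw [e1, e2]
  simp [mul_comm]

lemma int_norm_sq (F : Lp E 2 μ) : ∫ x, ‖F x‖ ^ 2 ∂μ = ‖F‖ ^ 2 := by
  rw [← real_inner_self_eq_norm_sq, L2.inner_def]
  simp

/-- Lax-Milgram -/
lemma lax [CompleteSpace E] (m : Mean μ) (a : α → E →ₗ[ℝ] E →ₗ[ℝ] ℝ) {c C : ℝ} (hc : 0 < c) (hC : 0 ≤ C)
    (ha1 : ∀ᵐ x ∂μ, ∀ ξ, c * ‖ξ‖ ^ 2 ≤ a x ξ ξ)
    (ha2 : ∀ᵐ x ∂μ, ∀ ξ ζ, |a x ξ ζ| ≤ C * (‖ξ‖ * ‖ζ‖))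
    (K0 : Submodule ℝ (Lp E 2 μ)) (g : Lp E 2 μ) :
    ∃ G : Lp E 2 μ, (∀ ε > 0, ∃ F ∈ K0, ‖F + g - G‖ < ε) ∧
      ∀ Ψ ∈ K0, m.M (fun x => a x (G x) (Ψ x)) = 0 := by
  have hbd : ∀ F H : Lp E 2 μ, |m.M (fun x => a x (F x) (H x))| ≤ C * ‖F‖ * ‖H‖ := by
    intro F H
    have h1 := int_norm_mul F H
    have := m.bound (h := fun x => a x (F x) (H x)) (h1.1.const_mul C)
      (by filter_upwards [ha2] with x hx using hx _ _)
    rw [integral_const_mul] at this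
    refine this.trans ?_
    rw [mul_assoc]
    exact mul_le_mul_of_nonneg_left h1.2 hC
  let B0 : Lp E 2 μ →ₗ[ℝ] Lp E 2 μ →ₗ[ℝ] ℝ := LinearMap.mk₂ ℝ
    (fun F H => m.M (fun x => a x (F x) (H x)))
    (by
      intro F F' H
      rw [← map_add]
      apply m.congr
      filter_upwards [Lp.coeFn_add F F'] with x hx
      rw [hx]; simp)
    (by
      intro c F H
      rw [← map_smul]
      apply m.congr
      filter_upwards [Lp.coeFn_smul c F] with x hx
      simp [hx])
    (by
      intro H F F'
      rw [← map_add]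
      apply m.congr
      filter_upwards [Lp.coeFn_add F F'] with x hx
      rw [hx]; simp)
    (by
      intro c H F
      rw [← map_smul]
      apply m.congr
      filter_upwards [Lp.coeFn_smul c F] with x hx
      simp [hx])
  let B : Lp E 2 μ →L[ℝ] Lp E 2 μ →L[ℝ] ℝ := LinearMap.mkContinuous₂ B0 C hbd
  have hB : ∀ F H, B F H = m.M (fun x => a x (F x) (H x)) := fun F H => rfl
  let K := K0.topologicalClosure
  have : CompleteSpace K := (Submodule.isClosed_topologicalClosure K0).completeSpace_coe
  let BK : K →L[ℝ] K →L[ℝ] ℝ := (B.bilinearComp K.subtypeL K.subtypeL)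
  have hBK : ∀ F H : K, BK F H = B F H := fun F H => rfl
  have hco : IsCoercive BK := by
    refine ⟨c, hc, fun F => ?_⟩
    rw [hBK, hB]
    have h1 := int_norm_mul (F : Lp E 2 μ) F
    have h2 := m.le_of (h := fun x => a x ((F : Lp E 2 μ) x) ((F : Lp E 2 μ) x)) (f := fun x => c * (‖(F : Lp E 2 μ) x‖ * ‖(F : Lp E 2 μ) x‖))
      (h1.1.const_mul c) (h1.1.const_mul C)
      (by filter_upwards [ha1] with x hx; have := hx ((F : Lp E 2 μ) x); rw [pow_two] at this; exact this)
      (by filter_upwards [ha2] with x hx using (le_abs_self _).trans (hx _ _))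
    refine le_trans (le_of_eq ?_) h2
    rw [integral_const_mul]
    simp_rw [← pow_two]
    rw [int_norm_sq, mul_assoc, ← pow_two]
    rfl
  let Lf : K →L[ℝ] ℝ := (B g).comp K.subtypeL
  let v : K := (InnerProductSpace.toDual ℝ K).symm (-Lf)
  let G0 : K := hco.continuousLinearEquivOfBilin.symm v
  have hG0 : ∀ w : K, B G0 w = - B g w := by
    intro w
    rw [← hBK, ← hco.continuousLinearEquivOfBilin_apply]
    simp [G0, v, Lf]
  refine ⟨G0 + g, fun ε hε => ?_, fun Ψ hΨ => ?_⟩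
  · have := G0.2
    have h2 : (G0 : Lp E 2 μ) ∈ closure (K0 : Set (Lp E 2 μ)) := by
      rw [← Submodule.topologicalClosure_coe]; exact this
    obtain ⟨F, hF, hd⟩ := Metric.mem_closure_iff.1 h2 ε hε
    refine ⟨F, hF, ?_⟩
    rw [add_sub_add_right_eq_sub, ← dist_eq_norm, dist_comm]
    exact hd
  · have h3 := hG0 ⟨Ψ, K0.le_topologicalClosure hΨ⟩
    rw [← hB, map_add]
    simp only [ContinuousLinearMap.add_apply]
    rw [h3]; simp
end LM
end EMN
open MeasureTheory Metric Set Filter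
open scoped ENNReal Topology

namespace EMN
variable {n : ℕ}

/-- gradient vector -/
noncomputable def gr (f : EE n → ℝ) (x : EE n) : EE n :=
  (InnerProductSpace.toDual ℝ (EE n)).symm (fderiv ℝ f x)

lemma norm_gr (f : EE n → ℝ) (x : EE n) : ‖gr f x‖ = ‖fderiv ℝ f x‖ := by simp [gr]
lemma enorm_gr (f : EE n → ℝ) (x : EE n) : ‖gr f x‖ₑ = ‖fderiv ℝ f x‖ₑ := by
  rw [← ofReal_norm, norm_gr, ofReal_norm]
lemma gr_coord (f : EE n → ℝ) (x : EE n) (i : Fin n) :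
    gr f x i = fderiv ℝ f x (EuclideanSpace.single i 1) := by
  have := InnerProductSpace.toDual_symm_apply (𝕜 := ℝ) (x := (EuclideanSpace.single i 1 : EE n))
    (y := fderiv ℝ f x)
  rw [← this, EuclideanSpace.inner_single_right]
  simp [gr]
lemma gr_cont {f : EE n → ℝ} (hf : ContDiff ℝ 1 f) : Continuous (gr f) :=
  (LinearIsometryEquiv.continuous _).comp (hf.continuous_fderiv one_ne_zero)
lemma gr_add {f g : EE n → ℝ} (hf : ContDiff ℝ 1 f) (hg : ContDiff ℝ 1 g) (x : EE n) :
    gr (f + g) x = gr f x + gr g x := by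
  rw [gr, fderiv_add (hf.differentiable one_ne_zero x) (hg.differentiable one_ne_zero x), map_add]; rfl
lemma gr_sub {f g : EE n → ℝ} (hf : ContDiff ℝ 1 f) (hg : ContDiff ℝ 1 g) (x : EE n) :
    gr (f - g) x = gr f x - gr g x := by
  rw [gr, fderiv_sub (hf.differentiable one_ne_zero x) (hg.differentiable one_ne_zero x), map_sub]; rfl
lemma gr_smul {f : EE n → ℝ} (hf : ContDiff ℝ 1 f) (c : ℝ) (x : EE n) :
    gr (c • f) x = c • gr f x := by
  rw [gr, fderiv_const_smul (hf.differentiable one_ne_zero x)]; simp [gr]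
lemma gr_mul {f g : EE n → ℝ} (hf : ContDiff ℝ 1 f) (hg : ContDiff ℝ 1 g) (x : EE n) :
    gr (fun y => f y * g y) x = f x • gr g x + g x • gr f x := by
  rw [gr, fderiv_fun_mul (hf.differentiable one_ne_zero x) (hg.differentiable one_ne_zero x)]; simp [gr]
lemma gr_comp {f : EE n → ℝ} {β : ℝ → ℝ} (hf : ContDiff ℝ 1 f) (hβ : ContDiff ℝ 1 β) (x : EE n) :
    gr (fun y => β (f y)) x = deriv β (f x) • gr f x := by
  have : HasFDerivAt (fun y => β (f y)) (deriv β (f x) • fderiv ℝ f x) x :=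
    ((hβ.differentiable one_ne_zero (f x)).hasDerivAt).comp_hasFDerivAt x
      (hf.differentiable one_ne_zero x).hasFDerivAt
  rw [gr, this.fderiv]; simp [gr]
lemma gr_compact {f : EE n → ℝ} (hf : HasCompactSupport f) : HasCompactSupport (gr f) :=
  (hf.fderiv ℝ).comp_left (g := fun l => (InnerProductSpace.toDual ℝ (EE n)).symm l) (map_zero _)

/-- admissible test functions -/
structure Adm (Γ : Set (EE n)) (φ : EE n → ℝ) : Prop where
  cd : ContDiff ℝ 1 φ
  cs : HasCompactSupport φ
  ts : tsupport φ ⊆ Γᶜ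

namespace Adm
variable {Γ : Set (EE n)} {φ ψ : EE n → ℝ}
lemma of_supp (hφ : Adm Γ φ) (hψ : ContDiff ℝ 1 ψ) (hs : ∀ x, x ∉ tsupport φ → ψ x = 0) :
    Adm Γ ψ := by
  have h1 : Function.support ψ ⊆ tsupport φ := by
    intro x hx; by_contra h; exact hx (hs x h)
  have h2 : tsupport ψ ⊆ tsupport φ := closure_minimal h1 (isClosed_tsupport φ)
  exact ⟨hψ, HasCompactSupport.of_support_subset_isCompact hφ.cs h1, h2.trans hφ.ts⟩
lemma add (hφ : Adm Γ φ) (hψ : Adm Γ ψ) : Adm Γ (φ + ψ) :=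
  ⟨hφ.cd.add hψ.cd, hφ.cs.add hψ.cs, (tsupport_add φ ψ).trans (union_subset hφ.ts hψ.ts)⟩
lemma smul (hφ : Adm Γ φ) (c : ℝ) : Adm Γ (c • φ) :=
  hφ.of_supp (hφ.cd.const_smul c) fun x hx => by simp [image_eq_zero_of_notMem_tsupport hx]
lemma zero : Adm Γ (0 : EE n → ℝ) :=
  ⟨contDiff_const, HasCompactSupport.zero, by simp [tsupport]⟩
lemma sub (hφ : Adm Γ φ) (hψ : Adm Γ ψ) : Adm Γ (φ - ψ) := by
  have := hφ.add (hψ.smul (-1))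
  rwa [neg_one_smul, ← sub_eq_add_neg] at this
lemma eq_zero (hφ : Adm Γ φ) {x : EE n} (hx : x ∈ Γ) : φ x = 0 :=
  image_eq_zero_of_notMem_tsupport fun h => hφ.ts h hx
end Adm

namespace AR
variable {d C₀ : ℝ} {Γ : Set (EE n)}

lemma nu_ac : nu d Γ ≪ volume := withDensity_absolutelyContinuous _ _
lemma wt_pos (h : AR n d C₀ Γ) {y : EE n} (hy : y ∉ Γ) : 0 < wt d Γ y :=
  Real.rpow_pos_of_pos (h.infDist_pos hy) _
lemma ac_nu (h : AR n d C₀ Γ) : volume ≪ nu d Γ := by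
  refine withDensity_absolutelyContinuous' (wt_meas d Γ).ennreal_ofReal.aemeasurable ?_
  filter_upwards [h.ae_notMem] with x hx
  simpa using h.wt_pos hx
lemma nu_ball_lt (h : AR n d C₀ Γ) (x : EE n) (R : ℝ) : nu d Γ (ball x R) < ⊤ := by
  obtain ⟨C, hC, hb⟩ := h.nu_ball
  obtain ⟨z, hz⟩ := h.ne
  refine lt_of_le_of_lt (measure_mono (ball_subset_ball' (ε₂ := |R| + dist x z + 1) (y := z) ?_))
    ((hb z hz (|R| + dist x z + 1) (by positivity)).trans_lt ENNReal.ofReal_lt_top)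
  linarith [le_abs_self R]
lemma fmc (h : AR n d C₀ Γ) : IsFiniteMeasureOnCompacts (nu d Γ) := by
  refine ⟨fun K hK => ?_⟩
  obtain ⟨z, hz⟩ := h.ne
  obtain ⟨R, hR⟩ := hK.isBounded.subset_ball z
  exact (measure_mono hR).trans_lt (h.nu_ball_lt z R)
end AR

lemma summ {α : Type*} [MeasurableSpace α] {μ : Measure α} {q : ℕ → α → ℝ}
    (hq : ∀ k, Integrable (q k) μ) (h0 : ∀ k x, 0 ≤ q k x) (hs : Summable fun k => ∫ x, q k x ∂μ) :
    (∀ᵐ x ∂μ, Summable (fun k => q k x)) ∧ Integrable (fun x => ∑' k, q k x) μ := by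
  have hm : ∀ k, AEMeasurable (fun x => ENNReal.ofReal (q k x)) μ :=
    fun k => (hq k).aestronglyMeasurable.aemeasurable.ennreal_ofReal
  have h1 : ∫⁻ x, ∑' k, ENNReal.ofReal (q k x) ∂μ ≠ ⊤ := by
    rw [lintegral_tsum hm]
    simp_rw [← ofReal_integral_eq_lintegral_ofReal (hq _) (Eventually.of_forall (h0 _))]
    rw [← ENNReal.ofReal_tsum_of_nonneg (fun k => integral_nonneg (h0 k)) hs]
    exact ENNReal.ofReal_ne_top
  have hM : AEMeasurable (fun x => ∑' k, ENNReal.ofReal (q k x)) μ := AEMeasurable.ennreal_tsum hm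
  constructor
  · filter_upwards [ae_lt_top' hM h1] with x hx
    have := ENNReal.summable_toReal hx.ne
    simpa only [ENNReal.toReal_ofReal (h0 _ x)] using this
  · have := integrable_toReal_of_lintegral_ne_top hM h1
    refine this.congr (Eventually.of_forall fun x => ?_)
    simp only
    rw [ENNReal.tsum_toReal_eq (fun _ => ENNReal.ofReal_ne_top)]
    simp only [ENNReal.toReal_ofReal (h0 _ x)]

/-- bilinear form with ellipticity -/
structure Frm (d Λ : ℝ) (Γ : Set (EE n)) (a : EE n → EE n →ₗ[ℝ] EE n →ₗ[ℝ] ℝ) : Prop where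
  hΛ : 0 < Λ
  lo : ∀ x ∉ Γ, ∀ ξ, Λ⁻¹ * ‖ξ‖ ^ 2 ≤ a x ξ ξ
  up : ∀ x ∉ Γ, ∀ ξ ζ, |a x ξ ζ| ≤ Λ * (‖ξ‖ * ‖ζ‖)

/-- raw solution data -/
structure Raw (d : ℝ) (Γ : Set (EE n)) (a : EE n → EE n →ₗ[ℝ] EE n →ₗ[ℝ] ℝ) (m : Mean (nu d Γ))
    (g u : EE n → ℝ) (G : EE n → EE n) (uk : ℕ → EE n → ℝ) (Q : EE n → ℝ) : Prop where
  gc : ContDiff ℝ 1 g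
  gs : HasCompactSupport g
  um : StronglyMeasurable u
  Gm : StronglyMeasurable G
  adm : ∀ k, Adm Γ (uk k - g)
  Qi : Integrable Q (nu d Γ)
  Qb : ∀ᵐ x, ∀ k, ‖gr (uk k) x‖ ^ 2 ≤ Q x
  ulim : ∀ᵐ x, Tendsto (fun k => uk k x) atTop (𝓝 (u x))
  Glim : ∀ᵐ x, Tendsto (fun k => gr (uk k) x) atTop (𝓝 (G x))
  sol : ∀ φ, Adm Γ φ → m.M (fun x => a x (G x) (gr φ x)) = 0

lemma raw_lim {d C₀ : ℝ} {Γ : Set (EE n)} (h : AR n d C₀ Γ)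
    {g : EE n → ℝ} (gc : ContDiff ℝ 1 g) {φ : ℕ → EE n → ℝ} (hφ : ∀ k, Adm Γ (φ k))
    {G : EE n → EE n} (hGm : StronglyMeasurable G)
    (hqi : ∀ k, Integrable (fun x => ‖gr (φ k + g) x - G x‖ ^ 2) (nu d Γ))
    (hqb : ∀ k, ∫ x, ‖gr (φ k + g) x - G x‖ ^ 2 ∂(nu d Γ) ≤ (1/4) ^ k) :
    ∀ᵐ x, ∃ l, Tendsto (fun k => φ k x) atTop (𝓝 l) := by
  obtain ⟨uk, huk⟩ : ∃ uk : ℕ → EE n → ℝ, uk = fun k => φ k + g := ⟨_, rfl⟩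
  have hukk : ∀ k, uk k = φ k + g := fun k => by rw [huk]
  simp only [← hukk] at hqi hqb
  have ukc : ∀ k, ContDiff ℝ 1 (uk k) := fun k => by rw [huk]; exact (hφ k).cd.add gc
  obtain ⟨C, hC, hF3⟩ := h.F3raw
  obtain ⟨z, hz⟩ := h.ne
  have key : ∀ N : ℕ, ∀ᵐ x ∂(volume.restrict (ball z (N + 1))),
      ∃ l, Tendsto (fun k => φ k x) atTop (𝓝 l) := by
    intro N
    set V := nu d Γ (ball z (N + 1)) with hV
    have hVt : V ≠ ⊤ := (h.nu_ball_lt z _).ne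
    have hb : ∀ k, ∫⁻ x in ball z (N + 1), ‖(φ (k+1) - φ k) x‖ₑ ≤
        ENNReal.ofReal (C * ((N:ℝ) + 1) ^ ((n:ℝ) - d)) *
          ((2 * V + 2) * ENNReal.ofReal ((1/2) ^ k)) := by
      intro k
      refine (hF3 z hz (N + 1) (by positivity) _ ((hφ (k+1)).sub (hφ k)).cd
        (fun ζ hζ => ((hφ (k+1)).sub (hφ k)).eq_zero hζ.1)).trans (mul_le_mul' le_rfl ?_)
      have hE : ∀ j : ℕ, ∫⁻ x in ball z (N + 1), ENNReal.ofReal ‖gr (uk j) x - G x‖ ∂(nu d Γ)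
          ≤ (V + 1) * ENNReal.ofReal ((1/2) ^ j) := by
        intro j
        have hmq : AEMeasurable (fun x => ENNReal.ofReal (2 ^ j * ‖gr (uk j) x - G x‖ ^ 2)) (nu d Γ) :=
          ((hqi j).const_mul _).aestronglyMeasurable.aemeasurable.ennreal_ofReal
        calc _ ≤ ∫⁻ x in ball z (N + 1), (ENNReal.ofReal ((1/2) ^ j) +
              ENNReal.ofReal (2 ^ j * ‖gr (uk j) x - G x‖ ^ 2)) ∂(nu d Γ) := by
              refine lintegral_mono fun x => ?_
              rw [← ENNReal.ofReal_add (by positivity) (by positivity)]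
              apply ENNReal.ofReal_le_ofReal
              have e1 : (1/2 : ℝ) ^ j * 2 ^ j = 1 := by rw [← mul_pow]; norm_num
              have e2 : (0:ℝ) < 2 ^ j := by positivity
              have e3 : (0:ℝ) < (1/2) ^ j := by positivity
              set t := ‖gr (uk j) x - G x‖
              have : 2 ^ j * ((1/2) ^ j + 2 ^ j * t ^ 2 - t) ≥ 0 := by
                nlinarith [sq_nonneg (2 ^ j * t - 1 / 2)]
              nlinarith [nonneg_of_mul_nonneg_right this e2]
          _ = ENNReal.ofReal ((1/2) ^ j) * V +
                ∫⁻ x in ball z (N + 1), ENNReal.ofReal (2 ^ j * ‖gr (uk j) x - G x‖ ^ 2) ∂(nu d Γ) := by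
              rw [lintegral_add_left measurable_const, setLIntegral_const]
          _ ≤ ENNReal.ofReal ((1/2) ^ j) * V + ENNReal.ofReal ((1/2) ^ j) := by
              gcongr
              refine (setLIntegral_le_lintegral _ _).trans ?_
              rw [← ofReal_integral_eq_lintegral_ofReal ((hqi j).const_mul _)
                (Eventually.of_forall fun x => by positivity), integral_const_mul]
              apply ENNReal.ofReal_le_ofReal
              calc _ ≤ (2:ℝ) ^ j * (1/4) ^ j := by gcongr; exact hqb j
                _ = _ := by rw [← mul_pow]; norm_num
          _ = _ := by ring
      calc _ ≤ ∫⁻ x in ball z (N + 1), (ENNReal.ofReal ‖gr (uk (k+1)) x - G x‖ +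
            ENNReal.ofReal ‖gr (uk k) x - G x‖) ∂(nu d Γ) := by
            refine lintegral_mono fun x => ?_
            rw [← enorm_gr, gr_sub (hφ (k+1)).cd (hφ k).cd, ← ofReal_norm,
              ← ENNReal.ofReal_add (by positivity) (by positivity)]
            apply ENNReal.ofReal_le_ofReal
            rw [hukk, hukk]
            rw [gr_add (hφ (k+1)).cd gc, gr_add (hφ k).cd gc]
            refine le_trans (le_of_eq ?_) (norm_sub_le _ _)
            congr 1; abel
        _ = _ + _ := lintegral_add_left' (by
              refine ((Continuous.aestronglyMeasurable (gr_cont (ukc _))).sub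
                hGm.aestronglyMeasurable).norm.aemeasurable.ennreal_ofReal) _
        _ ≤ (V + 1) * ENNReal.ofReal ((1/2) ^ (k+1)) + (V + 1) * ENNReal.ofReal ((1/2) ^ k) :=
            add_le_add (hE _) (hE _)
        _ ≤ (V + 1) * ENNReal.ofReal ((1/2) ^ k) + (V + 1) * ENNReal.ofReal ((1/2) ^ k) := by
            gcongr ?_ + _
            refine mul_le_mul' le_rfl (ENNReal.ofReal_le_ofReal ?_)
            exact pow_le_pow_of_le_one (by norm_num) (by norm_num) (by omega)
        _ = _ := by ring
    have hm : ∀ k, AEMeasurable (fun x => ‖(φ (k+1) - φ k) x‖ₑ) (volume.restrict (ball z (N + 1))) :=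
      fun k => ((hφ (k+1)).sub (hφ k)).cd.continuous.aestronglyMeasurable.enorm
    have htot : ∫⁻ x in ball z (N + 1), ∑' k, ‖(φ (k+1) - φ k) x‖ₑ ≠ ⊤ := by
      rw [lintegral_tsum hm]
      refine ((ENNReal.tsum_le_tsum hb).trans_lt ?_).ne
      rw [ENNReal.tsum_mul_left, ENNReal.tsum_mul_left]
      refine ENNReal.mul_lt_top ENNReal.ofReal_lt_top (ENNReal.mul_lt_top ?_ ?_)
      · exact (ENNReal.add_lt_top.2 ⟨ENNReal.mul_lt_top (by simp) hVt.lt_top, by simp⟩)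
      · have := tsum_geo (c := 1) (q := 1/2) (by norm_num) (by norm_num) (by norm_num)
        simp only [one_mul] at this
        rw [this]; exact ENNReal.ofReal_lt_top
    filter_upwards [ae_lt_top' (AEMeasurable.ennreal_tsum hm) htot] with x hx
    refine cauchySeq_tendsto_of_complete (cauchySeq_of_edist_le_of_tsum_ne_top _ (fun k => ?_) hx.ne)
    rw [edist_comm, edist_eq_enorm_sub]; rfl
  have : (univ : Set (EE n)) = ⋃ N : ℕ, ball z (N + 1) := by
    refine (eq_univ_of_forall fun x => ?_).symm
    obtain ⟨k, hk⟩ := exists_nat_gt (dist x z)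
    exact mem_iUnion.2 ⟨k, by rw [mem_ball]; linarith⟩
  rw [← Measure.restrict_univ (μ := (volume : Measure (EE n))), this, ae_restrict_iUnion_iff]
  exact key

set_option maxHeartbeats 400000 in
lemma exists_raw {d C₀ Λ : ℝ} {Γ : Set (EE n)} (h : AR n d C₀ Γ)
    {a : EE n → EE n →ₗ[ℝ] EE n →ₗ[ℝ] ℝ} (ha : Frm d Λ Γ a) (m : Mean (nu d Γ))
    {g : EE n → ℝ} (gc : ContDiff ℝ 1 g) (gs : HasCompactSupport g) :
    ∃ u G uk Q, Raw d Γ a m g u G uk Q := by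
  have := h.fmc
  have hnm : ∀ᵐ x ∂(nu d Γ), x ∉ Γ := AR.nu_ac.ae_le h.ae_notMem
  have hmem : ∀ {φ : EE n → ℝ}, ContDiff ℝ 1 φ → HasCompactSupport φ → MemLp (gr φ) 2 (nu d Γ) :=
    fun h1 h2 => (gr_cont h1).memLp_of_hasCompactSupport (gr_compact h2)
  let K0 : Submodule ℝ (Lp (EE n) 2 (nu d Γ)) :=
    { carrier := {F | ∃ φ, Adm Γ φ ∧ ∀ᵐ x ∂(nu d Γ), F x = gr φ x}
      add_mem' := by
        rintro F H ⟨φ, hφ, h1⟩ ⟨ψ, hψ, h2⟩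
        refine ⟨φ + ψ, hφ.add hψ, ?_⟩
        filter_upwards [h1, h2, Lp.coeFn_add F H] with x e1 e2 e3
        rw [e3, gr_add hφ.cd hψ.cd, Pi.add_apply, e1, e2]
      zero_mem' := by
        refine ⟨0, Adm.zero, ?_⟩
        filter_upwards [Lp.coeFn_zero (EE n) 2 (nu d Γ)] with x hx
        rw [hx]; simp [gr]
      smul_mem' := by
        rintro c F ⟨φ, hφ, h1⟩
        refine ⟨c • φ, hφ.smul c, ?_⟩
        filter_upwards [h1, Lp.coeFn_smul c F] with x e1 e3
        rw [e3, gr_smul hφ.cd, Pi.smul_apply, e1] }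
  obtain ⟨G, hG1, hG2⟩ := lax m a (inv_pos.2 ha.hΛ) ha.hΛ.le
    (by filter_upwards [hnm] with x hx using ha.lo x hx)
    (by filter_upwards [hnm] with x hx using ha.up x hx) K0 ((hmem gc gs).toLp _)
  have hGm := Lp.stronglyMeasurable G
  choose F hF hFG using fun k : ℕ => hG1 ((1/2) ^ k) (by positivity)
  choose φ hφ hFφ using hF
  set uk : ℕ → EE n → ℝ := fun k => φ k + g with huk
  have ukc : ∀ k, ContDiff ℝ 1 (uk k) := fun k => (hφ k).cd.add gc
  have hdiff : ∀ k, ∀ᵐ x ∂(nu d Γ), (F k + (hmem gc gs).toLp _ - G : Lp (EE n) 2 (nu d Γ)) x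
      = gr (uk k) x - G x := by
    intro k
    filter_upwards [Lp.coeFn_sub (F k + (hmem gc gs).toLp _) G,
      Lp.coeFn_add (F k) ((hmem gc gs).toLp _), (hmem gc gs).coeFn_toLp, hFφ k] with x e1 e2 e3 e4
    rw [e1, Pi.sub_apply, e2, Pi.add_apply, e3, e4, gr_add (hφ k).cd gc]
  set q : ℕ → EE n → ℝ := fun k x => ‖gr (uk k) x - G x‖ ^ 2 with hq
  have hqi : ∀ k, Integrable (q k) (nu d Γ) := by
    intro k
    have := (memLp_two_iff_integrable_sq_norm (Lp.aestronglyMeasurable _)).1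
      (Lp.memLp (F k + (hmem gc gs).toLp _ - G : Lp (EE n) 2 (nu d Γ)))
    refine this.congr ?_
    filter_upwards [hdiff k] with x hx
    rw [hx]
  have hqb : ∀ k, ∫ x, q k x ∂(nu d Γ) ≤ (1/4) ^ k := by
    intro k
    have h1 := int_norm_sq (F k + (hmem gc gs).toLp _ - G : Lp (EE n) 2 (nu d Γ))
    have h2 : ∫ x, q k x ∂(nu d Γ) = _ := (integral_congr_ae (by
      filter_upwards [hdiff k] with x hx
      rw [hx])).trans h1
    rw [h2]
    calc _ ≤ ((1/2 : ℝ) ^ k) ^ 2 := by gcongr; exact (hFG k).le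
      _ = _ := by rw [← pow_mul, mul_comm, pow_mul]; norm_num
  have hq0 : ∀ k x, 0 ≤ q k x := fun k x => by positivity
  obtain ⟨hs1, hs2⟩ := summ hqi hq0 (Summable.of_nonneg_of_le
    (fun k => integral_nonneg (hq0 k)) hqb (summable_geometric_of_lt_one (by norm_num) (by norm_num)))
  have hGi : Integrable (fun x => ‖G x‖ ^ 2) (nu d Γ) :=
    (memLp_two_iff_integrable_sq_norm (Lp.aestronglyMeasurable _)).1 (Lp.memLp G)
  have hlim : ∀ᵐ x, ∃ l, Tendsto (fun k => φ k x) atTop (𝓝 l) := raw_lim h gc hφ hGm hqi hqb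
  have hlim2 : ∀ᵐ x, ∃ l, Tendsto (fun k => uk k x) atTop (𝓝 l) := by
    filter_upwards [hlim] with x ⟨l, hl⟩
    exact ⟨l + g x, hl.add_const _⟩
  obtain ⟨u, hum, hul⟩ := exists_stronglyMeasurable_limit_of_tendsto_ae
    (fun k => (ukc k).continuous.aestronglyMeasurable) hlim2
  have hadm : ∀ k, Adm Γ (uk k - g) := by
    intro k
    have e : uk k - g = φ k := add_sub_cancel_right _ _
    rw [e]; exact hφ k
  have hQi : Integrable (fun x => 2 * ‖G x‖ ^ 2 + 2 * ∑' k, q k x) (nu d Γ) := by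
    have e1 := hGi.const_mul 2
    have e2 := hs2.const_mul 2
    exact e1.add e2
  refine ⟨u, G, uk, fun x => 2 * ‖G x‖ ^ 2 + 2 * ∑' k, q k x, ⟨gc, gs, hum, hGm, hadm,
    hQi, ?_, hul, ?_, ?_⟩⟩
  · filter_upwards [h.ac_nu.ae_le hs1] with x hx k
    have h1 := hx.le_tsum k (fun j _ => hq0 j x)
    have h2 : ‖gr (uk k) x‖ ≤ ‖gr (uk k) x - G x‖ + ‖G x‖ := norm_le_norm_sub_add _ _
    simp only [hq] at h1 ⊢
    nlinarith [sq_nonneg (‖gr (uk k) x - G x‖ - ‖G x‖), norm_nonneg (gr (uk k) x)]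
  · filter_upwards [h.ac_nu.ae_le hs1] with x hx
    have h1 := hx.tendsto_atTop_zero
    rw [tendsto_iff_norm_sub_tendsto_zero]
    have := h1.sqrt
    simpa [hq, Real.sqrt_sq (norm_nonneg _)] using this
  · intro ψ hψ
    have hL := hmem hψ.cd hψ.cs
    rw [← hG2 (hL.toLp _) ⟨ψ, hψ, hL.coeFn_toLp⟩]
    apply m.congr
    filter_upwards [hL.coeFn_toLp] with x hx
    rw [hx]
end EMN
open MeasureTheory Metric Set Filter
open scoped ENNReal Topology

namespace EMN
variable {n : ℕ}

/-- approximable pairs (function, gradient) -/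
structure Apx (d : ℝ) (Γ : Set (EE n)) (Θ : ℕ → EE n → ℝ) (θ : EE n → ℝ) (V : EE n → EE n)
    (D : EE n → ℝ) : Prop where
  cd : ∀ k, ContDiff ℝ 1 (Θ k)
  Di : Integrable D (nu d Γ)
  Db : ∀ᵐ x, ∀ k, ‖gr (Θ k) x‖ ^ 2 ≤ D x
  lim : ∀ᵐ x, Tendsto (fun k => Θ k x) atTop (𝓝 (θ x))
  glim : ∀ᵐ x, Tendsto (fun k => gr (Θ k) x) atTop (𝓝 (V x))

namespace Apx
variable {d C₀ : ℝ} {Γ : Set (EE n)} {Θ : ℕ → EE n → ℝ} {θ : EE n → ℝ} {V : EE n → EE n}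
    {D : EE n → ℝ}

lemma Vm (A : Apx d Γ Θ θ V D) : AEStronglyMeasurable V (nu d Γ) :=
  aestronglyMeasurable_of_tendsto_ae atTop
    (fun k => (gr_cont (A.cd k)).aestronglyMeasurable) ((AR.nu_ac (d := d) (Γ := Γ)).ae_le A.glim)
lemma Vb (A : Apx d Γ Θ θ V D) : ∀ᵐ x, ‖V x‖ ^ 2 ≤ D x := by
  filter_upwards [A.Db, A.glim] with x h1 h2
  exact le_of_tendsto (h2.norm.pow 2) (Eventually.of_forall h1)

lemma tend (A : Apx d Γ Θ θ V D) {B : Set (EE n)} (hB : nu d Γ B < ⊤) :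
    Tendsto (fun k => ∫⁻ x in B, ‖fderiv ℝ (Θ k) x‖ₑ ∂(nu d Γ)) atTop
      (𝓝 (∫⁻ x in B, ‖V x‖ₑ ∂(nu d Γ))) := by
  refine tendsto_lintegral_of_dominated_convergence' (fun x => 1 + ENNReal.ofReal (D x))
    (fun k => ?_) (fun k => ?_) ?_ ?_
  · exact ((A.cd k).continuous_fderiv one_ne_zero).aestronglyMeasurable.enorm
  · filter_upwards [ae_restrict_of_ae ((AR.nu_ac (d := d) (Γ := Γ)).ae_le A.Db)] with x hx
    have h1 := hx k
    rw [← enorm_gr, ← ofReal_norm, ← ENNReal.ofReal_one, ← ENNReal.ofReal_add zero_le_one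
      ((sq_nonneg _).trans h1)]
    exact ENNReal.ofReal_le_ofReal (by nlinarith [sq_nonneg (‖gr (Θ k) x‖ - 1)])
  · rw [lintegral_add_left measurable_const, setLIntegral_const]
    refine (ENNReal.add_lt_top.2 ⟨by simpa using hB, ?_⟩).ne
    refine (setLIntegral_le_lintegral _ _).trans_lt ?_
    exact A.Di.lintegral_lt_top
  · filter_upwards [ae_restrict_of_ae ((AR.nu_ac (d := d) (Γ := Γ)).ae_le A.glim)] with x hx
    simp only [← enorm_gr]
    exact hx.enorm

lemma fatou (A : Apx d Γ Θ θ V D) (B : Set (EE n)) {K : ℕ → ℝ≥0∞} {L : ℝ≥0∞}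
    (hK : ∀ k, ∫⁻ x in B, ‖Θ k x‖ₑ ≤ K k) (hL : Tendsto K atTop (𝓝 L)) :
    ∫⁻ x in B, ‖θ x‖ₑ ≤ L := by
  have h1 : ∫⁻ x in B, ‖θ x‖ₑ = ∫⁻ x in B, liminf (fun k => ‖Θ k x‖ₑ) atTop := by
    refine lintegral_congr_ae ?_
    filter_upwards [ae_restrict_of_ae A.lim] with x hx
    exact (hx.enorm.liminf_eq).symm
  rw [h1]
  refine (lintegral_liminf_le' fun k => ?_).trans ?_
  · exact (A.cd k).continuous.aestronglyMeasurable.enorm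
  · rw [← hL.liminf_eq]
    exact liminf_le_liminf (Eventually.of_forall hK)
end Apx

lemma AR.F3 {d C₀ : ℝ} {Γ : Set (EE n)} (h : AR n d C₀ Γ) : ∃ C > 0, ∀ z ∈ Γ, ∀ R > 0,
    ∀ (Θ : ℕ → EE n → ℝ) (θ : EE n → ℝ) (V : EE n → EE n) (D : EE n → ℝ), Apx d Γ Θ θ V D →
    (∀ k, ∀ x ∈ Γ ∩ ball z R, Θ k x = 0) →
    ∫⁻ x in ball z R, ‖θ x‖ₑ ≤ ENNReal.ofReal (C * R ^ ((n:ℝ) - d)) *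
      ∫⁻ x in ball z R, ‖V x‖ₑ ∂(nu d Γ) := by
  obtain ⟨C, hC, hF⟩ := h.F3raw
  refine ⟨C, hC, fun z hz R hR Θ θ V D A h0 => ?_⟩
  refine A.fatou _ (fun k => hF z hz R hR (Θ k) (A.cd k) (h0 k)) ?_
  exact ENNReal.Tendsto.const_mul (A.tend (h.nu_ball_lt z R)) (Or.inr ENNReal.ofReal_ne_top)

namespace Raw
variable {d C₀ Λ : ℝ} {Γ : Set (EE n)} {a : EE n → EE n →ₗ[ℝ] EE n →ₗ[ℝ] ℝ} {m : Mean (nu d Γ)}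
  {g u : EE n → ℝ} {G : EE n → EE n} {uk : ℕ → EE n → ℝ} {Q : EE n → ℝ}

lemma ukc (r : Raw d Γ a m g u G uk Q) (k : ℕ) : ContDiff ℝ 1 (uk k) := by
  have h1 := (r.adm k).cd.add r.gc
  have e : (fun x => (uk k - g) x + g x) = uk k := by ext x; simp
  rwa [e] at h1
lemma apx (r : Raw d Γ a m g u G uk Q) : Apx d Γ uk u G Q := ⟨r.ukc, r.Qi, r.Qb, r.ulim, r.Glim⟩
lemma ueq (r : Raw d Γ a m g u G uk Q) (k : ℕ) {x : EE n} (hx : x ∈ Γ) : uk k x = g x := by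
  have := (r.adm k).eq_zero hx
  simp only [Pi.sub_apply] at this; linarith
lemma uout (r : Raw d Γ a m g u G uk Q) (k : ℕ) {x : EE n} (hx : x ∉ tsupport (uk k - g)) :
    uk k x = g x := by
  have := image_eq_zero_of_notMem_tsupport hx
  simp only [Pi.sub_apply] at this; linarith

lemma neg (r : Raw d Γ a m g u G uk Q) :
    Raw d Γ a m (-g) (-u) (-G) (fun k => -uk k) Q := by
  have hg : ∀ k x, gr (-uk k) x = - gr (uk k) x := fun k x => by
    have := gr_smul (r.ukc k) (-1) x
    simpa using this
  refine ⟨r.gc.neg, ?_, r.um.neg, r.Gm.neg, fun k => ?_, r.Qi, ?_, ?_, ?_, fun φ hφ => ?_⟩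
  · exact r.gs.neg
  · have := (r.adm k).smul (-1)
    have e : (-1 : ℝ) • (uk k - g) = -uk k - -g := by rw [neg_one_smul]; abel
    rwa [e] at this
  · filter_upwards [r.Qb] with x hx k
    rw [hg, norm_neg]; exact hx k
  · filter_upwards [r.ulim] with x hx; exact hx.neg
  · filter_upwards [r.Glim] with x hx
    simp only [hg]; exact hx.neg
  · have := r.sol φ hφ
    have e : (fun x => a x ((-G) x) (gr φ x)) = - (fun x => a x (G x) (gr φ x)) := by
      ext x; simp
    rw [e, map_neg, this, neg_zero]

lemma test (h : AR n d C₀ Γ) (ha : Frm d Λ Γ a) (r : Raw d Γ a m g u G uk Q)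
    {Θ : ℕ → EE n → ℝ} {θ : EE n → ℝ} {V : EE n → EE n} {D : EE n → ℝ} (A : Apx d Γ Θ θ V D)
    (hA : ∀ k, Adm Γ (Θ k)) : m.M (fun x => a x (G x) (V x)) = 0 := by
  have hnm : ∀ᵐ x ∂(nu d Γ), x ∉ Γ := (AR.nu_ac (d := d) (Γ := Γ)).ae_le h.ae_notMem
  have hVm := A.Vm
  have hVb := (AR.nu_ac (d := d) (Γ := Γ)).ae_le A.Vb
  have hGQ := (AR.nu_ac (d := d) (Γ := Γ)).ae_le r.apx.Vb
  have hDb := (AR.nu_ac (d := d) (Γ := Γ)).ae_le A.Db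
  have hΛ := ha.hΛ
  have hdom : ∀ k, ∀ᵐ x ∂(nu d Γ), ‖Λ * (‖G x‖ * ‖V x - gr (Θ k) x‖)‖ ≤ Λ * (Q x + 4 * D x) := by
    intro k
    filter_upwards [hVb, hGQ, hDb] with x h1 h2 h3
    rw [Real.norm_of_nonneg (by positivity)]
    refine mul_le_mul_of_nonneg_left ?_ hΛ.le
    have h4 := norm_sub_le (V x) (gr (Θ k) x)
    have h5 := h3 k
    have h6 := norm_nonneg (V x - gr (Θ k) x)
    nlinarith [sq_nonneg (‖G x‖ - ‖V x - gr (Θ k) x‖), sq_nonneg (‖V x‖ - ‖gr (Θ k) x‖),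
      pow_le_pow_left₀ h6 h4 2]
  have hDi : Integrable (fun x => Λ * (Q x + 4 * D x)) (nu d Γ) := by
    have h1 := A.Di.const_mul 4
    have h2 := (r.Qi.add h1).const_mul Λ
    exact h2
  have hms : ∀ k, AEStronglyMeasurable (fun x => Λ * (‖G x‖ * ‖V x - gr (Θ k) x‖)) (nu d Γ) :=
    fun k => (r.Gm.aestronglyMeasurable.norm.mul
      (hVm.sub (gr_cont (A.cd k)).aestronglyMeasurable).norm).const_mul Λ
  have hlim : Tendsto (fun k => ∫ x, Λ * (‖G x‖ * ‖V x - gr (Θ k) x‖) ∂(nu d Γ)) atTop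
      (𝓝 (∫ x, (0:ℝ) ∂(nu d Γ))) := by
    refine tendsto_integral_of_dominated_convergence _ hms hDi hdom ?_
    filter_upwards [(AR.nu_ac (d := d) (Γ := Γ)).ae_le A.glim] with x hx
    have h1 : Tendsto (fun k => ‖V x - gr (Θ k) x‖) atTop (𝓝 0) := by
      have := (tendsto_const_nhds (x := V x)).sub hx
      simpa using this.norm
    simpa using (h1.const_mul (‖G x‖)).const_mul Λ
  rw [integral_zero] at hlim
  have hb : ∀ k, |m.M (fun x => a x (G x) (V x))| ≤ ∫ x, Λ * (‖G x‖ * ‖V x - gr (Θ k) x‖) ∂(nu d Γ) := by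
    intro k
    have e : (fun x => a x (G x) (V x)) =
        (fun x => a x (G x) (gr (Θ k) x)) + fun x => a x (G x) (V x - gr (Θ k) x) := by
      ext x; simp
    rw [e, map_add, r.sol _ (hA k), zero_add]
    refine m.bound (hDi.mono' (hms k) (hdom k)) ?_
    filter_upwards [hnm] with x hx
    exact ha.up x hx _ _
  have := ge_of_tendsto' hlim hb
  exact abs_nonpos_iff.1 this

lemma comp_apx (r : Apx d Γ uk u G Q) {β : ℝ → ℝ} (hβ : ContDiff ℝ 1 β) {K : ℝ}
    (hK : ∀ t, |deriv β t| ≤ K) :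
    Apx d Γ (fun k x => β (uk k x)) (fun x => β (u x)) (fun x => deriv β (u x) • G x)
      (fun x => K ^ 2 * Q x) := by
  refine ⟨fun k => hβ.comp (r.cd k), r.Di.const_mul _, ?_, ?_, ?_⟩
  · filter_upwards [r.Db] with x hx k
    rw [gr_comp (r.cd k) hβ, norm_smul, mul_pow, Real.norm_eq_abs]
    have := hx k
    have h2 := hK (uk k x)
    gcongr
  · filter_upwards [r.lim] with x hx
    exact (hβ.continuous.tendsto _).comp hx
  · filter_upwards [r.lim, r.glim] with x hx h2
    simp only [gr_comp (r.cd _) hβ]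
    exact (((hβ.continuous_deriv le_rfl).tendsto _).comp hx).smul h2

lemma max (h : AR n d C₀ Γ) (ha : Frm d Λ Γ a) (r : Raw d Γ a m g u G uk Q) {t : ℝ}
    (hg : ∀ x, g x ≤ t) : ∀ᵐ x, u x ≤ t := by
  have hnm : ∀ᵐ x ∂(nu d Γ), x ∉ Γ := (AR.nu_ac (d := d) (Γ := Γ)).ae_le h.ae_notMem
  have hΛ := ha.hΛ
  have ht : t < t + 1 := by linarith
  have hK : ∀ s, |deriv (T t (t+1)) s| ≤ KS := fun s => by
    rw [abs_of_nonneg (T_deriv_nonneg ht s)]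
    simpa using T_deriv_le ht s
  have A := comp_apx r.apx (T_smooth t (t+1)) hK
  have hA : ∀ k, Adm Γ (fun x => T t (t+1) (uk k x)) := fun k =>
    (r.adm k).of_supp (A.cd k) fun x hx => T_zero ht (by rw [r.uout k hx]; exact hg x)
  have h0 := r.test h ha A hA
  have hGQ := (AR.nu_ac (d := d) (Γ := Γ)).ae_le r.apx.Vb
  have hm1 : AEStronglyMeasurable (fun x => deriv (T t (t+1)) (u x)) (nu d Γ) :=
    ((T_deriv_cont t (t+1)).comp_stronglyMeasurable r.um).aestronglyMeasurable
  have hi : Integrable (fun x => Λ⁻¹ * (deriv (T t (t+1)) (u x) * ‖G x‖ ^ 2)) (nu d Γ) := by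
    refine Integrable.mono' ((r.Qi.const_mul KS).const_mul Λ⁻¹)
      ((hm1.mul (r.Gm.aestronglyMeasurable.norm.pow 2)).const_mul _) ?_
    filter_upwards [hGQ] with x hx
    have h1 := T_deriv_nonneg ht (u x)
    have h2 := (abs_le.1 (hK (u x))).2
    have h3 := KS_one
    rw [Real.norm_of_nonneg (by positivity)]
    gcongr
  have hle := m.le_of hi ((r.Qi.const_mul KS).const_mul Λ) (h := fun x => a x (G x) (deriv (T t (t+1)) (u x) • G x))
    (by
      filter_upwards [hnm] with x hx
      have := ha.lo x hx (G x)
      have h1 := T_deriv_nonneg ht (u x)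
      rw [map_smul, smul_eq_mul]
      nlinarith)
    (by
      filter_upwards [hnm, hGQ] with x hx hq
      have h3 := (abs_le.1 (ha.up x hx (G x) (G x))).2
      have h1 := T_deriv_nonneg ht (u x)
      have h2 := (abs_le.1 (hK (u x))).2
      rw [map_smul, smul_eq_mul]
      calc _ ≤ deriv (T t (t+1)) (u x) * (Λ * (‖G x‖ * ‖G x‖)) := by gcongr
        _ = Λ * (deriv (T t (t+1)) (u x) * ‖G x‖ ^ 2) := by ring
        _ ≤ _ := by
          have h3 := KS_one
          gcongr)
  rw [h0] at hle
  have hz : ∀ᵐ x ∂(nu d Γ), Λ⁻¹ * (deriv (T t (t+1)) (u x) * ‖G x‖ ^ 2) = 0 := by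
    refine (integral_eq_zero_iff_of_nonneg (fun x => ?_) hi).1 (le_antisymm hle (integral_nonneg fun x => ?_)) <;>
    · have h1 := T_deriv_nonneg ht (u x)
      simp only [Pi.zero_apply]; positivity
  obtain ⟨C, hC, hF⟩ := h.F3
  obtain ⟨z, hz'⟩ := h.ne
  have key : ∀ N : ℕ, ∀ᵐ x ∂(volume.restrict (ball z (N + 1))), u x ≤ t := by
    intro N
    have h1 := hF z hz' (N+1) (by positivity) _ _ _ _ A (fun k x hx => (hA k).eq_zero hx.1)
    have h2 : ∫⁻ x in ball z (N+1), ‖deriv (T t (t+1)) (u x) • G x‖ₑ ∂(nu d Γ) = 0 := by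
      rw [← lintegral_zero (μ := (nu d Γ).restrict (ball z (N+1)))]
      refine lintegral_congr_ae ?_
      filter_upwards [ae_restrict_of_ae hz] with x hx
      simp only [mul_eq_zero, inv_eq_zero, hΛ.ne', false_or, pow_eq_zero_iff two_ne_zero, norm_eq_zero] at hx
      rcases hx with hx | hx <;> simp [hx]
    rw [h2, mul_zero, nonpos_iff_eq_zero, lintegral_eq_zero_iff'] at h1
    · filter_upwards [h1] with x hx
      by_contra hc
      have : 0 < T t (t+1) (u x) := S_pos (by simp; linarith)
      simp at hx; linarith
    · exact ((T_smooth t (t+1)).continuous.comp_stronglyMeasurable r.um).aestronglyMeasurable.enorm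
  have : (univ : Set (EE n)) = ⋃ N : ℕ, ball z (N + 1) := by
    refine (eq_univ_of_forall fun x => ?_).symm
    obtain ⟨k, hk⟩ := exists_nat_gt (dist x z)
    exact mem_iUnion.2 ⟨k, by rw [mem_ball]; linarith⟩
  rw [← Measure.restrict_univ (μ := (volume : Measure (EE n))), this, ae_restrict_iUnion_iff]
  exact key

end Raw
end EMN
open MeasureTheory Metric Set Filter
open scoped ENNReal Topology

namespace EMN
variable {n : ℕ}

/-- clamp -/
noncomputable def chi (t : ℝ) : ℝ := t * (S (3 - t) * S (t + 2))
lemma chi_smooth : ContDiff ℝ 1 chi := by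
  have h1 : ContDiff ℝ 1 (fun t : ℝ => S (3 - t)) := S_smooth.comp (by fun_prop)
  have h2 : ContDiff ℝ 1 (fun t : ℝ => S (t + 2)) := S_smooth.comp (by fun_prop)
  exact contDiff_id.mul (h1.mul h2)
lemma chi_id {t : ℝ} (h1 : -1 ≤ t) (h2 : t ≤ 2) : chi t = t := by
  rw [chi, S_one (by linarith), S_one (by linarith)]; ring
lemma chi_bd (t : ℝ) : |chi t| ≤ 3 := by
  rw [chi]
  have a1 := S_nonneg (3 - t); have a2 := S_le_one (3 - t)
  have b1 := S_nonneg (t + 2); have b2 := S_le_one (t + 2)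
  by_cases h1 : 3 ≤ t
  · rw [S_zero (t := 3 - t) (by linarith)]; simp
  by_cases h2 : t ≤ -2
  · rw [S_zero (t := t + 2) (by linarith)]; simp
  rw [abs_mul, abs_of_nonneg (mul_nonneg a1 b1)]
  have : |t| ≤ 3 := abs_le.2 ⟨by linarith, by linarith⟩
  have h3 : S (3 - t) * S (t + 2) ≤ 1 := by nlinarith
  nlinarith [abs_nonneg t, mul_nonneg a1 b1]
lemma chi_cs : HasCompactSupport chi := by
  refine HasCompactSupport.of_support_subset_isCompact (isCompact_Icc (a := (-2:ℝ)) (b := 3)) ?_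
  intro t ht
  by_contra hc
  apply ht
  rw [mem_Icc, not_and_or, not_le, not_le] at hc
  rcases hc with hc | hc
  · rw [chi, S_zero (t := t + 2) (by linarith)]; simp
  · rw [chi, S_zero (t := 3 - t) (by linarith)]; simp
lemma chi_deriv_bd : ∃ K : ℝ, ∀ t, |deriv chi t| ≤ K := by
  obtain ⟨K, hK⟩ := (chi_smooth.continuous_deriv le_rfl).bounded_above_of_compact_support
    (chi_cs.deriv)
  exact ⟨K, hK⟩
lemma chi_deriv {t : ℝ} (h1 : 0 ≤ t) (h2 : t ≤ 1) : deriv chi t = 1 := by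
  have : chi =ᶠ[𝓝 t] id := by
    filter_upwards [Ioo_mem_nhds (a := -1) (b := 2) (by linarith : -1 < t) (by linarith)] with s hs
    exact chi_id hs.1.le hs.2.le
  rw [this.deriv_eq]; simp

/-- level truncation -/
noncomputable def be (κ h t : ℝ) : ℝ := (t - κ) * S ((t - κ) / h)
lemma be_smooth (κ h : ℝ) : ContDiff ℝ 1 (be κ h) := by
  have h1 : ContDiff ℝ 1 (fun t : ℝ => S ((t - κ) / h)) := S_smooth.comp (by fun_prop)
  exact ContDiff.mul (by fun_prop) h1
lemma be_deriv {κ h : ℝ} (hh : 0 < h) (t : ℝ) :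
    deriv (be κ h) t = S ((t - κ) / h) + (t - κ) / h * deriv S ((t - κ) / h) := by
  have h1 : HasDerivAt (fun t : ℝ => (t - κ) / h) (1 / h) t :=
    ((hasDerivAt_id t).sub_const κ).div_const h
  have h2 := (S_diff ((t - κ) / h)).hasDerivAt.comp t h1
  have h3 := ((hasDerivAt_id t).sub_const κ).mul h2
  have h4 : be κ h = (fun x => (id x - κ)) * (S ∘ fun t : ℝ => (t - κ) / h) := by
    ext x; simp [be]
  rw [h4, h3.deriv]; simp; field_simp
lemma be_deriv_ge {κ h : ℝ} (hh : 0 < h) (t : ℝ) : S ((t - κ) / h) ≤ deriv (be κ h) t := by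
  rw [be_deriv hh]
  by_cases hs : (t - κ) / h ≤ 0
  · rw [S_deriv_zero_left hs]; simp
  · have := S_deriv_nonneg ((t - κ) / h)
    push Not at hs
    nlinarith [mul_nonneg hs.le this]
lemma be_deriv_le {κ h : ℝ} (hh : 0 < h) (t : ℝ) : deriv (be κ h) t ≤ 1 + KS := by
  rw [be_deriv hh]
  have h1 := S_le_one ((t - κ) / h)
  have h2 := KS_one
  by_cases hs : (t - κ) / h ≤ 0
  · rw [S_deriv_zero_left hs]; linarith
  by_cases hs' : 1 ≤ (t - κ) / h
  · rw [S_deriv_zero_right hs']; linarith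
  push Not at hs hs'
  have h3 := S_deriv_nonneg ((t - κ) / h)
  have h4 := KS_bd ((t - κ) / h)
  nlinarith
lemma be_deriv_nonneg {κ h : ℝ} (hh : 0 < h) (t : ℝ) : 0 ≤ deriv (be κ h) t :=
  (S_nonneg _).trans (be_deriv_ge hh t)
lemma be_eq {κ h : ℝ} (hh : 0 < h) (t : ℝ) : be κ h t = max (t - κ) 0 * S ((t - κ) / h) := by
  by_cases hs : t - κ ≤ 0
  · rw [be, S_zero (div_nonpos_of_nonpos_of_nonneg hs hh.le)]; simp
  · rw [be, max_eq_left (by linarith)]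
lemma be_zero {κ h t : ℝ} (hh : 0 < h) (ht : t ≤ κ) : be κ h t = 0 := by
  rw [be_eq hh, max_eq_right (by linarith), zero_mul]
lemma be_abs (κ h t : ℝ) : |be κ h t| ≤ |t| + |κ| := by
  rw [be, abs_mul, abs_of_nonneg (S_nonneg _)]
  have h1 := S_nonneg ((t - κ) / h); have h2 := S_le_one ((t - κ) / h)
  have := abs_sub t κ
  nlinarith [abs_nonneg (t - κ)]

namespace Raw
variable {d C₀ Λ : ℝ} {Γ : Set (EE n)} {a : EE n → EE n →ₗ[ℝ] EE n →ₗ[ℝ] ℝ} {m : Mean (nu d Γ)}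
  {g u : EE n → ℝ} {G : EE n → EE n} {uk : ℕ → EE n → ℝ} {Q : EE n → ℝ}

lemma clamp (h : AR n d C₀ Γ) (ha : Frm d Λ Γ a) (r : Raw d Γ a m g u G uk Q)
    (g0 : ∀ x, 0 ≤ g x) (g1 : ∀ x, g x ≤ 1) :
    (∀ᵐ x, 0 ≤ u x ∧ u x ≤ 1) ∧
    ∃ vk Q', Raw d Γ a m g u G vk Q' ∧ ∀ k x, |vk k x| ≤ 3 := by
  have hu : ∀ᵐ x, 0 ≤ u x ∧ u x ≤ 1 := by
    filter_upwards [r.max h ha g1, r.neg.max h ha (t := 0) (fun x => by simpa using g0 x)] with x h1 h2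
    exact ⟨by simpa using h2, h1⟩
  refine ⟨hu, ?_⟩
  obtain ⟨K, hK⟩ := chi_deriv_bd
  have A := comp_apx r.apx chi_smooth hK
  refine ⟨fun k x => chi (uk k x), fun x => K ^ 2 * Q x, ⟨r.gc, r.gs, r.um, r.Gm, fun k => ?_, A.Di, A.Db,
    ?_, ?_, r.sol⟩, fun k x => chi_bd _⟩
  · refine (r.adm k).of_supp ((A.cd k).sub r.gc) fun x hx => ?_
    simp only [Pi.sub_apply]
    rw [r.uout k hx, chi_id (by linarith [g0 x]) (by linarith [g1 x]), sub_self]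
  · filter_upwards [A.lim, hu] with x h1 h2
    rwa [chi_id (by linarith) (by linarith)] at h1
  · filter_upwards [A.glim, hu] with x h1 h2
    rwa [chi_deriv h2.1 h2.2, one_smul] at h1

lemma dg_apx (h : AR n d C₀ Γ) (r : Raw d Γ a m g u G uk Q) (ub : ∀ k x, |uk k x| ≤ 3)
    {η : EE n → ℝ} (ηc : ContDiff ℝ 1 η) (ηs : HasCompactSupport η) (η1 : ∀ x, |η x| ≤ 1)
    {κ hh : ℝ} (hh0 : 0 < hh) :
    Apx d Γ (fun k x => (η x * η x) * be κ hh (uk k x)) (fun x => (η x * η x) * be κ hh (u x))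
     (fun x => (η x * η x) • (deriv (be κ hh) (u x) • G x) +
        be κ hh (u x) • (η x • gr η x + η x • gr η x))
     (fun x => 2 * (1 + KS) ^ 2 * Q x + 8 * (3 + |κ|) ^ 2 * ‖gr η x‖ ^ 2) := by
  have := h.fmc
  have hηη : ContDiff ℝ 1 (fun x => η x * η x) := ηc.mul ηc
  have hb : ∀ k, ContDiff ℝ 1 (fun x => be κ hh (uk k x)) := fun k => (be_smooth κ hh).comp (r.ukc k)
  have hgr : ∀ k x, gr (fun x => (η x * η x) * be κ hh (uk k x)) x =
      (η x * η x) • (deriv (be κ hh) (uk k x) • gr (uk k) x) +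
        be κ hh (uk k x) • (η x • gr η x + η x • gr η x) := fun k x => by
    rw [gr_mul hηη (hb k), gr_mul ηc ηc, gr_comp (r.ukc k) (be_smooth κ hh)]
  refine ⟨fun k => hηη.mul (hb k), ?_, ?_, ?_, ?_⟩
  · have h1 : Integrable (fun x => ‖gr η x‖ ^ 2) (nu d Γ) := by
      refine Continuous.integrable_of_hasCompactSupport ((gr_cont ηc).norm.pow 2) ?_
      exact (gr_compact ηs).comp_left (g := fun v => ‖v‖ ^ 2) (by simp)
    have h2 := r.Qi.const_mul (2 * (1 + KS) ^ 2)
    have h3 := h1.const_mul (8 * (3 + |κ|) ^ 2)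
    exact h2.add h3
  · filter_upwards [r.Qb] with x hx k
    rw [hgr]
    set A := (η x * η x) • (deriv (be κ hh) (uk k x) • gr (uk k) x)
    set B := be κ hh (uk k x) • (η x • gr η x + η x • gr η x)
    have hA : ‖A‖ ^ 2 ≤ (1 + KS) ^ 2 * Q x := by
      have e1 : ‖A‖ ≤ (1 + KS) * ‖gr (uk k) x‖ := by
        simp only [A, norm_smul, Real.norm_eq_abs, abs_mul]
        rw [abs_of_nonneg (be_deriv_nonneg hh0 _)]
        have e2 := be_deriv_le (κ := κ) hh0 (uk k x)
        have e3 := be_deriv_nonneg (κ := κ) hh0 (uk k x)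
        have e4 : |η x| * |η x| ≤ 1 := by nlinarith [η1 x, abs_nonneg (η x)]
        calc _ ≤ 1 * ((1 + KS) * ‖gr (uk k) x‖) := by gcongr
          _ = _ := one_mul _
      calc _ ≤ ((1 + KS) * ‖gr (uk k) x‖) ^ 2 := by gcongr
        _ = (1 + KS) ^ 2 * ‖gr (uk k) x‖ ^ 2 := by ring
        _ ≤ _ := by gcongr; exact hx k
    have hB : ‖B‖ ^ 2 ≤ 4 * (3 + |κ|) ^ 2 * ‖gr η x‖ ^ 2 := by
      have e1 : ‖B‖ ≤ (3 + |κ|) * (2 * ‖gr η x‖) := by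
        simp only [B, norm_smul, Real.norm_eq_abs]
        have e2 := (be_abs κ hh (uk k x)).trans (add_le_add (ub k x) le_rfl)
        have e3 : ‖η x • gr η x + η x • gr η x‖ ≤ 2 * ‖gr η x‖ := by
          refine (norm_add_le _ _).trans ?_
          rw [norm_smul, Real.norm_eq_abs]
          nlinarith [η1 x, norm_nonneg (gr η x)]
        gcongr
      calc _ ≤ ((3 + |κ|) * (2 * ‖gr η x‖)) ^ 2 := by gcongr
        _ = _ := by ring
    have hAB := norm_add_le A B
    have : ‖A + B‖ ^ 2 ≤ 2 * ‖A‖ ^ 2 + 2 * ‖B‖ ^ 2 := by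
      nlinarith [sq_nonneg (‖A‖ - ‖B‖), norm_nonneg (A + B)]
    linarith
  · filter_upwards [r.ulim] with x hx
    exact (((be_smooth κ hh).continuous.tendsto _).comp hx).const_mul _
  · filter_upwards [r.ulim, r.Glim] with x hx hG
    simp only [hgr]
    refine Tendsto.add (Tendsto.const_smul ?_ _) (Tendsto.smul_const ?_ _)
    · exact ((((be_smooth κ hh).continuous_deriv le_rfl).tendsto _).comp hx).smul hG
    · exact ((be_smooth κ hh).continuous.tendsto _).comp hx

end Raw
end EMN
open MeasureTheory Metric Set Filter
open scoped ENNReal Topology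

namespace EMN
variable {n : ℕ}

namespace Raw
variable {d C₀ Λ : ℝ} {Γ : Set (EE n)} {a : EE n → EE n →ₗ[ℝ] EE n →ₗ[ℝ] ℝ} {m : Mean (nu d Γ)}
  {g u : EE n → ℝ} {G : EE n → EE n} {uk : ℕ → EE n → ℝ} {Q : EE n → ℝ}

lemma dg_pt {Λ s b x p q e A B : ℝ} (hΛ : 0 < Λ) (s0 : 0 ≤ s) (s1 : s ≤ 1) (sb : s ≤ b) (hx : 0 ≤ x)
    (hp : 0 ≤ p) (hq : 0 ≤ q) (hA : Λ⁻¹ * p ^ 2 ≤ A) (hB : |B| ≤ Λ * (p * q)) :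
    Λ⁻¹ / 2 * ((e * e) * (b * p ^ 2)) - 2 * Λ ^ 3 * (q ^ 2 * x ^ 2) ≤
      (e * e) * (b * A) + (x * s) * (e * B + e * B) := by
  have h1 : (e * e) * (b * (Λ⁻¹ * p ^ 2)) ≤ (e * e) * (b * A) := by
    have := s0.trans sb
    have h2 := mul_self_nonneg e
    gcongr
  have h2 : -(2 * Λ * s * (|e| * p * (x * q))) ≤ (x * s) * (e * B + e * B) := by
    have : |(x * s) * (e * B + e * B)| ≤ 2 * Λ * s * (|e| * p * (x * q)) := by
      rw [← two_mul, abs_mul, abs_mul, abs_mul, abs_mul, abs_of_nonneg hx, abs_of_nonneg s0, abs_two]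
      calc _ ≤ x * s * (2 * (|e| * (Λ * (p * q)))) := by gcongr
        _ = _ := by ring
    linarith [(abs_le.1 this).1]
  have h3 : 2 * Λ * s * (|e| * p * (x * q)) ≤ s * (Λ⁻¹ / 2 * (e * e * p ^ 2) + 2 * Λ ^ 3 * (q ^ 2 * x ^ 2)) := by
    have : 2 * Λ * (|e| * p * (x * q)) ≤ Λ⁻¹ / 2 * (e * e * p ^ 2) + 2 * Λ ^ 3 * (q ^ 2 * x ^ 2) := by
      have e1 : e * e = |e| * |e| := (abs_mul_abs_self e).symm
      rw [e1]
      have h4 : 0 ≤ Λ⁻¹ / 2 * (|e| * p - 2 * Λ ^ 2 * (x * q)) ^ 2 := by positivity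
      have h5 : Λ⁻¹ / 2 * (|e| * p - 2 * Λ ^ 2 * (x * q)) ^ 2 = Λ⁻¹ / 2 * (|e| * |e| * p ^ 2) + 2 * Λ ^ 3 * (q ^ 2 * x ^ 2) - 2 * Λ * (|e| * p * (x * q)) := by
        field_simp; ring
      linarith
    calc _ = s * (2 * Λ * (|e| * p * (x * q))) := by ring
      _ ≤ _ := by gcongr
  have h4 : s * (Λ⁻¹ / 2 * (e * e * p ^ 2)) ≤ b * (Λ⁻¹ / 2 * (e * e * p ^ 2)) := by
    have h2 := mul_self_nonneg e
    gcongr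
  have h5 : s * (2 * Λ ^ 3 * (q ^ 2 * x ^ 2)) ≤ 1 * (2 * Λ ^ 3 * (q ^ 2 * x ^ 2)) := by gcongr
  nlinarith

set_option maxHeartbeats 400000 in
lemma dg1 (h : AR n d C₀ Γ) (ha : Frm d Λ Γ a) (r : Raw d Γ a m g u G uk Q) (ub : ∀ k x, |uk k x| ≤ 3)
    {η : EE n → ℝ} (ηc : ContDiff ℝ 1 η) (ηs : HasCompactSupport η) (η1 : ∀ x, |η x| ≤ 1)
    {κ hh : ℝ} (hh0 : 0 < hh) (hη : tsupport η ⊆ Γᶜ ∨ ∀ x, η x ≠ 0 → g x ≤ κ) :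
    ∫⁻ x, ENNReal.ofReal ((η x * η x) * (S ((u x - κ) / hh) * ‖G x‖ ^ 2)) ∂(nu d Γ) ≤
     ENNReal.ofReal (4 * Λ ^ 4) * ∫⁻ x, ENNReal.ofReal (‖gr η x‖ ^ 2 * (Max.max (u x - κ) 0) ^ 2) ∂(nu d Γ) := by
  have := h.fmc
  have hΛ := ha.hΛ
  have hnm : ∀ᵐ x ∂(nu d Γ), x ∉ Γ := AR.nu_ac.ae_le h.ae_notMem
  have A := r.dg_apx h ub ηc ηs η1 (κ := κ) hh0
  have hA : ∀ k, Adm Γ (fun x => (η x * η x) * be κ hh (uk k x)) := fun k => by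
    rcases hη with hη | hη
    · refine Adm.of_supp ⟨ηc, ηs, hη⟩ (A.cd k) fun x hx => ?_
      rw [image_eq_zero_of_notMem_tsupport hx]; simp
    · refine (r.adm k).of_supp (A.cd k) fun x hx => ?_
      by_cases h0 : η x = 0
      · simp [h0]
      · rw [be_zero hh0 (by rw [r.uout k hx]; exact hη x h0), mul_zero]
  have h0 := r.test h ha A hA
  have hGQ := (AR.nu_ac (d := d) (Γ := Γ)).ae_le r.apx.Vb
  have hu3 : ∀ᵐ x ∂(nu d Γ), |u x| ≤ 3 := by
    filter_upwards [(AR.nu_ac (d := d) (Γ := Γ)).ae_le r.ulim] with x hx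
    exact le_of_tendsto' hx.abs (fun k => ub k x)
  have hηm : AEStronglyMeasurable (fun x => η x * η x) (nu d Γ) :=
    (ηc.continuous.mul ηc.continuous).aestronglyMeasurable
  have hGm : AEStronglyMeasurable (fun x => ‖G x‖ ^ 2) (nu d Γ) := r.Gm.aestronglyMeasurable.norm.pow 2
  have hi1 : Integrable (fun x => (η x * η x) * (deriv (be κ hh) (u x) * ‖G x‖ ^ 2)) (nu d Γ) := by
    refine (r.Qi.const_mul (1 + KS)).mono' (hηm.mul (AEStronglyMeasurable.mul
      (((be_smooth κ hh).continuous_deriv le_rfl).comp_stronglyMeasurable r.um).aestronglyMeasurable hGm)) ?_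
    filter_upwards [hGQ] with x hx
    have e2 := be_deriv_le (κ := κ) hh0 (u x)
    have e3 := be_deriv_nonneg (κ := κ) hh0 (u x)
    have e5 := mul_self_nonneg (η x)
    have e4 : η x * η x ≤ 1 := by
      rw [← abs_mul_abs_self]; nlinarith [η1 x, abs_nonneg (η x)]
    rw [Real.norm_of_nonneg (by positivity)]
    have e6 := KS_one
    have e7 : 0 ≤ 1 + KS := by linarith
    calc _ ≤ 1 * ((1 + KS) * Q x) := by gcongr
      _ = _ := one_mul _
  have hi0 : Integrable (fun x => (η x * η x) * (S ((u x - κ) / hh) * ‖G x‖ ^ 2)) (nu d Γ) := by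
    refine hi1.mono' (hηm.mul (AEStronglyMeasurable.mul ?_ hGm)) ?_
    · have : Continuous (fun t : ℝ => S ((t - κ) / hh)) := S_diff.continuous.comp (by fun_prop)
      exact (this.comp_stronglyMeasurable r.um).aestronglyMeasurable
    · filter_upwards with x
      have e5 := mul_self_nonneg (η x)
      have e6 := S_nonneg ((u x - κ) / hh)
      have e7 := be_deriv_ge (κ := κ) hh0 (u x)
      rw [Real.norm_of_nonneg (by positivity)]
      gcongr
  have hi2 : Integrable (fun x => ‖gr η x‖ ^ 2 * (Max.max (u x - κ) 0) ^ 2) (nu d Γ) := by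
    have h1 : Integrable (fun x => ‖gr η x‖ ^ 2) (nu d Γ) := by
      refine Continuous.integrable_of_hasCompactSupport ((gr_cont ηc).norm.pow 2) ?_
      exact (gr_compact ηs).comp_left (g := fun v => ‖v‖ ^ 2) (by simp)
    refine (h1.mul_const ((3 + |κ|) ^ 2)).mono' (AEStronglyMeasurable.mul ?_ ?_) ?_
    · exact ((gr_cont ηc).norm.pow 2).aestronglyMeasurable
    · have : Continuous (fun t : ℝ => (Max.max (t - κ) 0) ^ 2) := by fun_prop
      exact (this.comp_stronglyMeasurable r.um).aestronglyMeasurable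
    · filter_upwards [hu3] with x hx
      rw [Real.norm_of_nonneg (by positivity)]
      have : Max.max (u x - κ) 0 ≤ 3 + |κ| := by
        refine max_le ?_ (by positivity)
        linarith [neg_abs_le κ, (abs_le.1 hx).2]
      gcongr
  have hlow : Integrable (fun x => Λ⁻¹ / 2 * ((η x * η x) * (deriv (be κ hh) (u x) * ‖G x‖ ^ 2)) -
      2 * Λ ^ 3 * (‖gr η x‖ ^ 2 * (Max.max (u x - κ) 0) ^ 2)) (nu d Γ) := by
    have e1 := hi1.const_mul (Λ⁻¹ / 2)
    have e2 := hi2.const_mul (2 * Λ ^ 3)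
    exact e1.sub e2
  have hup := (r.Qi.add A.Di).const_mul Λ
  have hle := m.le_of hlow hup (h := fun x => a x (G x) ((η x * η x) • (deriv (be κ hh) (u x) • G x) +
        be κ hh (u x) • (η x • gr η x + η x • gr η x)))
    (by
      filter_upwards [hnm] with x hx
      have e := dg_pt (e := η x) hΛ (S_nonneg ((u x - κ) / hh)) (S_le_one _) (be_deriv_ge (κ := κ) hh0 (u x))
        (le_max_right (u x - κ) 0) (norm_nonneg (G x)) (norm_nonneg (gr η x)) (ha.lo x hx (G x))
        (ha.up x hx (G x) (gr η x))
      rw [be_eq hh0]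
      simpa only [map_add, map_smul, smul_eq_mul] using e)
    (by
      filter_upwards [hnm, hGQ, (AR.nu_ac (d := d) (Γ := Γ)).ae_le A.Vb] with x hx hq hv
      refine ((le_abs_self _).trans (ha.up x hx _ _)).trans ?_
      simp only [Pi.add_apply]
      refine mul_le_mul_of_nonneg_left ?_ hΛ.le
      set v := (η x * η x) • (deriv (be κ hh) (u x) • G x) +
        be κ hh (u x) • (η x • gr η x + η x • gr η x)
      nlinarith [sq_nonneg (‖G x‖ - ‖v‖), sq_nonneg (‖G x‖), sq_nonneg ‖v‖])
  rw [h0, integral_sub (hi1.const_mul _) (hi2.const_mul _), integral_const_mul, integral_const_mul] at hle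
  have hmono : ∫ x, (η x * η x) * (S ((u x - κ) / hh) * ‖G x‖ ^ 2) ∂(nu d Γ) ≤
      ∫ x, (η x * η x) * (deriv (be κ hh) (u x) * ‖G x‖ ^ 2) ∂(nu d Γ) := by
    refine integral_mono hi0 hi1 fun x => ?_
    have e5 := mul_self_nonneg (η x)
    have e7 := be_deriv_ge (κ := κ) hh0 (u x)
    simp only
    gcongr
  rw [← ofReal_integral_eq_lintegral_ofReal hi0 (Eventually.of_forall fun x => by
      have e5 := mul_self_nonneg (η x)
      have e6 := S_nonneg ((u x - κ) / hh)
      simp only [Pi.zero_apply]; positivity),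
    ← ofReal_integral_eq_lintegral_ofReal hi2 (Eventually.of_forall fun x => by
      simp only [Pi.zero_apply]; positivity), ← ENNReal.ofReal_mul (by positivity)]
  apply ENNReal.ofReal_le_ofReal
  generalize ∫ x, (η x * η x) * (S ((u x - κ) / hh) * ‖G x‖ ^ 2) ∂(nu d Γ) = I0 at *
  generalize ∫ x, (η x * η x) * (deriv (be κ hh) (u x) * ‖G x‖ ^ 2) ∂(nu d Γ) = I1 at *
  generalize ∫ x, ‖gr η x‖ ^ 2 * (Max.max (u x - κ) 0) ^ 2 ∂(nu d Γ) = I2 at *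
  have h6 : Λ⁻¹ / 2 * I1 ≤ 2 * Λ ^ 3 * I2 := by linarith
  calc I0 ≤ I1 := hmono
    _ = 2 * Λ * (Λ⁻¹ / 2 * I1) := by field_simp
    _ ≤ 2 * Λ * (2 * Λ ^ 3 * I2) := by gcongr
    _ = _ := by ring

lemma dg (h : AR n d C₀ Γ) (ha : Frm d Λ Γ a) (r : Raw d Γ a m g u G uk Q) (ub : ∀ k x, |uk k x| ≤ 3)
    {η : EE n → ℝ} (ηc : ContDiff ℝ 1 η) (ηs : HasCompactSupport η) (η1 : ∀ x, |η x| ≤ 1)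
    {κ : ℝ} (hη : tsupport η ⊆ Γᶜ ∨ ∀ x, η x ≠ 0 → g x ≤ κ) :
    ∫⁻ x in {x | κ < u x}, ENNReal.ofReal ((η x * η x) * ‖G x‖ ^ 2) ∂(nu d Γ) ≤
     ENNReal.ofReal (4 * Λ ^ 4) * ∫⁻ x, ENNReal.ofReal (‖gr η x‖ ^ 2 * (Max.max (u x - κ) 0) ^ 2) ∂(nu d Γ) := by
  have hS : MeasurableSet {x | κ < u x} := measurableSet_lt measurable_const r.um.measurable
  set F : ℕ → EE n → ℝ≥0∞ := fun j x => ENNReal.ofReal ((η x * η x) * (S ((u x - κ) / (1 / ((j:ℝ) + 1))) * ‖G x‖ ^ 2))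
  have hF : ∀ x ∈ {x | κ < u x}, ENNReal.ofReal ((η x * η x) * ‖G x‖ ^ 2) = liminf (fun j => F j x) atTop := by
    intro x hx
    have hx : 0 < u x - κ := by have : κ < u x := hx; linarith
    refine (Tendsto.liminf_eq ?_).symm
    refine tendsto_const_nhds.congr' ?_
    obtain ⟨N, hN⟩ := exists_nat_gt (u x - κ)⁻¹
    filter_upwards [eventually_ge_atTop N] with j hj
    have hj' : (N:ℝ) ≤ j := by exact_mod_cast hj
    have : 1 ≤ (u x - κ) / (1 / ((j:ℝ) + 1)) := by
      rw [div_div_eq_mul_div, div_one]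
      have := mul_lt_mul_of_pos_left hN hx
      rw [mul_inv_cancel₀ hx.ne'] at this
      nlinarith
    simp only [F]
    rw [S_one this, one_mul]
  rw [setLIntegral_congr_fun hS hF]
  refine (setLIntegral_le_lintegral _ _).trans ?_
  refine (lintegral_liminf_le' fun j => ?_).trans ?_
  · have : Continuous (fun t : ℝ => S ((t - κ) / (1 / ((j:ℝ) + 1)))) := S_diff.continuous.comp (by fun_prop)
    have h1 := (this.comp_stronglyMeasurable r.um).measurable
    have h2 := r.Gm.norm.measurable
    have h3 := ηc.continuous.measurable
    exact (((h3.mul h3).mul (h1.mul (h2.pow_const 2))).ennreal_ofReal).aemeasurable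
  · have hall : ∀ j : ℕ, ∫⁻ x, F j x ∂(nu d Γ) ≤ ENNReal.ofReal (4 * Λ ^ 4) *
        ∫⁻ x, ENNReal.ofReal (‖gr η x‖ ^ 2 * (Max.max (u x - κ) 0) ^ 2) ∂(nu d Γ) := fun j =>
      r.dg1 h ha ub ηc ηs η1 (κ := κ) (one_div_pos.2 (Nat.cast_add_one_pos j)) hη
    refine (liminf_le_liminf (Eventually.of_forall hall)).trans ?_
    rw [liminf_const]
end Raw

/-- a (sub)solution with De Giorgi class inequality -/
structure Sol (d Λ : ℝ) (Γ : Set (EE n)) (g u : EE n → ℝ) (G : EE n → EE n) : Prop where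
  um : StronglyMeasurable u
  Gm : StronglyMeasurable G
  apx : ∃ uk Q, Apx d Γ uk u G Q ∧ ∀ k, ∀ x ∈ Γ, uk k x = g x
  dg : ∀ η : EE n → ℝ, ContDiff ℝ 1 η → HasCompactSupport η → (∀ x, |η x| ≤ 1) →
    ∀ κ : ℝ, (tsupport η ⊆ Γᶜ ∨ ∀ x, η x ≠ 0 → g x ≤ κ) →
    ∫⁻ x in {x | κ < u x}, ENNReal.ofReal ((η x * η x) * ‖G x‖ ^ 2) ∂(nu d Γ) ≤
     ENNReal.ofReal (4 * Λ ^ 4) * ∫⁻ x, ENNReal.ofReal (‖gr η x‖ ^ 2 * (Max.max (u x - κ) 0) ^ 2) ∂(nu d Γ)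

lemma exists_sol {d C₀ Λ : ℝ} {Γ : Set (EE n)} (h : AR n d C₀ Γ)
    {a : EE n → EE n →ₗ[ℝ] EE n →ₗ[ℝ] ℝ} (ha : Frm d Λ Γ a) (m : Mean (nu d Γ))
    {g : EE n → ℝ} (gc : ContDiff ℝ 1 g) (gs : HasCompactSupport g)
    (g0 : ∀ x, 0 ≤ g x) (g1 : ∀ x, g x ≤ 1) :
    ∃ u G, Sol d Λ Γ g u G ∧ Sol d Λ Γ (-g) (-u) (-G) ∧ (∀ᵐ x, 0 ≤ u x ∧ u x ≤ 1) ∧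
      ∀ φ, Adm Γ φ → m.M (fun x => a x (G x) (gr φ x)) = 0 := by
  obtain ⟨u, G, uk, Q, r⟩ := exists_raw h ha m gc gs
  obtain ⟨hu, vk, Q', r', hb⟩ := r.clamp h ha g0 g1
  refine ⟨u, G, ⟨r.um, r.Gm, ⟨vk, Q', r'.apx, fun k x hx => r'.ueq k hx⟩, ?_⟩,
    ⟨r.um.neg, r.Gm.neg, ⟨_, Q', r'.neg.apx, fun k x hx => r'.neg.ueq k hx⟩, ?_⟩, hu, r.sol⟩
  · intro η h1 h2 h3 κ h4
    exact r'.dg h ha hb h1 h2 h3 h4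
  · intro η h1 h2 h3 κ h4
    exact r'.neg.dg h ha (fun k x => by simpa using hb k x) h1 h2 h3 h4
end EMN
open MeasureTheory Metric Set Filter
open scoped ENNReal Topology

namespace EMN
variable {n : ℕ}

section conv
variable {d C₀ : ℝ} {Γ : Set (EE n)}

lemma nu_lint {B : Set (EE n)} (hB : MeasurableSet B) (f : EE n → ℝ≥0∞) :
    ∫⁻ x in B, f x ∂(nu d Γ) = ∫⁻ x in B, ENNReal.ofReal (wt d Γ x) * f x := by
  rw [nu, setLIntegral_withDensity_eq_setLIntegral_mul_non_measurable _
    (wt_meas d Γ).ennreal_ofReal _ hB (Eventually.of_forall fun x => ENNReal.ofReal_lt_top)]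
  rfl

lemma AR.vol_le_nu (h : AR n d C₀ Γ) {B : Set (EE n)} (hB : MeasurableSet B) {ρ : ℝ} (hρ : 0 < ρ)
    (hb : ∀ y ∈ B, infDist y Γ ≤ ρ) (f : EE n → ℝ≥0∞) :
    ∫⁻ x in B, f x ≤ ENNReal.ofReal (ρ ^ ((n:ℝ) - 1 - d)) * ∫⁻ x in B, f x ∂(nu d Γ) := by
  rw [nu_lint hB, ← lintegral_const_mul' _ _ ENNReal.ofReal_ne_top]
  refine lintegral_mono_ae ?_
  filter_upwards [ae_restrict_of_ae h.ae_notMem, ae_restrict_mem hB] with x hx hxB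
  rw [← mul_assoc, ← ENNReal.ofReal_mul (by positivity)]
  have : 1 ≤ ρ ^ ((n:ℝ) - 1 - d) * wt d Γ x := by
    have h1 := h.infDist_pos hx
    have h2 : ρ ^ (d + 1 - (n:ℝ)) ≤ wt d Γ x :=
      Real.rpow_le_rpow_of_nonpos h1 (hb x hxB) (by linarith [h.hd])
    calc (1:ℝ) = ρ ^ ((n:ℝ) - 1 - d) * ρ ^ (d + 1 - (n:ℝ)) := by
          rw [← Real.rpow_add hρ]; ring_nf; simp
      _ ≤ _ := by gcongr
  calc f x = 1 * f x := (one_mul _).symm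
    _ ≤ _ := by
      gcongr
      rw [← ENNReal.ofReal_one]; exact ENNReal.ofReal_le_ofReal this

lemma AR.nu_le_vol (h : AR n d C₀ Γ) {B : Set (EE n)} (hB : MeasurableSet B) {ρ : ℝ} (hρ : 0 < ρ)
    (hb : ∀ y ∈ B, ρ ≤ infDist y Γ) (f : EE n → ℝ≥0∞) :
    ∫⁻ x in B, f x ∂(nu d Γ) ≤ ENNReal.ofReal (ρ ^ (d + 1 - (n:ℝ))) * ∫⁻ x in B, f x := by
  rw [nu_lint hB, ← lintegral_const_mul' _ _ ENNReal.ofReal_ne_top]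
  refine setLIntegral_mono' hB fun x hx => ?_
  gcongr
  exact Real.rpow_le_rpow_of_nonpos hρ (hb x hx) (by linarith [h.hd])
end conv

/-- Sobolev in weak form -/
lemma sob (hn : 2 ≤ n) : ∃ C > 0, ∀ (d : ℝ) (Γ : Set (EE n)) (Θ : ℕ → EE n → ℝ) (θ : EE n → ℝ)
    (V : EE n → EE n) (D : EE n → ℝ) (B : Set (EE n)) (W : ℝ), Apx d Γ Θ θ V D → MeasurableSet B → 0 ≤ W →
    (∀ f : EE n → ℝ≥0∞, ∫⁻ x in B, f x ≤ ENNReal.ofReal W * ∫⁻ x in B, f x ∂(nu d Γ)) →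
    nu d Γ B < ⊤ → (∀ k, HasCompactSupport (Θ k)) → (∀ k, tsupport (Θ k) ⊆ B) →
    volume {x | 1 ≤ θ x} ^ (n - 1) ≤
      (ENNReal.ofReal (C * W) * ∫⁻ x in B, ‖V x‖ₑ ∂(nu d Γ)) ^ n := by
  have hn1 : (1:NNReal) < n := by exact_mod_cast hn
  have hp := NNReal.HolderConjugate.conjExponent hn1
  set p := NNReal.conjExponent (n:NNReal)
  have hp' : NNReal.HolderConjugate (Module.finrank ℝ (EE n)) p := by simpa using hp
  set C := eLpNormLESNormFDerivOneConst (volume : Measure (EE n)) p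
  refine ⟨C + 1, by positivity, fun d Γ Θ θ V D B W A hB hW hf hν hcs hts => ?_⟩
  set I := ∫⁻ x in B, ‖V x‖ₑ ∂(nu d Γ)
  have hk : ∀ k, eLpNorm (Θ k) p volume ≤ C * (ENNReal.ofReal W * ∫⁻ x in B, ‖fderiv ℝ (Θ k) x‖ₑ ∂(nu d Γ)) := by
    intro k
    refine (eLpNorm_le_eLpNorm_fderiv_one volume (A.cd k) (hcs k) hp').trans ?_
    gcongr
    rw [eLpNorm_one_eq_lintegral_enorm]
    refine le_trans (le_of_eq ?_) (hf _)
    refine (setLIntegral_eq_of_support_subset ?_).symm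
    intro x hx
    by_contra hc
    apply hx
    have : x ∉ tsupport (Θ k) := fun h => hc (hts k h)
    have h2 : fderiv ℝ (Θ k) x = 0 := image_eq_zero_of_notMem_tsupport fun h => this (tsupport_fderiv_subset ℝ h)
    change ‖fderiv ℝ (Θ k) x‖ₑ = 0
    rw [← ofReal_norm, h2, norm_zero, ENNReal.ofReal_zero]
  have hlim : Tendsto (fun k => (C:ℝ≥0∞) * (ENNReal.ofReal W * ∫⁻ x in B, ‖fderiv ℝ (Θ k) x‖ₑ ∂(nu d Γ))) atTop
      (𝓝 (C * (ENNReal.ofReal W * I))) :=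
    ENNReal.Tendsto.const_mul (ENNReal.Tendsto.const_mul (A.tend hν) (Or.inr ENNReal.ofReal_ne_top))
      (Or.inr ENNReal.coe_ne_top)
  have hθm : AEStronglyMeasurable θ volume :=
    aestronglyMeasurable_of_tendsto_ae atTop (fun k => (A.cd k).continuous.aestronglyMeasurable) A.lim
  have h1 : eLpNorm θ p volume ≤ C * (ENNReal.ofReal W * I) := by
    refine (Lp.eLpNorm_lim_le_liminf_eLpNorm (fun k => (A.cd k).continuous.aestronglyMeasurable) θ A.lim).trans ?_
    rw [← hlim.liminf_eq]
    exact liminf_le_liminf (Eventually.of_forall hk)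
  have hp0 : 0 < p := hp.symm.pos
  have h2 := mul_meas_ge_le_pow_eLpNorm' (volume : Measure (EE n)) (p := (p:ℝ≥0∞)) (by exact_mod_cast hp0.ne')
    ENNReal.coe_ne_top hθm 1
  rw [ENNReal.one_rpow, one_mul] at h2
  have hpe : (p:ℝ) * ((n - 1 : ℕ) : ℝ) = n := by
    have h4 := hp.coe.sub_one_mul_conj
    rw [Nat.cast_sub (by omega)]
    push_cast at h4 ⊢
    linarith
  calc volume {x | 1 ≤ θ x} ^ (n - 1) ≤ (eLpNorm θ p volume ^ (p:ℝ)) ^ (n - 1) := by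
        gcongr
        refine (measure_mono ?_).trans h2
        intro x hx
        have hx : 1 ≤ θ x := hx
        change 1 ≤ ‖θ x‖ₑ
        rw [← ofReal_norm, ← ENNReal.ofReal_one]
        exact ENNReal.ofReal_le_ofReal (hx.trans (le_abs_self _))
    _ = eLpNorm θ p volume ^ n := by
        rw [← ENNReal.rpow_natCast, ← ENNReal.rpow_mul, hpe, ENNReal.rpow_natCast]
    _ ≤ _ := by
        gcongr
        refine h1.trans ?_
        rw [ENNReal.ofReal_mul (by positivity), ← mul_assoc]
        gcongr
        rw [← ENNReal.ofReal_coe_nnreal]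
        exact ENNReal.ofReal_le_ofReal (by linarith)

namespace Sol
variable {d C₀ Λ : ℝ} {Γ : Set (EE n)} {g u : EE n → ℝ} {G : EE n → EE n}

lemma lev_meas (s : Sol d Λ Γ g u G) (κ : ℝ) : MeasurableSet {x | κ < u x} :=
  measurableSet_lt measurable_const s.um.measurable

lemma energy (s : Sol d Λ Γ g u G) {η : EE n → ℝ} (ηc : ContDiff ℝ 1 η) (ηs : HasCompactSupport η)
    (η1 : ∀ x, |η x| ≤ 1) {κ M K : ℝ} (hη : tsupport η ⊆ Γᶜ ∨ ∀ x, η x ≠ 0 → g x ≤ κ)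
    {B B' : Set (EE n)} (hB : MeasurableSet B) (hB' : MeasurableSet B')
    (hgr : ∀ x, ‖fderiv ℝ η x‖ ≤ K) (hout : tsupport η ⊆ B')
    (hB1 : ∀ x ∈ B, η x = 1) (hu : ∀ᵐ x ∂(volume.restrict B'), u x ≤ M) :
    ∫⁻ x in B ∩ {x | κ < u x}, ‖G x‖ₑ ^ 2 ∂(nu d Γ) ≤
      ENNReal.ofReal (4 * Λ ^ 4 * K ^ 2 * (M - κ) ^ 2) * nu d Γ (B' ∩ {x | κ < u x}) := by
  have hK : 0 ≤ K := (norm_nonneg _).trans (hgr 0)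
  have h1 := s.dg η ηc ηs η1 κ hη
  have hu' : ∀ᵐ x ∂(nu d Γ), x ∈ B' → u x ≤ M :=
    (AR.nu_ac (d := d) (Γ := Γ)).ae_le ((ae_restrict_iff' hB').1 hu)
  have hz : ∀ x ∉ B', gr η x = 0 := by
    intro x hx
    have h0 : fderiv ℝ η x = 0 :=
      image_eq_zero_of_notMem_tsupport fun h => hx (hout (tsupport_fderiv_subset ℝ h))
    rw [gr, h0, map_zero]
  calc ∫⁻ x in B ∩ {x | κ < u x}, ‖G x‖ₑ ^ 2 ∂(nu d Γ)
      = ∫⁻ x in B ∩ {x | κ < u x}, ENNReal.ofReal ((η x * η x) * ‖G x‖ ^ 2) ∂(nu d Γ) := by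
        refine setLIntegral_congr_fun (hB.inter (s.lev_meas κ)) fun x hx => ?_
        simp only [hB1 x hx.1, one_mul]
        rw [← ofReal_norm, ENNReal.ofReal_pow (norm_nonneg _)]
    _ ≤ ∫⁻ x in {x | κ < u x}, ENNReal.ofReal ((η x * η x) * ‖G x‖ ^ 2) ∂(nu d Γ) :=
        lintegral_mono_set inter_subset_right
    _ ≤ _ := h1
    _ ≤ ENNReal.ofReal (4 * Λ ^ 4) * ∫⁻ x in B' ∩ {x | κ < u x}, ENNReal.ofReal (K ^ 2 * (M - κ) ^ 2) ∂(nu d Γ) := by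
        refine mul_le_mul' le_rfl ?_
        rw [← lintegral_indicator (hB'.inter (s.lev_meas κ))]
        refine lintegral_mono_ae ?_
        filter_upwards [hu'] with x hx
        by_cases hxS : x ∈ B' ∩ {x | κ < u x}
        · rw [indicator_of_mem hxS]
          apply ENNReal.ofReal_le_ofReal
          have e1 : κ < u x := hxS.2
          have e2 := hx hxS.1
          rw [norm_gr, max_eq_left (by linarith)]
          have := hgr x
          have e3 : 0 ≤ u x - κ := by linarith
          gcongr
        · rw [indicator_of_notMem hxS]
          by_cases hx1 : x ∈ B'
          · have : ¬ κ < u x := fun h => hxS ⟨hx1, h⟩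
            rw [max_eq_right (by linarith)]; simp
          · rw [hz x hx1]; simp
    _ = _ := by
        rw [setLIntegral_const, ← mul_assoc, ← ENNReal.ofReal_mul (by positivity)]
        congr 2; ring


lemma pigeon (s : Sol d Λ Γ g u G) {B : Set (EE n)} (hB : MeasurableSet B) {V q m M τ : ℝ}
    (hV : nu d Γ B ≤ ENNReal.ofReal V) (hV0 : 0 ≤ V) (hq : 0 < q) (hmM : m < M) (hτ : 0 < τ) {J : ℕ} (hJ : 0 < J)
    (hJ2 : 4 * KS ^ 2 * q * V ≤ τ ^ 2 * J)
    (hen : ∀ κ, m ≤ κ → κ < M → ∫⁻ x in B ∩ {x | κ < u x}, ‖G x‖ₑ ^ 2 ∂(nu d Γ) ≤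
      ENNReal.ofReal (q * (M - κ) ^ 2)) :
    ∃ k l, m ≤ k ∧ k < l ∧ l ≤ M - (M - m) / 2 ^ J ∧
      ∫⁻ x in B, ‖deriv (T k l) (u x) • G x‖ₑ ∂(nu d Γ) ≤ ENNReal.ofReal τ := by
  have hKS := KS_one
  have hJR : (0:ℝ) < J := by exact_mod_cast hJ
  set lev : ℕ → ℝ := fun j => M - (M - m) / 2 ^ j with hlev
  have hd : 0 < M - m := by linarith
  have hhalf : ∀ j, M - lev (j+1) = (M - lev j) / 2 := fun j => by
    simp only [hlev]; rw [pow_succ]; field_simp; ring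
  have hpos : ∀ j, 0 < M - lev j := fun j => by
    simp only [hlev]
    have : 0 < (M - m) / 2 ^ j := by positivity
    linarith
  have hlt : ∀ j, lev j < lev (j+1) := fun j => by linarith [hhalf j, hpos j]
  have hmono : StrictMono lev := strictMono_nat_of_lt_succ hlt
  set Sj : ℕ → Set (EE n) := fun j => (B ∩ {x | lev j < u x}) ∩ {x | u x ≤ lev (j+1)} with hSj
  have hSm : ∀ j, MeasurableSet (Sj j) := fun j =>
    (hB.inter (s.lev_meas _)).inter (measurableSet_le s.um.measurable measurable_const)
  have hdis : Pairwise (Function.onFun Disjoint Sj) := by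
    intro i j hij
    rw [Function.onFun, Set.disjoint_left]
    rintro x ⟨⟨-, h1⟩, h2⟩ ⟨⟨-, h3⟩, h4⟩
    simp only [mem_ofPred_eq] at h1 h2 h3 h4
    rcases lt_or_gt_of_ne hij with h | h
    · have := hmono.monotone (Nat.succ_le_of_lt h); simp only [Nat.succ_eq_add_one] at this; linarith
    · have := hmono.monotone (Nat.succ_le_of_lt h); simp only [Nat.succ_eq_add_one] at this; linarith
  obtain ⟨j, hj, hjV⟩ : ∃ j ∈ Finset.range J, nu d Γ (Sj j) ≤ ENNReal.ofReal (V / J) := by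
    by_contra hc
    push Not at hc
    have h1 : ∑ j ∈ Finset.range J, nu d Γ (Sj j) ≤ ENNReal.ofReal V := by
      rw [← measure_biUnion_finset (fun i _ j _ hij => hdis hij) (fun j _ => hSm j)]
      refine (measure_mono ?_).trans hV
      simp only [iUnion_subset_iff]
      exact fun j _ x hx => hx.1.1
    have h2 : ∑ j ∈ Finset.range J, ENNReal.ofReal (V / J) < ∑ j ∈ Finset.range J, nu d Γ (Sj j) :=
      ENNReal.sum_lt_sum_of_nonempty (Finset.nonempty_range_iff.2 hJ.ne') hc
    rw [Finset.sum_const, Finset.card_range, nsmul_eq_mul, ← ENNReal.ofReal_natCast,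
      ← ENNReal.ofReal_mul hJR.le, mul_div_cancel₀ _ hJR.ne'] at h2
    exact absurd (h2.trans_le h1) (lt_irrefl _)
  have hjJ := Finset.mem_range.1 hj
  refine ⟨lev j, lev (j+1), ?_, hlt j, ?_, ?_⟩
  · have := hmono.monotone (Nat.zero_le j)
    simpa [hlev] using this
  · exact hmono.monotone (Nat.succ_le_of_lt hjJ)
  set h := M - lev j with hh
  have h0 : 0 < h := hpos j
  set ε := τ / (2 * KS * q) with hε
  have hε0 : 0 < ε := by positivity
  have hlk : lev (j+1) - lev j = h / 2 := by linarith [hhalf j]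
  calc ∫⁻ x in B, ‖deriv (T (lev j) (lev (j+1))) (u x) • G x‖ₑ ∂(nu d Γ)
      ≤ ∫⁻ x in B, (Sj j).indicator (fun x => ENNReal.ofReal (2 * KS / h) *
          (ENNReal.ofReal (ε / h / 2) * ‖G x‖ₑ ^ 2 + ENNReal.ofReal (h / ε / 2))) x ∂(nu d Γ) := by
        refine setLIntegral_mono' hB fun x hx => ?_
        by_cases hxS : x ∈ Sj j
        · rw [indicator_of_mem hxS, ← ofReal_norm, ← ofReal_norm, ← ENNReal.ofReal_pow (norm_nonneg _),
            ← ENNReal.ofReal_mul (by positivity), ← ENNReal.ofReal_add (by positivity) (by positivity),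
            ← ENNReal.ofReal_mul (by positivity)]
          apply ENNReal.ofReal_le_ofReal
          rw [norm_smul, Real.norm_of_nonneg (T_deriv_nonneg (hlt j) _)]
          have e1 := T_deriv_le (hlt j) (u x)
          have e2 : KS / (lev (j+1) - lev j) = 2 * KS / h := by rw [hlk]; field_simp
          rw [e2] at e1
          have e3 : ‖G x‖ ≤ ε / h / 2 * ‖G x‖ ^ 2 + h / ε / 2 := by
            have : 0 ≤ (ε * ‖G x‖ - h) ^ 2 / (2 * ε * h) := by positivity
            have e4 : (ε * ‖G x‖ - h) ^ 2 / (2 * ε * h) = ε / h / 2 * ‖G x‖ ^ 2 + h / ε / 2 - ‖G x‖ := by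
              field_simp; ring
            linarith
          gcongr
        · rw [indicator_of_notMem hxS, T_deriv_zero (hlt j), zero_smul, enorm_zero]
          by_contra hc
          push Not at hc
          exact hxS ⟨⟨hx, hc.1⟩, hc.2.le⟩
    _ ≤ ∫⁻ x in Sj j, ENNReal.ofReal (2 * KS / h) *
          (ENNReal.ofReal (ε / h / 2) * ‖G x‖ₑ ^ 2 + ENNReal.ofReal (h / ε / 2)) ∂(nu d Γ) := by
        refine (setLIntegral_le_lintegral _ _).trans ?_
        rw [lintegral_indicator (hSm j)]
    _ = ENNReal.ofReal (2 * KS / h) * (ENNReal.ofReal (ε / h / 2) * (∫⁻ x in Sj j, ‖G x‖ₑ ^ 2 ∂(nu d Γ)) +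
          ENNReal.ofReal (h / ε / 2) * nu d Γ (Sj j)) := by
        rw [lintegral_const_mul' _ _ ENNReal.ofReal_ne_top, lintegral_add_right _ measurable_const,
          lintegral_const_mul' _ _ ENNReal.ofReal_ne_top, setLIntegral_const]
    _ ≤ ENNReal.ofReal (2 * KS / h) * (ENNReal.ofReal (ε / h / 2) * ENNReal.ofReal (q * h ^ 2) +
          ENNReal.ofReal (h / ε / 2) * ENNReal.ofReal (V / J)) := by
        refine mul_le_mul' le_rfl (add_le_add (mul_le_mul' le_rfl ?_) (mul_le_mul' le_rfl hjV))
        refine (lintegral_mono_set inter_subset_left).trans (hen _ ?_ (by linarith))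
        have := hmono.monotone (Nat.zero_le j)
        simpa [hlev] using this
    _ ≤ _ := by
        rw [← ENNReal.ofReal_mul (by positivity), ← ENNReal.ofReal_mul (by positivity),
          ← ENNReal.ofReal_add (by positivity) (by positivity), ← ENNReal.ofReal_mul (by positivity)]
        apply ENNReal.ofReal_le_ofReal
        have e1 : 2 * KS / h * (ε / h / 2 * (q * h ^ 2) + h / ε / 2 * (V / J)) =
            KS * ε * q + KS * V / (ε * J) := by field_simp
        have e2 : KS * ε * q = τ / 2 := by rw [hε]; field_simp
        have e3 : KS * V / (ε * J) ≤ τ / 2 := by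
          rw [hε, div_le_iff₀ (by positivity)]
          have : τ / 2 * (τ / (2 * KS * q) * J) = τ ^ 2 * J / (4 * KS * q) := by field_simp; ring
          rw [this, le_div_iff₀ (by positivity)]
          nlinarith
        rw [e1, e2]; linarith

end Sol
end EMN
open MeasureTheory Metric Set Filter
open scoped ENNReal Topology

namespace EMN
variable {n : ℕ}

lemma Apx.cutmul {d C₀ : ℝ} {Γ : Set (EE n)} (h : AR n d C₀ Γ) {Θ : ℕ → EE n → ℝ} {θ : EE n → ℝ} {V : EE n → EE n}
    {D : EE n → ℝ} (A : Apx d Γ Θ θ V D) (Θb : ∀ k x, |Θ k x| ≤ 1)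
    {η : EE n → ℝ} (ηc : ContDiff ℝ 1 η) (ηs : HasCompactSupport η) (η1 : ∀ x, |η x| ≤ 1) :
    Apx d Γ (fun k x => η x * Θ k x) (fun x => η x * θ x) (fun x => η x • V x + θ x • gr η x)
      (fun x => 2 * D x + 2 * ‖gr η x‖ ^ 2) := by
  have := h.fmc
  have hgr : ∀ k x, gr (fun x => η x * Θ k x) x = η x • gr (Θ k) x + Θ k x • gr η x := fun k x => by
    rw [gr_mul ηc (A.cd k)]
  refine ⟨fun k => ηc.mul (A.cd k), ?_, ?_, ?_, ?_⟩
  · have h1 : Integrable (fun x => ‖gr η x‖ ^ 2) (nu d Γ) := by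
      refine Continuous.integrable_of_hasCompactSupport ((gr_cont ηc).norm.pow 2) ?_
      exact (gr_compact ηs).comp_left (g := fun v => ‖v‖ ^ 2) (by simp)
    exact (A.Di.const_mul 2).add (h1.const_mul 2)
  · filter_upwards [A.Db] with x hx k
    rw [hgr]
    have hA : ‖η x • gr (Θ k) x‖ ≤ ‖gr (Θ k) x‖ := by
      rw [norm_smul]; exact mul_le_of_le_one_left (norm_nonneg _) (η1 x)
    have hB : ‖Θ k x • gr η x‖ ≤ ‖gr η x‖ := by
      rw [norm_smul]; exact mul_le_of_le_one_left (norm_nonneg _) (Θb k x)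
    have h1 := (norm_add_le (η x • gr (Θ k) x) (Θ k x • gr η x)).trans (add_le_add hA hB)
    have h2 := hx k
    nlinarith [sq_nonneg (‖gr (Θ k) x‖ - ‖gr η x‖), norm_nonneg (η x • gr (Θ k) x + Θ k x • gr η x)]
  · filter_upwards [A.lim] with x hx
    exact hx.const_mul _
  · filter_upwards [A.lim, A.glim] with x hx hG
    simp only [hgr]
    exact Tendsto.add (hG.const_smul _) (hx.smul_const _)

lemma iter_real (hn : 2 ≤ n) {D : ℝ} (hD : 0 < D) : ∃ ε > 0, ∀ ρ > 0, ∀ a : ℕ → ℝ≥0∞,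
    a 0 ≤ ENNReal.ofReal (ε * ρ ^ n) →
    (∀ j, a (j+1) ^ (n-1) ≤ (ENNReal.ofReal (D * 8 ^ j / ρ) * a j) ^ n) →
    ∀ j, a j ≤ ENNReal.ofReal (ε * ρ ^ n * (((8:ℝ) ^ n)⁻¹) ^ j) := by
  obtain ⟨N, rfl⟩ : ∃ N, n = N + 1 := ⟨n - 1, by omega⟩
  set t : ℝ := ((8:ℝ) ^ (N+1))⁻¹ with ht
  have t0 : 0 < t := by positivity
  have ht8 : (8:ℝ)^(N+1) * t = 1 := by rw [ht]; field_simp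
  refine ⟨t ^ N / D ^ (N+1), by positivity, fun ρ hρ a h0 hs j => ?_⟩
  set ε := t ^ N / D ^ (N+1) with hε
  have e0 : 0 < ε := by positivity
  have hDe : D ^ (N+1) * ε = t ^ N := by rw [hε]; field_simp
  induction j with
  | zero => simpa using h0
  | succ j ih =>
    have h1 := hs j
    simp only [Nat.add_sub_cancel] at h1
    rw [← ENNReal.pow_le_pow_left_iff (show N ≠ 0 by omega), ← ENNReal.ofReal_pow (by positivity)]
    refine h1.trans ((pow_le_pow_left' (mul_le_mul' le_rfl ih) _).trans ?_)
    rw [← ENNReal.ofReal_mul (by positivity), ← ENNReal.ofReal_pow (by positivity)]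
    refine ENNReal.ofReal_le_ofReal (le_of_eq ?_)
    have e1 : D * 8 ^ j / ρ * (ε * ρ ^ (N+1) * t ^ j) = D * ε * 8 ^ j * t ^ j * ρ ^ N := by
      field_simp
      ring
    rw [e1]
    calc (D * ε * 8 ^ j * t ^ j * ρ ^ N) ^ (N+1)
        = (D ^ (N+1) * ε) * ε ^ N * (8 ^ (N+1) * t) ^ j * (t ^ j) ^ N * (ρ ^ (N+1)) ^ N := by ring
      _ = t ^ N * ε ^ N * (t ^ j) ^ N * (ρ ^ (N+1)) ^ N := by rw [hDe, ht8]; ring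
      _ = _ := by ring

lemma AR.whit {d C₀ : ℝ} {Γ : Set (EE n)} (h : AR n d C₀ Γ) {X : EE n} (hX : X ∉ Γ) :
    ∃ W W' : ℝ, 0 < W ∧ 0 < W' ∧ W * W' ≤ 4 ^ n ∧ ∀ B, MeasurableSet B → B ⊆ ball X (infDist X Γ / 2) →
      (∀ f : EE n → ℝ≥0∞, ∫⁻ x in B, f x ≤ ENNReal.ofReal W * ∫⁻ x in B, f x ∂(nu d Γ)) ∧
      (∀ f : EE n → ℝ≥0∞, ∫⁻ x in B, f x ∂(nu d Γ) ≤ ENNReal.ofReal W' * ∫⁻ x in B, f x) := by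
  have hδ := h.infDist_pos hX
  set δ := infDist X Γ
  have hd := h.hd
  have hd0 := h.hd0
  refine ⟨(2*δ) ^ ((n:ℝ) - 1 - d), (δ/2) ^ (d + 1 - (n:ℝ)), by positivity, by positivity, ?_, fun B hB hs => ⟨?_, ?_⟩⟩
  · have : (δ/2) ^ (d + 1 - (n:ℝ)) = ((δ/2) ^ ((n:ℝ) - 1 - d))⁻¹ := by
      rw [← Real.rpow_neg (by positivity)]; congr 1; ring
    rw [this, ← div_eq_mul_inv, ← Real.div_rpow (by positivity) (by positivity)]
    have : 2 * δ / (δ / 2) = 4 := by field_simp; norm_num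
    rw [this, ← Real.rpow_natCast]
    exact Real.rpow_le_rpow_of_exponent_le (by norm_num) (by linarith)
  · refine h.vol_le_nu hB (by positivity) fun y hy => ?_
    have h1 := infDist_le_infDist_add_dist (s := Γ) (x := y) (y := X)
    have h2 := mem_ball.1 (hs hy)
    change _ ≤ δ + _ at h1
    linarith
  · refine h.nu_le_vol hB (by positivity) fun y hy => ?_
    have h1 := infDist_le_infDist_add_dist (s := Γ) (x := X) (y := y)
    have h2 := mem_ball.1 (hs hy)
    rw [dist_comm] at h2
    change δ ≤ _ at h1
    linarith

lemma T_deriv_zero' {a b : ℝ} (hab : a < b) {t : ℝ} (h : ¬ a < t) : deriv (T a b) t = 0 :=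
  T_deriv_zero hab (Or.inl (not_lt.1 h))

namespace Sol
variable {d C₀ Λ : ℝ} {Γ : Set (EE n)}

lemma stepA (h : AR n d C₀ Γ) (hΛ : 0 < Λ) : ∃ C > 0, ∀ g u G, Sol d Λ Γ g u G → ∀ X ∉ Γ,
    ∀ ρ₁ s k l M H : ℝ, 0 < ρ₁ → 0 < s → ρ₁ + 4 * s ≤ infDist X Γ / 2 → k < l → 1 ≤ H → 0 < M - k → M - k ≤ H * (l - k) →
    (∀ᵐ x ∂(volume.restrict (ball X (ρ₁ + 4 * s))), u x ≤ M) →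
    volume (ball X ρ₁ ∩ {x | l < u x}) ^ (n-1) ≤
      (ENNReal.ofReal (C * H ^ 2 / s) * volume (ball X (ρ₁ + 4 * s) ∩ {x | k < u x})) ^ n := by
  obtain ⟨C, hC, hsob⟩ := sob h.two_le
  have hKS := KS_one
  set C1 := KS ^ 2 * (16 * Λ ^ 4 + 3) with hC1
  have hC10 : 0 < C1 := by positivity
  refine ⟨C * 4 ^ n * C1, by positivity, fun g u G sl X hX ρ₁ s k l M H hρ hs hle hkl hH hMk hMH hu => ?_⟩
  obtain ⟨W, W', hW, hW', hWW, hw⟩ := h.whit hX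
  obtain ⟨uk, Q, A, -⟩ := sl.apx
  set B1 := ball X (ρ₁ + 2 * s)
  set B2 := ball X (ρ₁ + 4 * s)
  have hB1s : B1 ⊆ B2 := ball_subset_ball (by linarith)
  have hB2s : B2 ⊆ ball X (infDist X Γ / 2) := ball_subset_ball hle
  have hδ := h.infDist_pos hX
  set η := cut X ρ₁ (ρ₁ + s)
  have hηab : ρ₁ < ρ₁ + s := by linarith
  set ζ := cut X (ρ₁ + 2*s) (ρ₁ + 3 * s)
  have hζab : ρ₁ + 2*s < ρ₁ + 3*s := by linarith
  have hζ0 : 0 ≤ ρ₁ + 2*s := by linarith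
  have hE := sl.energy (cut_smooth X (ρ₁ + 2*s) (ρ₁ + 3 * s)) (cut_compact hζ0 hζab)
    (fun x => by rw [abs_of_nonneg (cut_nonneg _ _ _ _)]; exact cut_le_one _ _ _ _) (κ := k) (M := M) (B := B1)
    (B' := B2) (K := 2 * KS / s) (Or.inl ?_) measurableSet_ball measurableSet_ball
    (fun x => (cut_fderiv_bd hζ0 hζab x).trans (le_of_eq (by ring))) ?_ ?_ hu
  rotate_left
  · intro y hy hyΓ
    have h1 := cut_tsupport hζ0 hζab hy
    have h2 := infDist_le_dist_of_mem (x := X) hyΓ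
    rw [mem_closedBall, dist_comm] at h1
    linarith
  · exact (cut_tsupport hζ0 hζab).trans (closedBall_subset_ball (by linarith))
  · intro x hx
    exact cut_one hζ0 hζab (mem_ball.1 hx).le
  set P := ENNReal.ofReal W' * volume (B2 ∩ {x | k < u x})
  have hlm := sl.lev_meas k
  have hP : nu d Γ (B2 ∩ {x | k < u x}) ≤ P := by
    have := (hw (B2 ∩ {x | k < u x}) (measurableSet_ball.inter hlm)
      (inter_subset_left.trans hB2s)).2 (fun _ => 1)
    simpa [P] using this
  have A2 := (Raw.comp_apx A (T_smooth k l) (K := KS / (l - k)) (fun t => by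
    rw [abs_of_nonneg (T_deriv_nonneg hkl t)]; exact T_deriv_le hkl t)).cutmul h
      (fun k' x => by
        show |T k l _| ≤ 1
        rw [abs_of_nonneg (T_nonneg _ _ _)]; exact T_le_one _ _ _)
      (cut_smooth X ρ₁ (ρ₁ + s)) (cut_compact hρ.le hηab)
      (fun x => by rw [abs_of_nonneg (cut_nonneg _ _ _ _)]; exact cut_le_one _ _ _ _)
  have hts : ∀ k', tsupport (fun x => cut X ρ₁ (ρ₁ + s) x * T k l (uk k' x)) ⊆ closedBall X (ρ₁ + s) := fun k' =>
    (tsupport_mul_subset_left).trans (cut_tsupport hρ.le hηab)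
  have hS := hsob _ _ _ _ _ _ B1 W A2 measurableSet_ball hW.le
    (hw B1 measurableSet_ball (hB1s.trans hB2s)).1 (h.nu_ball_lt _ _)
    (fun k' => (isCompact_closedBall X (ρ₁+s)).of_isClosed_subset (isClosed_tsupport _) (hts k'))
    (fun k' => (hts k').trans (closedBall_subset_ball (by linarith)))
  have hsub : ball X ρ₁ ∩ {x | l < u x} ⊆ {x | 1 ≤ cut X ρ₁ (ρ₁ + s) x * T k l (u x)} := by
    rintro x ⟨hx, hx2⟩
    simp only [mem_ofPred_eq]
    rw [cut_one hρ.le hηab (mem_ball.1 hx).le, T_one hkl (le_of_lt hx2), one_mul]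
  refine (pow_le_pow_left' (measure_mono hsub) _).trans (hS.trans (pow_le_pow_left' ?_ _))
  -- gradient estimate
  set τ := s / (M - k) ^ 2
  have hτ : 0 < τ := by positivity
  set c2 := (KS / (l - k)) ^ 2 / τ + 2 * KS / s
  have hlk : 0 < l - k := by linarith
  have hc2 : 0 ≤ c2 := by positivity
  have hpt : ∀ x, ‖cut X ρ₁ (ρ₁ + s) x • (deriv (T k l) (u x) • G x) + T k l (u x) • gr (cut X ρ₁ (ρ₁ + s)) x‖ₑ ≤
      ({x | k < u x}).indicator (fun x => ENNReal.ofReal τ * ‖G x‖ₑ ^ 2 + ENNReal.ofReal c2) x := by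
    intro x
    by_cases hx : k < u x
    · rw [indicator_of_mem (by exact hx), ← ofReal_norm, ← ofReal_norm, ← ENNReal.ofReal_pow (norm_nonneg _),
        ← ENNReal.ofReal_mul hτ.le, ← ENNReal.ofReal_add (by positivity) hc2]
      refine ENNReal.ofReal_le_ofReal ((norm_add_le _ _).trans ?_)
      have h1 : ‖cut X ρ₁ (ρ₁ + s) x • (deriv (T k l) (u x) • G x)‖ ≤ KS / (l - k) * ‖G x‖ := by
        rw [norm_smul, norm_smul, Real.norm_of_nonneg (cut_nonneg _ _ _ _), Real.norm_of_nonneg (T_deriv_nonneg hkl _)]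
        have := T_deriv_le hkl (u x)
        have h0 := T_deriv_nonneg hkl (u x)
        calc _ ≤ 1 * (KS / (l - k) * ‖G x‖) := by gcongr; exact cut_le_one _ _ _ _
          _ = _ := one_mul _
      have h2 : ‖T k l (u x) • gr (cut X ρ₁ (ρ₁ + s)) x‖ ≤ 2 * KS / s := by
        rw [norm_smul, Real.norm_of_nonneg (T_nonneg _ _ _), norm_gr]
        have := cut_fderiv_bd (c := X) hρ.le hηab x
        rw [add_sub_cancel_left] at this
        calc _ ≤ 1 * (2 * KS / s) := by gcongr; exact T_le_one _ _ _
          _ = _ := one_mul _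
      have h3 : KS / (l - k) * ‖G x‖ ≤ τ * ‖G x‖ ^ 2 + (KS / (l - k)) ^ 2 / τ := by
        have h4 : (KS / (l - k)) ^ 2 / τ * τ = (KS / (l - k)) ^ 2 := by field_simp
        have h5 : 0 ≤ (KS / (l - k)) ^ 2 / τ := by positivity
        have h6 : 0 ≤ KS / (l - k) := by positivity
        by_contra hc
        push Not at hc
        nlinarith [sq_nonneg (τ * ‖G x‖ - KS / (l - k)), mul_pos hτ (sub_pos.2 hc), norm_nonneg (G x), mul_nonneg h6 (mul_nonneg hτ.le (norm_nonneg (G x)))]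
      simp only [c2]
      linarith
    · rw [indicator_of_notMem (by exact hx), T_deriv_zero' hkl hx, T_zero hkl (not_lt.1 hx)]
      simp
  have hV : ∫⁻ x in B1, ‖cut X ρ₁ (ρ₁ + s) x • (deriv (T k l) (u x) • G x) + T k l (u x) • gr (cut X ρ₁ (ρ₁ + s)) x‖ₑ ∂(nu d Γ)
      ≤ ENNReal.ofReal (C1 * H ^ 2 / s) * P := by
    refine (lintegral_mono hpt).trans ?_
    rw [setLIntegral_indicator hlm, inter_comm, lintegral_add_right _ measurable_const, setLIntegral_const,
      lintegral_const_mul' _ _ ENNReal.ofReal_ne_top]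
    have e1 : nu d Γ (B1 ∩ {x | k < u x}) ≤ P := (measure_mono (inter_subset_inter_left _ hB1s)).trans hP
    refine (add_le_add (mul_le_mul' le_rfl (hE.trans (mul_le_mul' le_rfl hP))) (mul_le_mul' le_rfl e1)).trans ?_
    rw [← mul_assoc, ← add_mul, ← ENNReal.ofReal_mul hτ.le, ← ENNReal.ofReal_add (by positivity) hc2]
    refine mul_le_mul' (ENNReal.ofReal_le_ofReal ?_) le_rfl
    have e2 : (KS / (l - k)) ^ 2 / τ ≤ KS ^ 2 * H ^ 2 / s := by
      have : (KS / (l - k)) ^ 2 / τ = KS ^ 2 * ((M - k) / (l - k)) ^ 2 / s := by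
        simp only [τ]; field_simp
      rw [this]
      gcongr
      rw [div_le_iff₀ hlk]; exact hMH
    have e3 : τ * (4 * Λ ^ 4 * (2 * KS / s) ^ 2 * (M - k) ^ 2) = 16 * Λ ^ 4 * KS ^ 2 / s := by
      simp only [τ]; field_simp; ring
    have e4 : 16 * Λ ^ 4 * KS ^ 2 / s ≤ 16 * Λ ^ 4 * KS ^ 2 * H ^ 2 / s := by
      refine div_le_div_of_nonneg_right ?_ hs.le
      exact le_mul_of_one_le_right (by positivity) (one_le_pow₀ hH)
    have e5 : 2 * KS / s ≤ 2 * KS ^ 2 * H ^ 2 / s := by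
      refine div_le_div_of_nonneg_right ?_ hs.le
      have : (1:ℝ) ≤ H ^ 2 := one_le_pow₀ hH
      have h6 : KS ≤ KS ^ 2 := by nlinarith
      nlinarith [mul_le_mul_of_nonneg_left this (sq_nonneg KS)]
    rw [e3]
    calc _ ≤ 16 * Λ ^ 4 * KS ^ 2 * H ^ 2 / s + (KS ^ 2 * H ^ 2 / s + 2 * KS ^ 2 * H ^ 2 / s) := by
          simp only [c2]; gcongr
      _ = _ := by simp only [hC1]; ring
  refine (mul_le_mul' le_rfl hV).trans ?_
  simp only [P]
  rw [← mul_assoc, ← mul_assoc, ← ENNReal.ofReal_mul (by positivity), ← ENNReal.ofReal_mul (by positivity)]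
  refine mul_le_mul' (ENNReal.ofReal_le_ofReal ?_) le_rfl
  calc C * W * (C1 * H ^ 2 / s) * W' = C * (W * W') * C1 * H ^ 2 / s := by ring
    _ ≤ _ := by gcongr

lemma lemA (h : AR n d C₀ Γ) (hΛ : 0 < Λ) : ∃ ε > 0, ∀ g u G, Sol d Λ Γ g u G → ∀ X ∉ Γ,
    ∀ ρ m M : ℝ, 0 < ρ → ρ ≤ infDist X Γ / 2 → m < M →
    (∀ᵐ x ∂(volume.restrict (ball X ρ)), u x ≤ M) →
    volume (ball X ρ ∩ {x | m < u x}) ≤ ENNReal.ofReal (ε * ρ ^ n) →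
    ∀ᵐ x ∂(volume.restrict (ball X (ρ/2))), u x ≤ (m + M) / 2 := by
  obtain ⟨C, hC, hst⟩ := stepA h hΛ
  obtain ⟨ε, hε, hit⟩ := iter_real h.two_le (D := C * 2 ^ 8) (by positivity)
  refine ⟨ε, hε, fun g u G sl X hX ρ m M hρ hρδ hmM hu hsm => ?_⟩
  set k : ℕ → ℝ := fun j => m + (M - m) / 2 * (1 - 1 / 2 ^ j) with hk
  set r : ℕ → ℝ := fun j => ρ / 2 * (1 + 1 / 2 ^ j) with hr
  have hd : 0 < M - m := by linarith
  have hr1 : ∀ j, r j ≤ ρ := fun j => by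
    have : (1:ℝ) / 2 ^ j ≤ 1 := by rw [div_le_one (by positivity)]; exact one_le_pow₀ (by norm_num)
    simp only [hr]; nlinarith
  have hkk : ∀ j, k j ≤ (m + M) / 2 := fun j => by
    have : (0:ℝ) < 1 / 2 ^ j := by positivity
    simp only [hk]; nlinarith
  have hrr : ∀ j, ρ / 2 ≤ r j := fun j => by
    have : (0:ℝ) < 1 / 2 ^ j := by positivity
    simp only [hr]; nlinarith
  have key := hit ρ hρ (fun j => volume (ball X (r j) ∩ {x | k j < u x})) (by
      have e1 : r 0 = ρ := by simp only [hr]; norm_num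
      have e2 : k 0 = m := by simp only [hk]; norm_num
      simp only [e1, e2]; exact hsm) (fun j => by
      have e2 : (0:ℝ) < 2 ^ j := by positivity
      have hs : 0 < ρ / 2 ^ (j + 4) := by positivity
      have e1 : r (j+1) + 4 * (ρ / 2 ^ (j + 4)) = r j := by
        simp only [hr]; field_simp; ring
      have e3 : k (j+1) - k j = (M - m) / 2 ^ (j+2) := by
        simp only [hk]; field_simp; ring
      have := hst g u G sl X hX (r (j+1)) (ρ / 2 ^ (j+4)) (k j) (k (j+1)) M (2 ^ (j+2)) (by linarith [hrr (j+1)]) hs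
        (by rw [e1]; exact (hr1 j).trans hρδ) (by have : 0 < (M - m) / 2 ^ (j+2) := by positivity
                                                  linarith) (one_le_pow₀ (by norm_num))
        (by linarith [hkk j]) (by
          rw [e3, mul_div_cancel₀ _ (by positivity)]
          have : m ≤ k j := by
            have : (1:ℝ) / 2 ^ j ≤ 1 := by rw [div_le_one (by positivity)]; exact one_le_pow₀ (by norm_num)
            simp only [hk]; nlinarith
          linarith)
        (by rw [e1]; exact ae_restrict_of_ae_restrict_of_subset (ball_subset_ball (hr1 j)) hu)
      rw [e1] at this
      refine this.trans (le_of_eq ?_)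
      congr 3
      have e8 : (8:ℝ) ^ j = 2 ^ (j * 3) := by rw [mul_comm, pow_mul]; norm_num
      field_simp
      ring_nf
      rw [e8])
  rw [ae_restrict_iff' measurableSet_ball, ae_iff]
  refine measure_mono_null (t := ball X (ρ/2) ∩ {x | (m + M)/2 < u x}) (fun x hx => ?_) ?_
  · simp only [mem_ofPred_eq, Classical.not_imp, not_le] at hx
    exact hx
  · refine le_antisymm ?_ (zero_le)
    have hle : ∀ j, volume (ball X (ρ/2) ∩ {x | (m + M)/2 < u x}) ≤ ENNReal.ofReal (ε * ρ ^ n * (((8:ℝ) ^ n)⁻¹) ^ j) :=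
      fun j => (measure_mono (inter_subset_inter (ball_subset_ball (hrr j)) fun x hx => lt_of_le_of_lt (hkk j) hx)).trans
        (key j)
    have hn0 : n ≠ 0 := by have := h.two_le; omega
    have hlim : Tendsto (fun j : ℕ => ENNReal.ofReal (ε * ρ ^ n * (((8:ℝ) ^ n)⁻¹) ^ j)) atTop (𝓝 (ENNReal.ofReal (ε * ρ ^ n * 0))) := by
      refine ENNReal.tendsto_ofReal (Tendsto.const_mul _ (tendsto_pow_atTop_nhds_zero_of_lt_one (by positivity) ?_))
      exact inv_lt_one_of_one_lt₀ (one_lt_pow₀ (by norm_num) hn0)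
    rw [mul_zero, ENNReal.ofReal_zero] at hlim
    exact ge_of_tendsto' hlim hle

end Sol
end EMN
open MeasureTheory Metric Set Filter
open scoped ENNReal Topology

namespace EMN
variable {n : ℕ}

lemma Apx.F2 {d : ℝ} {Γ : Set (EE n)} {Θ : ℕ → EE n → ℝ} {θ : EE n → ℝ} {V : EE n → EE n}
    {D : EE n → ℝ} (A : Apx d Γ Θ θ V D) {B P : Set (EE n)} (hc : Convex ℝ B) (hB : MeasurableSet B)
    (hP : P ⊆ B) (hBf : volume B ≠ ⊤) (hν : nu d Γ B < ⊤) {L W : ℝ} (hL : ∀ x ∈ B, ∀ y ∈ B, dist x y ≤ L)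
    (hW : ∀ f : EE n → ℝ≥0∞, ∫⁻ x in B, f x ≤ ENNReal.ofReal W * ∫⁻ x in B, f x ∂(nu d Γ)) :
    volume P * ∫⁻ x in B, ‖θ x‖ₑ ≤ volume B * (∫⁻ x in P, ‖θ x‖ₑ) +
      ENNReal.ofReal (2 ^ n * L) * volume B * (ENNReal.ofReal W * ∫⁻ x in B, ‖V x‖ₑ ∂(nu d Γ)) := by
  set RH := ENNReal.ofReal (2 ^ n * L) * volume B * (ENNReal.ofReal W * ∫⁻ x in B, ‖V x‖ₑ ∂(nu d Γ))
  have hlim : Tendsto (fun k => ENNReal.ofReal (2 ^ n * L) * volume B * (ENNReal.ofReal W * ∫⁻ x in B, ‖fderiv ℝ (Θ k) x‖ₑ ∂(nu d Γ))) atTop (𝓝 RH) :=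
    ENNReal.Tendsto.const_mul (ENNReal.Tendsto.const_mul (A.tend hν) (Or.inr ENNReal.ofReal_ne_top))
      (Or.inr (ENNReal.mul_ne_top ENNReal.ofReal_ne_top hBf))
  have hk : ∀ k, ∫⁻ z in P, ∫⁻ y in B, ‖Θ k y - Θ k z‖ₑ ≤ ENNReal.ofReal (2 ^ n * L) * volume B * (ENNReal.ofReal W * ∫⁻ x in B, ‖fderiv ℝ (Θ k) x‖ₑ ∂(nu d Γ)) := by
    intro k
    refine (lintegral_mono_set hP).trans ((F2raw hc hB hBf hL (A.cd k)).trans ?_)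
    exact mul_le_mul' le_rfl (hW _)
  have hm : ∀ k, Measurable (fun p : EE n × EE n => ‖Θ k p.2 - Θ k p.1‖ₑ) := fun k => by
    have := (A.cd k).continuous
    fun_prop
  have hθm : AEStronglyMeasurable θ volume :=
    aestronglyMeasurable_of_tendsto_ae atTop (fun k => (A.cd k).continuous.aestronglyMeasurable) A.lim
  have hf : ∀ᵐ z ∂(volume.restrict P), ∫⁻ y in B, ‖θ y - θ z‖ₑ ≤ liminf (fun k => ∫⁻ y in B, ‖Θ k y - Θ k z‖ₑ) atTop := by
    filter_upwards [ae_restrict_of_ae A.lim] with z hz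
    refine le_trans (le_of_eq ?_) (lintegral_liminf_le fun k => ?_)
    · refine lintegral_congr_ae ?_
      filter_upwards [ae_restrict_of_ae A.lim] with y hy
      exact ((hy.sub hz).enorm).liminf_eq.symm
    · have := (A.cd k).continuous
      fun_prop
  have h1 : ∫⁻ z in P, ∫⁻ y in B, ‖θ y - θ z‖ₑ ≤ RH := by
    refine (lintegral_mono_ae hf).trans ((lintegral_liminf_le fun k => (hm k).lintegral_prod_right').trans ?_)
    rw [← hlim.liminf_eq]
    exact liminf_le_liminf (Eventually.of_forall hk)
  have h2 : ∀ z, ∫⁻ x in B, ‖θ x‖ₑ ≤ volume B * ‖θ z‖ₑ + ∫⁻ y in B, ‖θ y - θ z‖ₑ := fun z => by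
    rw [mul_comm, ← setLIntegral_const, ← lintegral_add_left measurable_const]
    refine lintegral_mono fun y => ?_
    have : θ y = θ z + (θ y - θ z) := by ring
    calc _ = ‖θ z + (θ y - θ z)‖ₑ := by rw [← this]
      _ ≤ _ := enorm_add_le _ _
  calc volume P * ∫⁻ x in B, ‖θ x‖ₑ = ∫⁻ z in P, ∫⁻ x in B, ‖θ x‖ₑ := by rw [setLIntegral_const, mul_comm]
    _ ≤ ∫⁻ z in P, (volume B * ‖θ z‖ₑ + ∫⁻ y in B, ‖θ y - θ z‖ₑ) := lintegral_mono h2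
    _ = volume B * (∫⁻ z in P, ‖θ z‖ₑ) + ∫⁻ z in P, ∫⁻ y in B, ‖θ y - θ z‖ₑ := by
      rw [lintegral_add_left', lintegral_const_mul' _ _ hBf]
      exact (hθm.restrict.enorm.const_mul _)
    _ ≤ _ := add_le_add le_rfl h1

namespace Sol
variable {d C₀ Λ : ℝ} {Γ : Set (EE n)}

lemma levels {g u : EE n → ℝ} {G : EE n → EE n} (s : Sol d Λ Γ g u G) (hΛ : 0 < Λ) {η : EE n → ℝ} (ηc : ContDiff ℝ 1 η)
    (ηs : HasCompactSupport η)
    (η1 : ∀ x, |η x| ≤ 1) {m M K V τ : ℝ} (hη : tsupport η ⊆ Γᶜ ∨ ∀ x, η x ≠ 0 → g x ≤ m)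
    {B B' : Set (EE n)} (hB : MeasurableSet B) (hB' : MeasurableSet B') (hBB : B ⊆ B')
    (hgr : ∀ x, ‖fderiv ℝ η x‖ ≤ K) (hout : tsupport η ⊆ B')
    (hB1 : ∀ x ∈ B, η x = 1) (hu : ∀ᵐ x ∂(volume.restrict B'), u x ≤ M) (hmM : m < M)
    (hV : nu d Γ B' ≤ ENNReal.ofReal V) (hV0 : 0 < V) (hK : 0 < K) (hτ : 0 < τ) {J : ℕ} (hJ : 0 < J)
    (hJ2 : 16 * KS ^ 2 * Λ ^ 4 * K ^ 2 * V ^ 2 ≤ τ ^ 2 * J) :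
    ∃ k l, m ≤ k ∧ k < l ∧ l < M ∧ (l + M) / 2 ≤ M - (M - m) / 2 ^ (J+1) ∧
      ∫⁻ x in B, ‖deriv (T k l) (u x) • G x‖ₑ ∂(nu d Γ) ≤ ENNReal.ofReal τ := by
  obtain ⟨k, l, h1, h2, h3, h4⟩ := s.pigeon hB (V := V) (q := 4 * Λ ^ 4 * K ^ 2 * V) ((measure_mono hBB).trans hV) hV0.le
    (by positivity) hmM hτ hJ (le_trans (le_of_eq (by ring)) hJ2) (fun κ hκ hκM => by
      refine (s.energy ηc ηs η1 (κ := κ) (M := M) (K := K) (hη.imp_right fun hh x hx => (hh x hx).trans hκ) hB hB' hgr hout hB1 hu).trans ?_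
      refine (mul_le_mul' le_rfl ((measure_mono inter_subset_left).trans hV)).trans ?_
      rw [← ENNReal.ofReal_mul (by positivity)]
      exact ENNReal.ofReal_le_ofReal (le_of_eq (by ring)))
  have h5 : 0 < (M - m) / 2 ^ J := div_pos (by linarith) (by positivity)
  refine ⟨k, l, h1, h2, by linarith, ?_, h4⟩
  have : (M - m) / 2 ^ (J+1) = (M - m) / 2 ^ J / 2 := by rw [pow_succ, div_div]
  linarith

lemma Tapx {uk : ℕ → EE n → ℝ} {u : EE n → ℝ} {G : EE n → EE n} {Q : EE n → ℝ} (A : Apx d Γ uk u G Q) {k l : ℝ} (hkl : k < l) :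
    Apx d Γ (fun j x => T k l (uk j x)) (fun x => T k l (u x)) (fun x => deriv (T k l) (u x) • G x)
      (fun x => (KS / (l - k)) ^ 2 * Q x) :=
  Raw.comp_apx A (T_smooth k l) (K := KS / (l - k)) (fun t => by
    rw [abs_of_nonneg (T_deriv_nonneg hkl t)]; exact T_deriv_le hkl t)

lemma cheb {g u : EE n → ℝ} {G : EE n → EE n} (s : Sol d Λ Γ g u G) {k l : ℝ} (hkl : k < l) {B B' : Set (EE n)} (hB : B ⊆ B') :
    volume (B ∩ {x | l < u x}) ≤ ∫⁻ x in B', ‖T k l (u x)‖ₑ := by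
  calc volume (B ∩ {x | l < u x}) ≤ volume (B' ∩ {x | l < u x}) := measure_mono (inter_subset_inter_left _ hB)
    _ = ∫⁻ x in B' ∩ {x | l < u x}, 1 := by simp
    _ = ∫⁻ x in B', ({x | l < u x}).indicator 1 x := by
      rw [setLIntegral_indicator (s.lev_meas l), inter_comm]; rfl
    _ ≤ _ := by
      refine lintegral_mono fun x => ?_
      by_cases hx : l < u x
      · rw [indicator_of_mem (by exact hx), T_one hkl hx.le]; simp
      · rw [indicator_of_notMem (by exact hx)]; exact zero_le

lemma cut_abs (X : EE n) (a b : ℝ) (x : EE n) : |cut X a b x| ≤ 1 := by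
  rw [abs_of_nonneg (cut_nonneg _ _ _ _)]; exact cut_le_one _ _ _ _

lemma exJ {a t : ℝ} (ht : 0 < t) : ∃ J : ℕ, 0 < J ∧ a ≤ t ^ 2 * J := by
  obtain ⟨J, hJ⟩ := exists_nat_ge (a / t ^ 2)
  refine ⟨J + 1, by omega, ?_⟩
  rw [div_le_iff₀ (by positivity)] at hJ
  push_cast
  nlinarith [sq_nonneg t]

lemma IGL (h : AR n d C₀ Γ) (hΛ : 0 < Λ) : ∃ c > 0, ∀ g u G, Sol d Λ Γ g u G → ∀ X ∉ Γ,
    ∀ ρ m M : ℝ, 0 < ρ → ρ ≤ infDist X Γ / 2 → m < M →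
    (∀ᵐ x ∂(volume.restrict (ball X ρ)), u x ≤ M) →
    volume (ball X (ρ/2)) ≤ 2 * volume (ball X (ρ/2) ∩ {x | u x ≤ m}) →
    ∀ᵐ x ∂(volume.restrict (ball X (ρ/4))), u x ≤ M - c * (M - m) := by
  obtain ⟨ε, hε, hA⟩ := lemA h hΛ
  have hKS := KS_one
  have hvb := vb_pos (n := n)
  set t := ε / (2 * 16 ^ n) with ht
  have ht0 : 0 < t := by positivity
  obtain ⟨J, hJ, hJ2⟩ := exJ (a := 1024 * KS ^ 4 * Λ ^ 4 * vb n ^ 2) ht0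
  refine ⟨1 / 2 ^ (J+1), by positivity, fun g u G s X hX ρ m M hρ hρδ hmM hu hhalf => ?_⟩
  obtain ⟨W, W', hW, hW', hWW, hw⟩ := h.whit hX
  have hδ := h.infDist_pos hX
  set B := ball X (ρ/2)
  have hBs : B ⊆ ball X (infDist X Γ / 2) := ball_subset_ball (by linarith)
  have hab : ρ / 2 < 3 * ρ / 4 := by linarith
  have h0 : 0 ≤ ρ / 2 := by linarith
  obtain ⟨k, l, h1, h2, h3, h4, h5⟩ := s.levels hΛ (cut_smooth X (ρ/2) (3*ρ/4)) (cut_compact h0 hab) (cut_abs _ _ _)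
    (m := m) (M := M) (K := 8 * KS / ρ) (V := W' * (ρ ^ n * vb n)) (τ := t * (W' * (ρ ^ n / ρ))) (B := B) (B' := ball X ρ) (Or.inl (by
      intro y hy hyΓ
      have h1 := cut_tsupport h0 hab hy
      have h2 := infDist_le_dist_of_mem (x := X) hyΓ
      rw [mem_closedBall, dist_comm] at h1
      linarith)) measurableSet_ball measurableSet_ball (ball_subset_ball (by linarith))
      (fun x => (cut_fderiv_bd h0 hab x).trans (le_of_eq (by field_simp; ring)))
      ((cut_tsupport h0 hab).trans (closedBall_subset_ball (by linarith)))
      (fun x hx => cut_one h0 hab (mem_ball.1 hx).le) hu hmM (by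
        have := (hw (ball X ρ) measurableSet_ball (ball_subset_ball hρδ)).2 (fun _ => 1)
        rw [setLIntegral_one, setLIntegral_one, vol_ball X hρ, ← ENNReal.ofReal_mul hW'.le] at this
        exact this) (by positivity) (by positivity) (by positivity) hJ (by
        calc 16 * KS ^ 2 * Λ ^ 4 * (8 * KS / ρ) ^ 2 * (W' * (ρ ^ n * vb n)) ^ 2
            = (1024 * KS ^ 4 * Λ ^ 4 * vb n ^ 2) * (W' * (ρ ^ n / ρ)) ^ 2 := by ring
          _ ≤ (t ^ 2 * J) * (W' * (ρ ^ n / ρ)) ^ 2 := by gcongr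
          _ = _ := by ring)
  obtain ⟨uk, Q, A, -⟩ := s.apx
  have hvB : volume B = ENNReal.ofReal ((ρ/2) ^ n * vb n) := vol_ball X (by positivity)
  have hvB0 : volume B ≠ 0 := by rw [hvB]; simp; positivity
  have hvBt : volume B ≠ ⊤ := by rw [hvB]; exact ENNReal.ofReal_ne_top
  have hF := (Tapx A h2).F2 (B := B) (P := B ∩ {x | u x ≤ m}) (convex_ball _ _) measurableSet_ball inter_subset_left hvBt
    (h.nu_ball_lt _ _) (L := ρ) (W := W) (fun x hx y hy => by
      have := dist_triangle_right x y X
      have := mem_ball.1 hx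
      have := mem_ball.1 hy
      linarith) (hw B measurableSet_ball hBs).1
  have hz : ∫⁻ x in B ∩ {x | u x ≤ m}, ‖T k l (u x)‖ₑ = 0 := by
    have : ∫⁻ x in B ∩ {x | u x ≤ m}, ‖T k l (u x)‖ₑ = ∫⁻ x in B ∩ {x | u x ≤ m}, 0 := by
      refine setLIntegral_congr_fun (measurableSet_ball.inter (measurableSet_le s.um.measurable measurable_const)) fun x hx => ?_
      have : u x ≤ m := hx.2
      simp [T_zero h2 (this.trans h1)]
    rw [this]; simp
  rw [hz, mul_zero, zero_add] at hF
  set I := ∫⁻ x in B, ‖T k l (u x)‖ₑ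
  have hI : I ≤ ENNReal.ofReal (ε * (ρ/2) ^ n) := by
    have e1 : volume B * I ≤ volume B * ENNReal.ofReal (ε * (ρ/2) ^ n) := by
      calc volume B * I ≤ 2 * (volume (B ∩ {x | u x ≤ m}) * I) := by
            rw [← mul_assoc]; exact mul_le_mul' hhalf le_rfl
        _ ≤ 2 * (ENNReal.ofReal (2 ^ n * ρ) * volume B * (ENNReal.ofReal W * ENNReal.ofReal (t * (W' * (ρ ^ n / ρ))))) := by
            refine mul_le_mul' le_rfl (hF.trans ?_)
            exact mul_le_mul' le_rfl (mul_le_mul' le_rfl h5)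
        _ = volume B * ENNReal.ofReal (2 * (2 ^ n * ρ) * (W * (t * (W' * (ρ ^ n / ρ))))) := by
            rw [ENNReal.ofReal_mul (p := 2 * (2 ^ n * ρ)) (by positivity), ENNReal.ofReal_mul (p := 2) (by positivity), ENNReal.ofReal_mul (p := W) hW.le]
            simp only [ENNReal.ofReal_ofNat]
            ring
        _ ≤ _ := by
            refine mul_le_mul' le_rfl (ENNReal.ofReal_le_ofReal ?_)
            calc 2 * (2 ^ n * ρ) * (W * (t * (W' * (ρ ^ n / ρ)))) = 2 * 2 ^ n * t * ρ ^ n * (W * W') := by field_simp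
              _ ≤ 2 * 2 ^ n * t * ρ ^ n * 4 ^ n := by gcongr
              _ = _ := by
                rw [ht, div_pow, show (16:ℝ) = 2 * 2 * 4 by norm_num, mul_pow, mul_pow]
                field_simp
    exact (ENNReal.mul_le_mul_iff_right hvB0 hvBt).1 e1
  have := hA g u G s X hX (ρ/2) l M (by positivity) (by linarith) h3
    (ae_restrict_of_ae_restrict_of_subset (ball_subset_ball (by linarith)) hu) ((s.cheb h2 subset_rfl).trans hI)
  rw [show ρ / 2 / 2 = ρ / 4 by ring] at this
  filter_upwards [this] with x hx
  refine hx.trans (h4.trans (le_of_eq ?_))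
  ring

lemma core (h : AR n d C₀ Γ) (hΛ : 0 < Λ) : ∃ c > 0, ∀ g u G, Sol d Λ Γ g u G → ∀ p ∈ Γ, ∀ X ∉ Γ,
    ∀ R m M : ℝ, 0 < R → m < M → (∀ᵐ x ∂(volume.restrict (ball p R)), u x ≤ M) → (∀ x ∈ ball p R, g x ≤ m) →
    dist X p ≤ 0.6 * R → R / 8 ≤ infDist X Γ →
    ∀ᵐ x ∂(volume.restrict (ball X (R/32))), u x ≤ M - c * (M - m) := by
  obtain ⟨ε, hε, hA⟩ := lemA h hΛ
  obtain ⟨Cν, hCν, hνb⟩ := h.nu_ball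
  obtain ⟨CF, hCF, hF⟩ := h.F3
  have hKS := KS_one
  have hd := h.hd
  set t := ε / (CF * 16 ^ n) with ht
  have ht0 : 0 < t := by positivity
  obtain ⟨J, hJ, hJ2⟩ := exJ (a := 16 * KS ^ 2 * Λ ^ 4 * (16 * KS) ^ 2 * Cν ^ 2) ht0
  refine ⟨1 / 2 ^ (J+1), by positivity, fun g u G s p hp X hX R m M hR hmM hu hg hXp hδ => ?_⟩
  have hab : 3 * R / 4 < 7 * R / 8 := by linarith
  have h0 : 0 ≤ 3 * R / 4 := by linarith
  have hRd : R ^ (d + 1) = R ^ d * R := Real.rpow_add_one hR.ne' d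
  obtain ⟨k, l, h1, h2, h3, h4, h5⟩ := s.levels hΛ (cut_smooth p (3*R/4) (7*R/8)) (cut_compact h0 hab) (cut_abs _ _ _)
    (m := m) (M := M) (K := 16 * KS / R) (V := Cν * R ^ (d+1)) (τ := t * R ^ d) (B := ball p (3*R/4)) (B' := ball p R) (Or.inr (by
      intro y hy
      refine hg y ?_
      have h1 := cut_tsupport h0 hab (subset_tsupport _ hy)
      rw [mem_closedBall] at h1
      rw [mem_ball]
      linarith)) measurableSet_ball measurableSet_ball (ball_subset_ball (by linarith))
      (fun x => (cut_fderiv_bd h0 hab x).trans (le_of_eq (by field_simp; ring)))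
      ((cut_tsupport h0 hab).trans (closedBall_subset_ball (by linarith)))
      (fun x hx => cut_one h0 hab (mem_ball.1 hx).le) hu hmM (hνb p hp R hR)
      (by positivity) (by positivity) (by positivity) hJ (by
        rw [hRd]
        calc 16 * KS ^ 2 * Λ ^ 4 * (16 * KS / R) ^ 2 * (Cν * (R ^ d * R)) ^ 2
            = (16 * KS ^ 2 * Λ ^ 4 * (16 * KS) ^ 2 * Cν ^ 2) * (R ^ d) ^ 2 := by field_simp
          _ ≤ (t ^ 2 * J) * (R ^ d) ^ 2 := by gcongr
          _ = _ := by ring)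
  obtain ⟨uk, Q, A, hbd⟩ := s.apx
  have h6 := hF p hp (3*R/4) (by positivity) _ _ _ _ (Tapx A h2) (fun j x hx => by
    refine T_zero h2 ?_
    rw [hbd j x hx.1]
    exact (hg x (ball_subset_ball (by linarith) hx.2)).trans h1)
  have h7 := hA g u G s X hX (R/16) l M (by positivity) (by linarith) h3
    (ae_restrict_of_ae_restrict_of_subset (ball_subset_ball' (by norm_num at hXp ⊢; linarith)) hu)
    ((s.cheb h2 (ball_subset_ball' (by norm_num at hXp ⊢; linarith))).trans (h6.trans ((mul_le_mul' le_rfl h5).trans (by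
      rw [← ENNReal.ofReal_mul (by positivity)]
      refine ENNReal.ofReal_le_ofReal ?_
      have e1 : (3 * R / 4) ^ ((n:ℝ) - d) ≤ R ^ ((n:ℝ) - d) := Real.rpow_le_rpow h0 (by linarith) (by linarith)
      have e2 : R ^ ((n:ℝ) - d) * R ^ d = R ^ n := by
        rw [← Real.rpow_add hR, sub_add_cancel, Real.rpow_natCast]
      calc CF * (3 * R / 4) ^ ((n:ℝ) - d) * (t * R ^ d) ≤ CF * R ^ ((n:ℝ) - d) * (t * R ^ d) := by gcongr
        _ = CF * t * (R ^ ((n:ℝ) - d) * R ^ d) := by ring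
        _ = CF * t * R ^ n := by rw [e2]
        _ = _ := by rw [ht, div_pow]; field_simp))))
  rw [show R / 16 / 2 = R / 32 by ring] at h7
  filter_upwards [h7] with x hx
  refine hx.trans (h4.trans (le_of_eq ?_))
  ring

end Sol
end EMN
open MeasureTheory Metric Set Filter
open scoped ENNReal Topology

namespace EMN
variable {n : ℕ}

lemma ae_ball {X : EE n} {r : ℝ} {P : EE n → Prop} :
    (∀ᵐ x ∂(volume.restrict (ball X r)), P x) ↔ ∀ᵐ x, x ∈ ball X r → P x :=
  ae_restrict_iff' measurableSet_ball

lemma loc_cont {u g : EE n → ℝ} {Γ : Set (EE n)}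
    (hl : ∀ z, ∀ ε > 0, ∃ r > 0, ∃ a, (z ∈ Γ → a = g z) ∧ ∀ᵐ x ∂(volume.restrict (ball z r)), |u x - a| ≤ ε) :
    ∃ v : EE n → ℝ, Continuous v ∧ (∀ᵐ x, v x = u x) ∧ ∀ z ∈ Γ, v z = g z := by
  have hne : ∀ z : EE n, (𝓝 z ⊓ ae volume).NeBot := fun z => by
    rw [inf_neBot_iff]
    intro s hs t ht
    by_contra hc
    rw [not_nonempty_iff_eq_empty] at hc
    have h1 : volume s = 0 := by
      refine measure_mono_null (fun x hx => ?_) ht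
      intro hxt
      have : x ∈ s ∩ t := ⟨hx, hxt⟩
      rw [hc] at this; exact this
    exact (Measure.measure_pos_of_mem_nhds volume hs).ne' h1
  have hev : ∀ z r, ∀ P : EE n → Prop, (∀ᵐ x ∂(volume.restrict (ball z r)), P x) → ∀ y ∈ ball z r,
      ∀ᶠ x in 𝓝 y ⊓ ae volume, P x := fun z r P hP y hy => by
    rw [ae_ball] at hP
    have h1 : ∀ᶠ x in 𝓝 y ⊓ ae volume, x ∈ ball z r := Filter.Eventually.filter_mono inf_le_left (isOpen_ball.mem_nhds hy)
    have h2 := hP.filter_mono (inf_le_right (a := 𝓝 y))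
    filter_upwards [h1, h2] with x h3 h4 using h4 h3
  have hlim : ∀ z, ∃ L, Tendsto u (𝓝 z ⊓ ae volume) (𝓝 L) := fun z => by
    have := hne z
    refine cauchy_map_iff_exists_tendsto.1 (Metric.cauchy_iff.2 ⟨inferInstance, fun ε hε => ?_⟩)
    obtain ⟨r, hr, a, -, ha⟩ := hl z (ε/3) (by positivity)
    refine ⟨closedBall a (ε/3), ?_, fun x hx y hy => ?_⟩
    · rw [mem_map]
      filter_upwards [hev z r _ ha z (mem_ball_self hr)] with x hx
      simpa [Real.dist_eq] using hx
    · have := dist_triangle_right x y a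
      rw [mem_closedBall] at hx hy
      linarith
  choose v hv using hlim
  have hva : ∀ z r a ε, (∀ᵐ x ∂(volume.restrict (ball z r)), |u x - a| ≤ ε) → ∀ y ∈ ball z r, |v y - a| ≤ ε :=
    fun z r a ε hP y hy => by
      have := hne y
      exact le_of_tendsto (((hv y).sub_const a).abs) (hev z r _ hP y hy)
  refine ⟨v, ?_, ?_, ?_⟩
  · rw [Metric.continuous_iff']
    intro z ε hε
    obtain ⟨r, hr, a, -, ha⟩ := hl z (ε/3) (by positivity)
    filter_upwards [ball_mem_nhds z hr] with y hy
    have h1 := hva z r a _ ha y hy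
    have h2 := hva z r a _ ha z (mem_ball_self hr)
    rw [Real.dist_eq]
    rw [abs_le] at h1 h2
    rw [abs_lt]
    constructor <;> linarith
  · have hN : ∀ N : ℕ, ∀ᵐ x, |v x - u x| ≤ 2 * (1 / (N + 1)) := fun N => by
      rw [ae_iff]
      refine measure_null_of_locally_null _ fun z _ => ?_
      obtain ⟨r, hr, a, -, ha⟩ := hl z (1 / (N + 1)) (by positivity)
      refine ⟨ball z r ∩ {x | ¬ |u x - a| ≤ 1 / (N + 1)} ∪ (ball z r)ᶜ ∩ ∅, ?_, ?_⟩
      · filter_upwards [self_mem_nhdsWithin, nhdsWithin_le_nhds (ball_mem_nhds z hr)] with y hy1 hy2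
        left
        refine ⟨hy2, fun hc => hy1 ?_⟩
        have h1 := hva z r a _ ha y hy2
        rw [abs_le] at h1 hc ⊢
        constructor <;> linarith
      · rw [ae_ball, ae_iff] at ha
        simp only [inter_empty, union_empty]
        refine measure_mono_null (fun x hx => ?_) ha
        simp only [mem_ofPred_eq, Classical.not_imp]
        exact hx
    filter_upwards [ae_all_iff.2 hN] with x hx
    have h1 : Tendsto (fun N : ℕ => 2 * ((1:ℝ) / (N + 1))) atTop (𝓝 (2 * 0)) :=
      tendsto_one_div_add_atTop_nhds_zero_nat.const_mul 2
    have h2 := ge_of_tendsto' h1 hx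
    have h3 : |v x - u x| = 0 := le_antisymm (by simpa using h2) (abs_nonneg _)
    exact sub_eq_zero.1 (abs_eq_zero.1 h3)
  · intro z hz
    have h1 : ∀ ε > 0, |v z - g z| ≤ ε := fun ε hε => by
      obtain ⟨r, hr, a, ha', ha⟩ := hl z ε hε
      rw [← ha' hz]
      exact hva z r a _ ha z (mem_ball_self hr)
    have h3 : |v z - g z| = 0 := le_antisymm (le_of_forall_pos_le_add fun ε hε => by simpa using h1 ε hε) (abs_nonneg _)
    exact sub_eq_zero.1 (abs_eq_zero.1 h3)

namespace Sol
variable {d C₀ Λ : ℝ} {Γ : Set (EE n)} {g u : EE n → ℝ} {G : EE n → EE n}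

lemma bdry (h : AR n d C₀ Γ) (hΛ : 0 < Λ) (s : Sol d Λ Γ g u G) (gc : Continuous g) {z : EE n} (hz : z ∈ Γ)
    (hu : ∀ᵐ x, u x ≤ g z + 1) {ε : ℝ} (hε : 0 < ε) :
    ∃ r > 0, ∀ᵐ x ∂(volume.restrict (ball z r)), u x ≤ g z + ε := by
  obtain ⟨c, hc, hcore⟩ := core h hΛ
  set m := g z + ε / 2 with hm
  obtain ⟨R0, hR0, hgR⟩ : ∃ R0 > 0, ∀ x ∈ ball z R0, g x ≤ m := by
    have := (gc.tendsto z).eventually (gt_mem_nhds (show g z < m by linarith))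
    obtain ⟨R0, h1, h2⟩ := Metric.eventually_nhds_iff_ball.1 this
    exact ⟨R0, h1, fun x hx => (h2 x hx).le⟩
  set q := 1 - min c (1/2) with hq
  have hq0 : 0 < q := by have := min_le_right c (1/2); linarith
  have hq1 : q < 1 := by have : 0 < min c (1/2) := by positivity
                         linarith
  have hind : ∀ j : ℕ, ∀ᵐ x ∂(volume.restrict (ball z (R0 / 8 ^ j))), u x ≤ m + q ^ j := by
    intro j
    induction j with
    | zero =>
      filter_upwards [ae_restrict_of_ae hu] with x hx
      rw [pow_zero]; linarith
    | succ j ih =>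
      set R := R0 / 8 ^ j with hR
      have hRp : 0 < R := by positivity
      have hRle : R ≤ R0 := div_le_self hR0.le (one_le_pow₀ (by norm_num))
      rw [show R0 / 8 ^ (j+1) = R / 8 by rw [hR, pow_succ, div_div], ae_ball]
      have hqj : 0 < q ^ j := by positivity
      have hnull : volume {x | x ∉ Γ ∧ x ∈ ball z (R/8) ∧ ¬ u x ≤ m + q ^ (j+1)} = 0 := by
        refine measure_null_of_locally_null _ fun X hX => ?_
        obtain ⟨hXΓ, hXb, -⟩ := hX
        have hδ := h.infDist_pos hXΓ
        obtain ⟨p, hp, hpd⟩ := h.closed.exists_infDist_eq_dist h.ne X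
        set δ := infDist X Γ with hδ'
        have hXz := mem_ball.1 hXb
        have hδz : δ ≤ dist X z := infDist_le_dist_of_mem hz
        have hpz := dist_triangle_left p z X
        have hsub : ball p (2 * δ) ⊆ ball z R := ball_subset_ball' (by linarith)
        have h1 := hcore g u G s p hp X hXΓ (2 * δ) m (m + q ^ j) (by positivity) (by linarith)
          (ae_restrict_of_ae_restrict_of_subset hsub ih)
          (fun x hx => hgR x (ball_subset_ball hRle (hsub hx))) (by rw [← hpd]; norm_num; linarith) (by linarith)
        refine ⟨{x | ¬ (x ∈ ball X (2 * δ / 32) → u x ≤ m + q ^ j - c * (m + q ^ j - m))}, ?_, ?_⟩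
        · filter_upwards [self_mem_nhdsWithin, nhdsWithin_le_nhds (ball_mem_nhds X (show 0 < 2 * δ / 32 by positivity))] with y hy1 hy2
          simp only [mem_ofPred_eq, Classical.not_imp]
          refine ⟨hy2, fun hcc => hy1.2.2 (hcc.trans ?_)⟩
          have : q ^ (j+1) = q ^ j - min c (1/2) * q ^ j := by rw [pow_succ, hq]; ring
          rw [this]
          have := mul_le_mul_of_nonneg_right (min_le_left c (1/2)) hqj.le
          linarith
        · rw [ae_ball, ae_iff] at h1
          exact h1
      filter_upwards [measure_eq_zero_iff_ae_notMem.1 hnull, h.ae_notMem] with x hx hxΓ hxb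
      by_contra hcc
      exact hx ⟨hxΓ, hxb, hcc⟩
  obtain ⟨j, hj⟩ := exists_pow_lt_of_lt_one (show 0 < ε / 2 by positivity) hq1
  refine ⟨R0 / 8 ^ j, by positivity, ?_⟩
  filter_upwards [hind j] with x hx
  linarith

lemma inter (h : AR n d C₀ Γ) (hΛ : 0 < Λ) (s : Sol d Λ Γ g u G) (s' : Sol d Λ Γ (-g) (-u) (-G))
    (u01 : ∀ᵐ x, 0 ≤ u x ∧ u x ≤ 1) {X : EE n} (hX : X ∉ Γ) {ε : ℝ} (hε : 0 < ε) :
    ∃ r > 0, ∃ a, ∀ᵐ x ∂(volume.restrict (ball X r)), |u x - a| ≤ ε := by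
  obtain ⟨c, hc, hI⟩ := IGL h hΛ
  set q := 1 - min c 1 / 2 with hq
  have hmin1 := min_le_right c 1
  have hmin2 := min_le_left c 1
  have hmin0 : 0 < min c 1 := by positivity
  have hq0 : 0 < q := by linarith
  have hq1 : q < 1 := by linarith
  have hδ := h.infDist_pos hX
  set δ := infDist X Γ
  have hind : ∀ j : ℕ, ∃ m M : ℝ, m < M ∧ M - m ≤ q ^ j ∧ ∀ᵐ x ∂(volume.restrict (ball X (δ / 2 / 4 ^ j))), m ≤ u x ∧ u x ≤ M := by
    intro j
    induction j with
    | zero => exact ⟨0, 1, by norm_num, by simp, ae_restrict_of_ae u01⟩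
    | succ j ih =>
      obtain ⟨m, M, hmM, hle, hb⟩ := ih
      set ρ := δ / 2 / 4 ^ j with hρ
      have hρ0 : 0 < ρ := by positivity
      have hρle : ρ ≤ δ / 2 := div_le_self (by positivity) (one_le_pow₀ (by norm_num))
      rw [show δ / 2 / 4 ^ (j+1) = ρ / 4 by rw [hρ, pow_succ]; field_simp]
      have hb' : ∀ᵐ x ∂(volume.restrict (ball X (ρ/4))), m ≤ u x ∧ u x ≤ M :=
        ae_restrict_of_ae_restrict_of_subset (ball_subset_ball (by linarith)) hb
      set μ := (m + M) / 2 with hμ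
      have hqq : q * (M - m) ≤ q ^ (j+1) := by rw [pow_succ, mul_comm]; gcongr
      have hcc : min c 1 * (M - m) ≤ c * (M - m) := by gcongr
      have hcc1 : min c 1 * (M - m) ≤ 1 * (M - m) := by gcongr
      have hcc0 : 0 < min c 1 * (M - m) := mul_pos hmin0 (by linarith)
      by_cases hcase : volume (ball X (ρ/2)) ≤ 2 * volume (ball X (ρ/2) ∩ {x | u x ≤ μ})
      · have h1 := hI g u G s X hX ρ μ M hρ0 hρle (by linarith) (hb.mono fun x hx => hx.2) hcase
        refine ⟨m, M - min c 1 / 2 * (M - m), by linarith, ?_, ?_⟩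
        · refine le_trans (le_of_eq ?_) hqq; rw [hq]; ring
        · filter_upwards [h1, hb'] with x hx1 hx2
          refine ⟨hx2.1, hx1.trans ?_⟩
          rw [show M - μ = (M - m) / 2 by rw [hμ]; ring]
          linarith
      · have hcase' : volume (ball X (ρ/2)) ≤ 2 * volume (ball X (ρ/2) ∩ {x | (-u) x ≤ -μ}) := by
          push Not at hcase
          have e1 : volume (ball X (ρ/2)) ≤ volume (ball X (ρ/2) ∩ {x | u x ≤ μ}) + volume (ball X (ρ/2) ∩ {x | (-u) x ≤ -μ}) := by
            refine (measure_mono fun x hx => ?_).trans (measure_union_le _ _)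
            rcases le_total (u x) μ with hh | hh
            · exact Or.inl ⟨hx, hh⟩
            · exact Or.inr ⟨hx, neg_le_neg hh⟩
          by_contra hc2
          push Not at hc2
          have hne : volume (ball X (ρ/2)) ≠ ⊤ := measure_ball_lt_top.ne
          have e2 := ENNReal.add_lt_add hcase hc2
          rw [← mul_add, ← two_mul] at e2
          exact absurd (mul_le_mul' (le_refl 2) e1) (not_le.2 e2)
        have h1 := hI (-g) (-u) (-G) s' X hX ρ (-μ) (-m) hρ0 hρle (by linarith) (hb.mono fun x hx => neg_le_neg hx.1) hcase'
        refine ⟨m + min c 1 / 2 * (M - m), M, by linarith, ?_, ?_⟩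
        · refine le_trans (le_of_eq ?_) hqq; rw [hq]; ring
        · filter_upwards [h1, hb'] with x hx1 hx2
          refine ⟨?_, hx2.2⟩
          rw [Pi.neg_apply, show -m - -μ = (M - m) / 2 by rw [hμ]; ring] at hx1
          linarith
  obtain ⟨j, hj⟩ := exists_pow_lt_of_lt_one hε hq1
  obtain ⟨m, M, hmM, hle, hb⟩ := hind j
  refine ⟨δ / 2 / 4 ^ j, by positivity, m, ?_⟩
  filter_upwards [hb] with x hx
  rw [abs_of_nonneg (by linarith)]
  linarith

lemma cont (h : AR n d C₀ Γ) (hΛ : 0 < Λ) (s : Sol d Λ Γ g u G) (s' : Sol d Λ Γ (-g) (-u) (-G))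
    (gc : Continuous g) (g0 : ∀ x, 0 ≤ g x) (g1 : ∀ x, g x ≤ 1) (u01 : ∀ᵐ x, 0 ≤ u x ∧ u x ≤ 1) :
    ∃ v : EE n → ℝ, Continuous v ∧ (∀ᵐ x, v x = u x) ∧ ∀ z ∈ Γ, v z = g z := by
  refine loc_cont fun z ε hε => ?_
  by_cases hz : z ∈ Γ
  · obtain ⟨r1, hr1, h1⟩ := s.bdry h hΛ gc hz (u01.mono fun x hx => by linarith [g0 z]) hε
    obtain ⟨r2, hr2, h2⟩ := s'.bdry h hΛ gc.neg hz (u01.mono fun x hx => by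
      simp only [Pi.neg_apply]; linarith [g1 z]) hε
    refine ⟨min r1 r2, by positivity, g z, fun _ => rfl, ?_⟩
    filter_upwards [ae_restrict_of_ae_restrict_of_subset (ball_subset_ball (min_le_left _ _)) h1,
      ae_restrict_of_ae_restrict_of_subset (ball_subset_ball (min_le_right _ _)) h2] with x hx1 hx2
    simp only [Pi.neg_apply] at hx2
    rw [abs_le]; constructor <;> linarith
  · obtain ⟨r, hr, a, ha⟩ := inter h hΛ s s' u01 hz hε
    exact ⟨r, hr, a, fun hh => absurd hh hz, ha⟩

end Sol
end EMN
open MeasureTheory Metric Set Filter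
open scoped ENNReal Topology

namespace EMN
variable {n : ℕ}

lemma AR.d_pos {d C₀ : ℝ} {Γ : Set (EE n)} (h : AR n d C₀ Γ) (hunb : ¬ Bornology.IsBounded Γ) : 0 < d := by
  rcases h.hd0.lt_or_eq with h0 | h0
  · exact h0
  exfalso
  subst h0
  have hinf : Γ.Infinite := fun hf => hunb hf.isBounded
  obtain ⟨N, hN⟩ := exists_nat_gt C₀
  obtain ⟨F, hF, hcard⟩ := hinf.exists_subset_card_eq N
  obtain ⟨x, hx⟩ := h.ne
  obtain ⟨r, hr⟩ := F.finite_toSet.isBounded.subset_ball x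
  have h1 := (h.ar x hx (max r 1) (by positivity)).2
  have h2 : μH[0] (F : Set (EE n)) = N := by
    rw [← sum_measure_singleton]
    simp [hcard]
  have h3 : μH[0] (F : Set (EE n)) ≤ μH[0] (Γ ∩ ball x (max r 1)) :=
    measure_mono (subset_inter hF (hr.trans (ball_subset_ball (le_max_left _ _))))
  rw [h2] at h3
  rw [Real.rpow_zero, mul_one] at h1
  have h4 := h3.trans h1
  rw [← ENNReal.ofReal_natCast, ENNReal.ofReal_le_ofReal_iff h.hC.le] at h4
  linarith

lemma AR.annulus {d C₀ : ℝ} {Γ : Set (EE n)} (h : AR n d C₀ Γ) (hd : 0 < d) : ∃ K ≥ (2:ℝ), ∀ x ∈ Γ, ∀ R > 0,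
    ∃ z ∈ Γ, 2 * R ≤ dist z x ∧ dist z x < K * R := by
  have hC := h.hC
  have ht : Tendsto (fun K : ℝ => K ^ d) atTop atTop := tendsto_rpow_atTop hd
  obtain ⟨K, hK, hK2⟩ := ((ht.eventually_gt_atTop (C₀ ^ 2 * 2 ^ d)).and (eventually_ge_atTop 2)).exists
  refine ⟨K, hK2, fun x hx R hR => ?_⟩
  by_contra hc
  push Not at hc
  have hs : Γ ∩ ball x (K * R) ⊆ Γ ∩ ball x (2 * R) := by
    rintro y ⟨hy, hy2⟩
    refine ⟨hy, ?_⟩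
    by_contra h3
    rw [mem_ball, not_lt] at h3
    exact absurd (mem_ball.1 hy2) (not_lt.2 (hc y hy h3))
  have h1 := ((h.ar x hx (K * R) (by positivity)).1.trans (measure_mono hs)).trans (h.ar x hx (2 * R) (by positivity)).2
  rw [ENNReal.ofReal_le_ofReal_iff (by positivity), Real.mul_rpow (by positivity) hR.le, Real.mul_rpow (by positivity) hR.le] at h1
  have hRd : 0 < R ^ d := by positivity
  have h2 : C₀⁻¹ * K ^ d ≤ C₀ * 2 ^ d := by
    refine le_of_mul_le_mul_right ?_ hRd
    linarith
  rw [inv_mul_le_iff₀ hC] at h2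
  nlinarith

lemma exists_mid (hn : 2 ≤ n) (e f : EE n) : ∃ e' : EE n, ‖e'‖ = 1 ∧ 0 ≤ inner ℝ e e' ∧ 0 ≤ inner ℝ f e' := by
  have h1 : (ℝ ∙ e)ᗮ ≠ ⊥ := by
    intro hb
    have h2 := Submodule.finrank_add_finrank_orthogonal (ℝ ∙ e)
    rw [hb, finrank_bot, finrank_euclideanSpace_fin] at h2
    have h3 : Module.finrank ℝ (ℝ ∙ e) ≤ 1 := by
      have := finrank_span_le_card (R := ℝ) ({e} : Set (EE n))
      simpa using this
    omega
  obtain ⟨v, hv, hv0⟩ := Submodule.exists_mem_ne_zero_of_ne_bot h1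
  have hev : inner ℝ e v = 0 := Submodule.mem_orthogonal_singleton_iff_inner_right.1 hv
  have hvn : 0 < ‖v‖ := norm_pos_iff.2 hv0
  have key : ∀ c : ℝ, |c| = 1 → 0 ≤ c * inner ℝ f v → ∃ e' : EE n, ‖e'‖ = 1 ∧ 0 ≤ inner ℝ e e' ∧ 0 ≤ inner ℝ f e' := by
    intro c hc hcf
    refine ⟨(c * ‖v‖⁻¹) • v, ?_, ?_, ?_⟩
    · rw [norm_smul, Real.norm_eq_abs, abs_mul, hc, abs_inv, abs_norm]; field_simp
    · rw [inner_smul_right, hev, mul_zero]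
    · rw [inner_smul_right]
      have : c * ‖v‖⁻¹ * inner ℝ f v = ‖v‖⁻¹ * (c * inner ℝ f v) := by ring
      rw [this]; positivity
  rcases le_total 0 (inner ℝ f v) with hh | hh
  · exact key 1 (by simp) (by linarith)
  · exact key (-1) (by simp) (by linarith)

def De (x e : EE n) (a b : ℝ) : Set (EE n) := {y | a < inner ℝ e (y - x)} ∩ ball x b

lemma De_convex (x e : EE n) (a b : ℝ) : Convex ℝ (De x e a b) := by
  refine Convex.inter ?_ (convex_ball _ _)
  intro y hy z hz s t hs ht hst
  simp only [mem_ofPred_eq] at *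
  have : s • y + t • z - x = s • (y - x) + t • (z - x) := by
    have : x = (s + t) • x := by rw [hst, one_smul]
    nth_rewrite 1 [this]
    simp only [smul_sub, add_smul]; abel
  rw [this, inner_add_right, inner_smul_right, inner_smul_right]
  rcases hs.lt_or_eq with h0 | h0
  · have h1 := mul_lt_mul_of_pos_left hy h0
    have h2 := mul_le_mul_of_nonneg_left hz.le ht
    have : s * a + t * a = a := by rw [← add_mul, hst, one_mul]
    linarith
  · have : t = 1 := by linarith
    rw [← h0, this]; linarith

lemma De_open (x e : EE n) (a b : ℝ) : IsOpen (De x e a b) :=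
  (isOpen_lt continuous_const (by fun_prop)).inter isOpen_ball

lemma De_ball {x e q : EE n} {a b R : ℝ} (he : ‖e‖ = 1) (h1 : a + R ≤ inner ℝ e (q - x)) (h2 : dist q x + R ≤ b) :
    ball q R ⊆ De x e a b := by
  intro y hy
  have hy' := mem_ball.1 hy
  refine ⟨?_, ?_⟩
  · have : y - x = (q - x) + (y - q) := by abel
    simp only [mem_ofPred_eq]
    rw [this, inner_add_right]
    have h3 := abs_le.1 (abs_real_inner_le_norm e (y - q))
    rw [he, one_mul, ← dist_eq_norm] at h3
    linarith
  · rw [mem_ball]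
    have := dist_triangle y q x
    linarith

lemma De_far {x e y : EE n} {a b : ℝ} (he : ‖e‖ = 1) (hy : y ∈ De x e a b) : a < dist y x ∧ dist y x < b := by
  refine ⟨?_, mem_ball.1 hy.2⟩
  have h1 : a < inner ℝ e (y - x) := hy.1
  have h3 := real_inner_le_norm e (y - x)
  rw [he, one_mul, ← dist_eq_norm] at h3
  linarith

namespace Sol
variable {d C₀ Λ : ℝ} {Γ : Set (EE n)}

lemma chain (h : AR n d C₀ Γ) {Θ : ℕ → EE n → ℝ} {θ : EE n → ℝ} {V : EE n → EE n}
    {D : EE n → ℝ} (A : Apx d Γ Θ θ V D) {x e q : EE n} (hx : x ∈ Γ) (he : ‖e‖ = 1) {R L t a : ℝ} (hR : 0 < R) (hL : 1 ≤ L)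
    (ht : 0 < t) (ha : 0 ≤ a)
    (hV : ∫⁻ x in De x e (0.8 * R) (L * R), ‖V x‖ₑ ∂(nu d Γ) ≤ ENNReal.ofReal (t * R ^ d))
    (hq : ball q R ⊆ De x e (0.8 * R) (L * R)) (hq2 : ∫⁻ x in ball q R, ‖θ x‖ₑ ≤ ENNReal.ofReal (a * t * R ^ n)) :
    ∫⁻ x in De x e (0.8 * R) (L * R), ‖θ x‖ₑ ≤ ENNReal.ofReal (L ^ n * (a + 2 ^ n * (2 * L) * L ^ n) * t * R ^ n) := by
  set B := De x e (0.8 * R) (L * R) with hBdef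
  have hBm : MeasurableSet B := (De_open _ _ _ _).measurableSet
  have hBb : B ⊆ ball x (L * R) := inter_subset_right
  have hLR : 0 < L * R := by positivity
  have hvb := vb_pos (n := n)
  have hd := h.hd
  have hd0 := h.hd0
  have hBf : volume B ≠ ⊤ := ((measure_mono hBb).trans_lt measure_ball_lt_top).ne
  have hF := A.F2 (B := B) (P := ball q R) (De_convex _ _ _ _) hBm hq hBf
    ((measure_mono hBb).trans_lt (h.nu_ball_lt _ _)) (L := 2 * L * R) (W := (L * R) ^ ((n:ℝ) - 1 - d)) (fun y hy y' hy' => by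
      have := dist_triangle_right y y' x
      have := mem_ball.1 (hBb hy)
      have := mem_ball.1 (hBb hy')
      linarith) (h.vol_le_nu hBm hLR fun y hy => (infDist_le_dist_of_mem hx).trans (mem_ball.1 (hBb hy)).le)
  have hvq : volume (ball q R) = ENNReal.ofReal (R ^ n * vb n) := vol_ball q hR
  have hvq0 : volume (ball q R) ≠ 0 := by rw [hvq]; simp; positivity
  have hvqt : volume (ball q R) ≠ ⊤ := measure_ball_lt_top.ne
  have hvB : volume B ≤ ENNReal.ofReal (L ^ n) * volume (ball q R) := by
    refine (measure_mono hBb).trans (le_of_eq ?_)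
    rw [vol_ball x hLR, hvq, ← ENNReal.ofReal_mul (by positivity)]
    congr 1; ring
  have hexp : (L * R) ^ ((n:ℝ) - 1 - d) * R ^ d * R ≤ L ^ n * R ^ n := by
    rw [Real.mul_rpow (by positivity) hR.le]
    have e1 : R ^ ((n:ℝ) - 1 - d) * R ^ d * R = R ^ n := by
      rw [← Real.rpow_add hR, ← Real.rpow_add_one hR.ne', ← Real.rpow_natCast]; congr 1; ring
    have e2 : L ^ ((n:ℝ) - 1 - d) ≤ L ^ n := by
      rw [← Real.rpow_natCast]; exact Real.rpow_le_rpow_of_exponent_le hL (by linarith)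
    calc _ = L ^ ((n:ℝ) - 1 - d) * (R ^ ((n:ℝ) - 1 - d) * R ^ d * R) := by ring
      _ ≤ _ := by rw [e1]; gcongr
  refine (ENNReal.mul_le_mul_iff_right hvq0 hvqt).1 (hF.trans ?_)
  have f1 : volume B * (∫⁻ x in ball q R, ‖θ x‖ₑ) ≤ volume (ball q R) * ENNReal.ofReal (L ^ n * a * t * R ^ n) := by
    refine (mul_le_mul' hvB hq2).trans (le_of_eq ?_)
    rw [show L ^ n * a * t * R ^ n = L ^ n * (a * t * R ^ n) by ring, ENNReal.ofReal_mul (p := L ^ n) (by positivity)]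
    ring
  have f2 : ENNReal.ofReal (2 ^ n * (2 * L * R)) * volume B * (ENNReal.ofReal ((L * R) ^ ((n:ℝ) - 1 - d)) * ∫⁻ x in B, ‖V x‖ₑ ∂(nu d Γ))
      ≤ volume (ball q R) * ENNReal.ofReal (L ^ n * (2 ^ n * (2 * L) * L ^ n) * t * R ^ n) := by
    refine (mul_le_mul' (mul_le_mul' le_rfl hvB) (mul_le_mul' le_rfl hV)).trans ?_
    calc _ = volume (ball q R) * (ENNReal.ofReal (2 ^ n * (2 * L * R)) * ENNReal.ofReal (L ^ n) * (ENNReal.ofReal ((L * R) ^ ((n:ℝ) - 1 - d)) * ENNReal.ofReal (t * R ^ d))) := by ring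
      _ ≤ _ := by
        refine mul_le_mul' le_rfl ?_
        rw [← ENNReal.ofReal_mul (by positivity), ← ENNReal.ofReal_mul (by positivity), ← ENNReal.ofReal_mul (by positivity)]
        refine ENNReal.ofReal_le_ofReal ?_
        calc _ = 2 ^ n * (2 * L) * L ^ n * t * ((L * R) ^ ((n:ℝ) - 1 - d) * R ^ d * R) := by ring
          _ ≤ 2 ^ n * (2 * L) * L ^ n * t * (L ^ n * R ^ n) := by gcongr
          _ = _ := by ring
  refine (add_le_add f1 f2).trans (le_of_eq ?_)
  rw [← mul_add, ← ENNReal.ofReal_add (by positivity) (by positivity)]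
  congr 2; ring

set_option maxHeartbeats 1000000 in
lemma far (h : AR n d C₀ Γ) (hd : 0 < d) (hΛ : 0 < Λ) : ∃ c > 0, ∀ g u G, Sol d Λ Γ g u G → ∀ x ∈ Γ, ∀ Y ∉ Γ,
    ∀ R : ℝ, 0 < R → dist Y x = R → (∀ᵐ x, u x ≤ 1) → (∀ y, 0.65 * R ≤ dist y x → g y ≤ 0) →
    R / 10 ≤ infDist Y Γ →
    ∀ᵐ x ∂(volume.restrict (ball Y (R/40))), u x ≤ 1 - c := by
  obtain ⟨ε, hε, hA⟩ := lemA h hΛ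
  obtain ⟨Cν, hCν, hνb⟩ := h.nu_ball
  obtain ⟨CF, hCF, hF⟩ := h.F3
  obtain ⟨K', hK', hann⟩ := h.annulus hd
  have hKS := KS_one
  set L := K' + 6 with hL
  have hL1 : 1 ≤ L := by linarith
  set b := 2 ^ n * (2 * L) * L ^ n with hb
  set a1 := L ^ n * (CF + b) with ha1
  set a2 := L ^ n * (a1 + b) with ha2
  set a3 := L ^ n * (a2 + b) with ha3
  have hb0 : 0 < b := by positivity
  have ha10 : 0 < a1 := by positivity
  have ha20 : 0 < a2 := by positivity
  have ha30 : 0 < a3 := by positivity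
  set t := ε / (a3 * 20 ^ n) with ht
  have ht0 : 0 < t := by positivity
  obtain ⟨J, hJ, hJ2⟩ := exJ (a := 16 * KS ^ 2 * Λ ^ 4 * (42 * KS) ^ 2 * (Cν * (3 * L) ^ (d+1)) ^ 2) ht0
  refine ⟨1 / 2 ^ (J+1), by positivity, fun g u G s x hx Y hY R hR hYx hu hg hδ => ?_⟩
  have hLR : 7 * R < L * R := by nlinarith
  set η : EE n → ℝ := fun y => cut x (L*R) (2*L*R) y - cut x (0.65 * R) (0.7 * R) y with hη
  have p1 : 0 ≤ L * R := by linarith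
  have p2 : L * R < 2 * L * R := by linarith
  have p3 : 0 ≤ 0.65 * R := by positivity
  have p4 : 0.65 * R < 0.7 * R := by norm_num; linarith
  have p5 : 0.7 * R < L * R := by norm_num; linarith
  have hηsupp : tsupport η ⊆ closedBall x (2 * L * R) := by
    refine closure_minimal (fun y hy => ?_) isClosed_closedBall
    by_contra hc
    rw [mem_closedBall, not_le] at hc
    apply hy
    simp only [hη]
    rw [cut_zero p1 p2 hc.le, cut_zero p3 p4 (by linarith), sub_zero]
  set B : Set (EE n) := ball x (L * R) \ closedBall x (0.7 * R) with hB
  have hBm : MeasurableSet B := measurableSet_ball.diff measurableSet_closedBall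
  have hRd : (3 * L * R) ^ (d + 1) = (3 * L) ^ (d+1) * (R ^ d * R) := by
    rw [Real.mul_rpow (by positivity) hR.le, Real.rpow_add_one hR.ne' d]
  obtain ⟨k, l, h1, h2, h3, h4, h5⟩ := s.levels hΛ (η := η) ((cut_smooth _ _ _).sub (cut_smooth _ _ _))
    ((isCompact_closedBall x (2*L*R)).of_isClosed_subset (isClosed_tsupport _) hηsupp) (fun y => by
      have a1 := cut_nonneg x (L*R) (2*L*R) y
      have a2 := cut_nonneg x (0.65 * R) (0.7 * R) y
      have a3 := cut_le_one x (L*R) (2*L*R) y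
      have a4 := cut_le_one x (0.65 * R) (0.7 * R) y
      simp only [hη]
      rw [abs_le]; constructor <;> linarith)
    (m := 0) (M := 1) (K := 42 * KS / R) (V := Cν * (3 * L * R) ^ (d+1)) (τ := t * R ^ d) (B := B) (B' := ball x (3*L*R)) (Or.inr (by
      intro y hy
      refine hg y ?_
      by_contra hc
      push Not at hc
      apply hy
      simp only [hη]
      rw [cut_one p1 p2 (by linarith), cut_one p3 p4 hc.le, sub_self])) hBm measurableSet_ball
      (diff_subset.trans (ball_subset_ball (by linarith)))
      (fun y => by
        have e1 := cut_fderiv_bd (c := x) p1 p2 y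
        have e2 := cut_fderiv_bd (c := x) p3 p4 y
        have e3 : fderiv ℝ η y = fderiv ℝ (cut x (L*R) (2*L*R)) y - fderiv ℝ (cut x (0.65 * R) (0.7 * R)) y :=
          fderiv_sub ((cut_smooth _ _ _).differentiable one_ne_zero y) ((cut_smooth _ _ _).differentiable one_ne_zero y)
        rw [e3]
        refine (norm_sub_le _ _).trans ((add_le_add e1 e2).trans ?_)
        have e4 : 2 * KS / (2 * L * R - L * R) ≤ 2 * KS / R := by
          apply div_le_div_of_nonneg_left (by positivity) hR; linarith
        have e5 : 2 * KS / (0.7 * R - 0.65 * R) = 40 * KS / R := by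
          rw [show 0.7 * R - 0.65 * R = R / 20 by ring]; field_simp; norm_num
        rw [e5]
        refine (add_le_add e4 le_rfl).trans (le_of_eq ?_)
        ring)
      (hηsupp.trans (closedBall_subset_ball (by linarith)))
      (fun y hy => by
        have e1 := mem_ball.1 hy.1
        have e2 := hy.2
        rw [mem_closedBall, not_le] at e2
        simp only [hη]
        rw [cut_one p1 p2 e1.le, cut_zero p3 p4 e2.le, sub_zero]) (ae_restrict_of_ae hu) one_pos (hνb x hx _ (by positivity))
      (by positivity) (by positivity) (by positivity) hJ (by
        rw [hRd]
        calc 16 * KS ^ 2 * Λ ^ 4 * (42 * KS / R) ^ 2 * (Cν * ((3 * L) ^ (d+1) * (R ^ d * R))) ^ 2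
            = (16 * KS ^ 2 * Λ ^ 4 * (42 * KS) ^ 2 * (Cν * (3 * L) ^ (d+1)) ^ 2) * (R ^ d) ^ 2 := by field_simp
          _ ≤ (t ^ 2 * J) * (R ^ d) ^ 2 := by gcongr
          _ = _ := by ring)
  obtain ⟨uk, Q, A, hbd⟩ := s.apx
  have AT := Tapx A h2
  obtain ⟨z, hz, hz1, hz2⟩ := hann x hx R hR
  have hDB : ∀ e : EE n, ‖e‖ = 1 → De x e (0.8 * R) (L * R) ⊆ B := fun e he y hy => by
    have := De_far he hy
    refine ⟨hy.2, ?_⟩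
    rw [mem_closedBall, not_le]
    norm_num at this ⊢; linarith
  have hVe : ∀ e : EE n, ‖e‖ = 1 → ∫⁻ x in De x e (0.8 * R) (L * R), ‖deriv (T k l) (u x) • G x‖ₑ ∂(nu d Γ) ≤ ENNReal.ofReal (t * R ^ d) :=
    fun e he => (lintegral_mono_set (hDB e he)).trans h5
  have hunit : ∀ y : EE n, 0 < dist y x → ‖(dist y x)⁻¹ • (y - x)‖ = 1 ∧ inner ℝ ((dist y x)⁻¹ • (y - x)) (y - x) = dist y x := by
    intro y hy
    constructor
    · rw [norm_smul, ← dist_eq_norm, Real.norm_of_nonneg (by positivity)]; field_simp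
    · rw [real_inner_smul_left, real_inner_self_eq_norm_sq, ← dist_eq_norm]; field_simp
  obtain ⟨hf1, hf2⟩ := hunit z (by linarith)
  set f := (dist z x)⁻¹ • (z - x)
  obtain ⟨he1, he2⟩ := hunit Y (by linarith)
  set e := (dist Y x)⁻¹ • (Y - x)
  obtain ⟨e', he'1, he'2, he'3⟩ := exists_mid h.two_le e f
  have hLR' : (K' + 1) * R < L * R := by nlinarith
  have hzD : ball z R ⊆ De x f (0.8 * R) (L * R) := De_ball hf1 (by rw [hf2]; norm_num; linarith) (by linarith)
  have hov : ∀ v w : EE n, ‖v‖ = 1 → ‖w‖ = 1 → 0 ≤ inner ℝ v w → ball (x + (2 * R) • (v + w)) R ⊆ De x v (0.8 * R) (L * R) := by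
    intro v w hv hw hvw
    refine De_ball hv ?_ ?_
    · rw [add_sub_cancel_left, inner_smul_right, inner_add_right, real_inner_self_eq_norm_sq, hv]
      have : 0 ≤ R * inner ℝ v w := by positivity
      norm_num; linarith
    · rw [dist_eq_norm, add_sub_cancel_left, norm_smul, Real.norm_of_nonneg (by positivity)]
      have := norm_add_le v w
      nlinarith
  have g0 : ∫⁻ x in ball z R, ‖T k l (u x)‖ₑ ≤ ENNReal.ofReal (CF * t * R ^ n) := by
    refine (hF z hz R hR _ _ _ _ AT (fun j y hy => by
      refine T_zero h2 ?_
      rw [hbd j y hy.1]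
      refine (hg y ?_).trans h1
      have := De_far hf1 (hzD hy.2)
      norm_num at this ⊢; linarith)).trans ?_
    refine (mul_le_mul' le_rfl ((lintegral_mono_set hzD).trans (hVe f hf1))).trans ?_
    rw [← ENNReal.ofReal_mul (by positivity)]
    refine ENNReal.ofReal_le_ofReal (le_of_eq ?_)
    have e2 : R ^ ((n:ℝ) - d) * R ^ d = R ^ n := by
      rw [← Real.rpow_add hR, sub_add_cancel, Real.rpow_natCast]
    calc CF * R ^ ((n:ℝ) - d) * (t * R ^ d) = CF * t * (R ^ ((n:ℝ) - d) * R ^ d) := by ring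
      _ = _ := by rw [e2]
  have g1 := chain h AT hx hf1 hR hL1 ht0 hCF.le (hVe f hf1) hzD g0
  have g2 := chain h AT hx he'1 hR hL1 ht0 ha10.le (hVe e' he'1)
    (by rw [add_comm f e']; exact hov e' f he'1 hf1 (by rw [real_inner_comm]; exact he'3))
    ((lintegral_mono_set (hov f e' hf1 he'1 he'3)).trans g1)
  have g3 := chain h AT hx he1 hR hL1 ht0 ha20.le (hVe e he1)
    (by rw [add_comm e' e]; exact hov e e' he1 he'1 he'2)
    ((lintegral_mono_set (hov e' e he'1 he1 (by rw [real_inner_comm]; exact he'2))).trans g2)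
  have hYD : ball Y (R/20) ⊆ De x e (0.8 * R) (L * R) := De_ball he1 (by rw [he2]; norm_num; linarith) (by linarith)
  have h7 := hA g u G s Y hY (R/20) l 1 (by positivity) (by linarith) h3
    (ae_restrict_of_ae hu)
    ((s.cheb h2 hYD).trans (g3.trans (ENNReal.ofReal_le_ofReal (le_of_eq (by
      rw [← hb, ← ha3, ht, div_pow]; field_simp)))))
  rw [show R / 20 / 2 = R / 40 by ring] at h7
  filter_upwards [h7] with x hx
  refine hx.trans (h4.trans (le_of_eq ?_))
  ring

end Sol
end EMN
open MeasureTheory Metric Set Filter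
open scoped ENNReal Topology

namespace EMN
variable {n : ℕ}

lemma AR.phi_le {d C₀ : ℝ} {Γ : Set (EE n)} (h : AR n d C₀ Γ) {φ : EE n → ℝ} (hφ : Adm Γ φ) :
    ∃ K, 0 ≤ K ∧ ∀ x, |φ x| ≤ K * wt d Γ x := by
  obtain ⟨M, hM⟩ := hφ.cs.exists_bound_of_continuous hφ.cd.continuous
  obtain ⟨z, hz⟩ := h.ne
  obtain ⟨R, hR⟩ := hφ.cs.isBounded.subset_closedBall z
  have hM0 : 0 ≤ M := (norm_nonneg _).trans (hM z)
  refine ⟨M / (max R 1) ^ (d + 1 - (n:ℝ)), by positivity, fun x => ?_⟩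
  by_cases hx : x ∈ tsupport φ
  · have h1 : infDist x Γ ≤ max R 1 := (infDist_le_dist_of_mem hz).trans ((hR hx).trans (le_max_left _ _))
    have h2 : (max R 1) ^ (d + 1 - (n:ℝ)) ≤ wt d Γ x :=
      Real.rpow_le_rpow_of_nonpos (h.infDist_pos (hφ.ts hx)) h1 (by linarith [h.hd])
    have h3 : 0 < (max R 1) ^ (d + 1 - (n:ℝ)) := by positivity
    rw [div_mul_eq_mul_div, le_div_iff₀ h3]
    exact mul_le_mul (hM x) h2 h3.le hM0
  · rw [image_eq_zero_of_notMem_tsupport hx, abs_zero]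
    exact mul_nonneg (by positivity) (wt_nonneg _ _ _)

lemma int_nu {d : ℝ} {Γ : Set (EE n)} {f : EE n → ℝ} :
    Integrable f (nu d Γ) ↔ Integrable (fun x => wt d Γ x * f x) := by
  unfold nu
  rw [integrable_withDensity_iff_integrable_smul' (wt_meas d Γ).ennreal_ofReal (by simp)]
  simp [ENNReal.toReal_ofReal (wt_nonneg _ _ _)]

lemma integral_nu {d : ℝ} {Γ : Set (EE n)} {f : EE n → ℝ} :
    ∫ x, f x ∂(nu d Γ) = ∫ x, wt d Γ x * f x := by
  unfold nu
  rw [integral_withDensity_eq_integral_toReal_smul (wt_meas d Γ).ennreal_ofReal (by simp)]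
  simp [ENNReal.toReal_ofReal (wt_nonneg _ _ _)]

lemma Apx.weak {d C₀ : ℝ} {Γ : Set (EE n)} (h : AR n d C₀ Γ) {Θ : ℕ → EE n → ℝ} {θ : EE n → ℝ}
    {V : EE n → EE n} {D : EE n → ℝ} (A : Apx d Γ Θ θ V D) (bd : ∀ k x, |Θ k x| ≤ 3)
    {φ : EE n → ℝ} (hφ : Adm Γ φ) (i : Fin n) :
    ∫ x, θ x * fderiv ℝ φ x (EuclideanSpace.single i 1) = - ∫ x, V x i * φ x := by
  have hd : Continuous fun x => fderiv ℝ φ x (EuclideanSpace.single i 1) :=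
    (hφ.cd.continuous_fderiv one_ne_zero).clm_apply continuous_const
  have hdc : HasCompactSupport fun x => fderiv ℝ φ x (EuclideanSpace.single i 1) :=
    hφ.cs.fderiv_apply ℝ _
  have e : ∀ k, ∫ x, Θ k x * fderiv ℝ φ x (EuclideanSpace.single i 1) = - ∫ x, gr (Θ k) x i * φ x := by
    intro k
    have hk : Continuous fun x => fderiv ℝ (Θ k) x (EuclideanSpace.single i 1) :=
      ((A.cd k).continuous_fderiv one_ne_zero).clm_apply continuous_const
    simp only [gr_coord]
    refine integral_mul_fderiv_eq_neg_fderiv_mul_of_integrable ?_ ?_ ?_ ?_ ?_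
    · exact (hk.mul hφ.cd.continuous).integrable_of_hasCompactSupport hφ.cs.mul_left
    · exact ((A.cd k).continuous.mul hd).integrable_of_hasCompactSupport hdc.mul_left
    · exact ((A.cd k).continuous.mul hφ.cd.continuous).integrable_of_hasCompactSupport hφ.cs.mul_left
    · exact fun x _ => (A.cd k).differentiable one_ne_zero x
    · exact fun x _ => hφ.cd.differentiable one_ne_zero x
  have t1 : Tendsto (fun k => ∫ x, Θ k x * fderiv ℝ φ x (EuclideanSpace.single i 1)) atTop
      (𝓝 (∫ x, θ x * fderiv ℝ φ x (EuclideanSpace.single i 1))) := by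
    refine tendsto_integral_of_dominated_convergence
      (fun x => 3 * ‖fderiv ℝ φ x (EuclideanSpace.single i 1)‖)
      (fun k => ((A.cd k).continuous.mul hd).aestronglyMeasurable)
      ((hd.integrable_of_hasCompactSupport hdc).norm.const_mul 3) ?_ ?_
    · intro k
      refine Eventually.of_forall fun x => ?_
      rw [norm_mul]
      exact mul_le_mul_of_nonneg_right (bd k x) (norm_nonneg _)
    · filter_upwards [A.lim] with x hx using hx.mul_const _
  have t2 : Tendsto (fun k => ∫ x, gr (Θ k) x i * φ x) atTop (𝓝 (∫ x, V x i * φ x)) := by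
    obtain ⟨K, hK0, hK⟩ := h.phi_le hφ
    refine tendsto_integral_of_dominated_convergence
      (fun x => |φ x| + K * (wt d Γ x * D x))
      (fun k => ?_)
      (((hφ.cd.continuous.integrable_of_hasCompactSupport hφ.cs).norm).add ((int_nu.1 A.Di).const_mul K)) ?_ ?_
    · simp only [gr_coord]
      exact ((((A.cd k).continuous_fderiv one_ne_zero).clm_apply continuous_const).mul hφ.cd.continuous).aestronglyMeasurable
    · intro k
      filter_upwards [A.Db] with x hx
      have h1 : ‖gr (Θ k) x i‖ ≤ ‖gr (Θ k) x‖ := PiLp.norm_apply_le _ _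
      have h2 : ‖gr (Θ k) x i‖ ≤ 1 + D x := by nlinarith [hx k, sq_nonneg (‖gr (Θ k) x‖ - 1)]
      have h3 : 0 ≤ D x := (sq_nonneg _).trans (hx k)
      rw [norm_mul, Real.norm_eq_abs (φ x)]
      have h4 := mul_le_mul_of_nonneg_right h2 (abs_nonneg (φ x))
      have h5 := mul_le_mul_of_nonneg_left (hK x) h3
      nlinarith
    · filter_upwards [A.glim] with x hx
      exact ((((EuclideanSpace.proj i : EE n →L[ℝ] ℝ).continuous.tendsto _).comp hx)).mul_const _
  simp only [e] at t1
  exact tendsto_nhds_unique t1 t2.neg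

lemma Sol.weak {d Λ C₀ : ℝ} {Γ : Set (EE n)} (h : AR n d C₀ Γ) {g u v : EE n → ℝ} {G : EE n → EE n}
    (s : Sol d Λ Γ g u G) (u01 : ∀ᵐ x, 0 ≤ u x ∧ u x ≤ 1) (hv : ∀ᵐ x, v x = u x)
    {φ : EE n → ℝ} (hφ : Adm Γ φ) (i : Fin n) :
    ∫ x, v x * fderiv ℝ φ x (EuclideanSpace.single i 1) = - ∫ x, G x i * φ x := by
  obtain ⟨uk, Q, A, -⟩ := s.apx
  obtain ⟨K, hK⟩ := chi_deriv_bd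
  have B := Raw.comp_apx A chi_smooth hK
  have := B.weak h (fun k x => chi_bd _) hφ i
  rw [integral_congr_ae (g := fun x => chi (u x) * fderiv ℝ φ x (EuclideanSpace.single i 1)), this,
    integral_congr_ae (f := fun x => (deriv chi (u x) • G x) i * φ x)]
  · filter_upwards [u01] with x hx
    rw [chi_deriv hx.1 hx.2, one_smul]
  · filter_upwards [u01, hv] with x hx hx2
    rw [chi_id (by linarith) (by linarith), hx2]

lemma Sol.energyW {d Λ : ℝ} {Γ : Set (EE n)} {g u : EE n → ℝ} {G : EE n → EE n}
    (s : Sol d Λ Γ g u G) :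
    (∫⁻ X in Γᶜ, ENNReal.ofReal (‖G X‖ ^ 2 * infDist X Γ ^ (d + 1 - (n : ℝ)))) < ⊤ := by
  obtain ⟨uk, Q, A, -⟩ := s.apx
  have h1 := (int_nu.1 A.Di).lintegral_lt_top
  refine lt_of_le_of_lt ((setLIntegral_le_lintegral _ _).trans (lintegral_mono_ae ?_)) h1
  filter_upwards [A.Vb] with x hx
  refine ENNReal.ofReal_le_ofReal ?_
  have := mul_le_mul_of_nonneg_left hx (wt_nonneg d Γ x)
  rw [mul_comm]
  exact this

/-- the bilinear form -/
noncomputable def frm (d : ℝ) (Γ : Set (EE n)) (A : EE n → Matrix (Fin n) (Fin n) ℝ) (X : EE n) :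
    EE n →ₗ[ℝ] EE n →ₗ[ℝ] ℝ :=
  LinearMap.mk₂ ℝ (fun ξ ζ => (∑ i, ∑ j, A X i j * ξ j * ζ i) * (wt d Γ X)⁻¹)
    (fun a b c => by simp only [PiLp.add_apply, mul_add, add_mul, Finset.sum_add_distrib])
    (fun a b c => by
      simp only [PiLp.smul_apply, smul_eq_mul, Finset.sum_mul, Finset.mul_sum]
      exact Finset.sum_congr rfl fun i _ => Finset.sum_congr rfl fun j _ => by ring)
    (fun a b c => by simp only [PiLp.add_apply, mul_add, add_mul, Finset.sum_add_distrib])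
    (fun a b c => by
      simp only [PiLp.smul_apply, smul_eq_mul, Finset.sum_mul, Finset.mul_sum]
      exact Finset.sum_congr rfl fun i _ => Finset.sum_congr rfl fun j _ => by ring)

lemma frm_apply (d : ℝ) (Γ : Set (EE n)) (A : EE n → Matrix (Fin n) (Fin n) ℝ) (X ξ ζ : EE n) :
    frm d Γ A X ξ ζ = (∑ i, ∑ j, A X i j * ξ j * ζ i) * (wt d Γ X)⁻¹ := rfl

lemma frm_frm {d C₀ C₃ : ℝ} {Γ : Set (EE n)} (h : AR n d C₀ Γ) (hC₃ : 0 < C₃)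
    {A : EE n → Matrix (Fin n) (Fin n) ℝ}
    (hell : ∀ X ∉ Γ, ∀ ξ ζ : EuclideanSpace ℝ (Fin n),
      C₃⁻¹ * Metric.infDist X Γ ^ (d + 1 - (n : ℝ)) * ‖ξ‖ ^ 2 ≤
          ∑ i, ∑ j, A X i j * ξ j * ξ i ∧
      |∑ i, ∑ j, A X i j * ξ j * ζ i| ≤
          C₃ * Metric.infDist X Γ ^ (d + 1 - (n : ℝ)) * ‖ξ‖ * ‖ζ‖) :
    Frm d C₃ Γ (frm d Γ A) := by
  refine ⟨hC₃, fun x hx ξ => ?_, fun x hx ξ ζ => ?_⟩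
  · have hw := h.wt_pos hx
    have h1 := (hell x hx ξ ξ).1
    rw [frm_apply, ← div_eq_mul_inv, le_div_iff₀ hw]
    change C₃⁻¹ * wt d Γ x * _ ≤ _ at h1
    linarith
  · have hw := h.wt_pos hx
    have h1 := (hell x hx ξ ζ).2
    rw [frm_apply, ← div_eq_mul_inv, abs_div, abs_of_pos hw, div_le_iff₀ hw]
    change _ ≤ C₃ * wt d Γ x * _ * _ at h1
    linarith

lemma frm_eq {d C₀ : ℝ} {Γ : Set (EE n)} (h : AR n d C₀ Γ) (m : Mean (nu d Γ))
    {A : EE n → Matrix (Fin n) (Fin n) ℝ} {G : EE n → EE n} {φ : EE n → ℝ}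
    (h0 : m.M (fun x => frm d Γ A x (G x) (gr φ x)) = 0) :
    ∫ X, ∑ i, (∑ j, A X i j * G X j) * fderiv ℝ φ X (EuclideanSpace.single i 1) = 0 := by
  by_cases hi : Integrable fun X => ∑ i, (∑ j, A X i j * G X j) * fderiv ℝ φ X (EuclideanSpace.single i 1)
  swap
  · exact integral_undef hi
  have e : (fun X => ∑ i, (∑ j, A X i j * G X j) * fderiv ℝ φ X (EuclideanSpace.single i 1)) =ᵐ[volume]
      fun x => wt d Γ x * frm d Γ A x (G x) (gr φ x) := by
    filter_upwards [h.ae_notMem] with x hx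
    have hw := (h.wt_pos hx).ne'
    rw [frm_apply, mul_comm (wt d Γ x), mul_assoc, inv_mul_cancel₀ hw, mul_one]
    simp only [gr_coord, Finset.sum_mul]
  rw [integral_congr_ae e, ← integral_nu, ← m.int _ (int_nu.2 (hi.congr e)), h0]

lemma ae_pt_le {v : EE n → ℝ} {u : EE n → ℝ} (hv : Continuous v) (hvu : ∀ᵐ x, v x = u x) {X : EE n} {r c : ℝ}
    (hr : 0 < r) (hb : ∀ᵐ x ∂(volume.restrict (ball X r)), u x ≤ c) : v X ≤ c := by
  by_contra hc
  push Not at hc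
  have ho : IsOpen ({x | c < v x} ∩ ball X r) := (isOpen_lt continuous_const hv).inter isOpen_ball
  have hp : 0 < volume ({x | c < v x} ∩ ball X r) := ho.measure_pos _ ⟨X, hc, mem_ball_self hr⟩
  have hz : volume ({x | c < v x} ∩ ball X r) = 0 := by
    refine measure_mono_null ?_ (ae_iff.1 ((ae_ball.1 hb).and hvu))
    rintro x ⟨h1, h2⟩ h3
    have := h3.1 h2
    rw [← h3.2] at this
    exact absurd h1 (not_lt.2 this)
  exact hp.ne' hz
end EMN
open MeasureTheory Metric Set Filter
open scoped ENNReal Topology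

namespace EMN
variable {n : ℕ}

lemma ptA {d C₀ Λ : ℝ} {Γ : Set (EE n)} (h : AR n d C₀ Γ) (hΛ : 0 < Λ) : ∃ c > 0,
    ∀ g u G v, Sol d Λ Γ (-g) (-u) (-G) → (∀ᵐ x, 0 ≤ u x ∧ u x ≤ 1) → Continuous v → (∀ᵐ x, v x = u x) →
    ∀ x ∈ Γ, ∀ r > 0, (∀ y ∈ ball x (0.9 * r), g y = 1) → ∀ X ∉ Γ, X ∈ ball x (r / 2) → c ≤ v X := by
  obtain ⟨c, hc, H⟩ := Sol.core h hΛ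
  refine ⟨c, hc, fun g u G v s u01 vc vu x hx r hr hg X hX hXb => ?_⟩
  have hδ := h.infDist_pos hX
  have nvu : ∀ᵐ x, (-v) x = (-u) x := by
    filter_upwards [vu] with y hy
    simp [hy]
  have key : ∀ p ∈ Γ, ∀ R, 0 < R → ball p R ⊆ ball x (0.9 * r) → dist X p ≤ 0.6 * R →
      R / 8 ≤ infDist X Γ → c ≤ v X := by
    intro p hp R hR hs h1 h2
    have := H _ _ _ s p hp X hX R (-1) 0 hR (by norm_num)
      (ae_restrict_of_ae (by filter_upwards [u01] with y hy; simpa using hy.1))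
      (fun y hy => by simp [hg y (hs hy)]) h1 h2
    have := ae_pt_le vc.neg nvu (by positivity) this
    simp only [Pi.neg_apply] at this
    linarith
  rw [mem_ball] at hXb
  by_cases hb : 0.9 * r / 8 ≤ infDist X Γ
  · exact key x hx (0.9 * r) (by positivity) subset_rfl (by linarith) hb
  · push Not at hb
    obtain ⟨p, hp, he⟩ := h.closed.exists_infDist_eq_dist h.ne X
    refine key p hp (2 * infDist X Γ) (by positivity) (ball_subset_ball' ?_) (by linarith) (by linarith)
    have := dist_triangle p X x
    rw [dist_comm p X] at this
    linarith

lemma ptB {d C₀ Λ : ℝ} {Γ : Set (EE n)} (h : AR n d C₀ Γ) (hd : 0 < d) (hΛ : 0 < Λ) : ∃ c > 0,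
    ∀ g u G v, Sol d Λ Γ g u G → (∀ᵐ x, 0 ≤ u x ∧ u x ≤ 1) → Continuous v → (∀ᵐ x, v x = u x) →
    ∀ x ∈ Γ, ∀ r > 0, (∀ y, 1.25 * r ≤ dist y x → g y = 0) → ∀ Y ∉ Γ, Y ∉ ball x (2 * r) → v Y ≤ 1 - c := by
  obtain ⟨c, hc, H⟩ := Sol.core h hΛ
  obtain ⟨c', hc', H'⟩ := Sol.far h hd hΛ
  refine ⟨min c c', lt_min hc hc', fun g u G v s u01 vc vu x hx r hr hg Y hY hYb => ?_⟩
  have hδ := h.infDist_pos hY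
  have u1 : ∀ᵐ x, u x ≤ 1 := u01.mono fun _ h => h.2
  rw [mem_ball, not_lt] at hYb
  by_cases hb : dist Y x / 10 ≤ infDist Y Γ
  · have := H' _ _ _ s x hx Y hY (dist Y x) (by linarith) rfl u1
      (fun y hy => (hg y (by linarith)).le) hb
    have := ae_pt_le vc vu (by linarith) this
    linarith [min_le_right c c']
  · push Not at hb
    obtain ⟨p, hp, he⟩ := h.closed.exists_infDist_eq_dist h.ne Y
    have := H _ _ _ s p hp Y hY (2 * infDist Y Γ) 0 1 (by positivity) (by norm_num)
      (ae_restrict_of_ae u1) (fun y hy => (hg y ?_).le) (by linarith) (by linarith)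
    · have := ae_pt_le vc vu (by positivity) this
      linarith [min_le_left c c']
    · rw [mem_ball] at hy
      have h1 := dist_triangle Y p x
      have h2 := dist_triangle p y x
      rw [dist_comm p y] at h2
      linarith

lemma rep {d C₀ C₃ : ℝ} {Γ : Set (EE n)} (h : AR n d C₀ Γ) (hC₃ : 0 < C₃)
    (A : EuclideanSpace ℝ (Fin n) → Matrix (Fin n) (Fin n) ℝ)
    (hell : ∀ X ∉ Γ, ∀ ξ ζ : EuclideanSpace ℝ (Fin n),
      C₃⁻¹ * Metric.infDist X Γ ^ (d + 1 - (n : ℝ)) * ‖ξ‖ ^ 2 ≤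
          ∑ i, ∑ j, A X i j * ξ j * ξ i ∧
      |∑ i, ∑ j, A X i j * ξ j * ζ i| ≤
          C₃ * Metric.infDist X Γ ^ (d + 1 - (n : ℝ)) * ‖ξ‖ * ‖ζ‖)
    (ω : EuclideanSpace ℝ (Fin n) → Measure (EuclideanSpace ℝ (Fin n)))
    (hprob : ∀ X ∉ Γ, IsProbabilityMeasure (ω X) ∧ ω X Γᶜ = 0)
    (hrepr : ∀ (u : EuclideanSpace ℝ (Fin n) → ℝ)
      (G : EuclideanSpace ℝ (Fin n) → EuclideanSpace ℝ (Fin n)),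
      Continuous u →
      (∀ φ : EuclideanSpace ℝ (Fin n) → ℝ, ContDiff ℝ (⊤ : ℕ∞) φ → HasCompactSupport φ →
        tsupport φ ⊆ Γᶜ → ∀ i : Fin n,
          ∫ X, u X * fderiv ℝ φ X (EuclideanSpace.single i 1) = - ∫ X, G X i * φ X) →
      ((∫⁻ X in Γᶜ,
          ENNReal.ofReal (‖G X‖ ^ 2 * Metric.infDist X Γ ^ (d + 1 - (n : ℝ)))) < ⊤) →
      (∀ φ : EuclideanSpace ℝ (Fin n) → ℝ, ContDiff ℝ (⊤ : ℕ∞) φ → HasCompactSupport φ →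
        tsupport φ ⊆ Γᶜ →
          ∫ X, ∑ i, (∑ j, A X i j * G X j) * fderiv ℝ φ X (EuclideanSpace.single i 1) = 0) →
      ∀ X ∉ Γ, u X = ∫ y, u y ∂(ω X))
    {g : EE n → ℝ} (gc : ContDiff ℝ 1 g) (gs : HasCompactSupport g)
    (g0 : ∀ x, 0 ≤ g x) (g1 : ∀ x, g x ≤ 1) :
    ∃ u G v, Sol d C₃ Γ g u G ∧ Sol d C₃ Γ (-g) (-u) (-G) ∧ (∀ᵐ x, 0 ≤ u x ∧ u x ≤ 1) ∧ Continuous v ∧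
      (∀ᵐ x, v x = u x) ∧ ∀ X ∉ Γ, v X = ∫ y, g y ∂(ω X) := by
  obtain ⟨M, hM1, hM2⟩ := exists_mean (nu d Γ)
  let m : Mean (nu d Γ) := ⟨M, hM1, hM2⟩
  obtain ⟨u, G, s, s', u01, hm⟩ := exists_sol h (frm_frm h hC₃ hell) m gc gs g0 g1
  obtain ⟨v, vc, vu, vg⟩ := Sol.cont h hC₃ s s' gc.continuous g0 g1 u01
  refine ⟨u, G, v, s, s', u01, vc, vu, fun X hX => ?_⟩
  have hadm : ∀ φ : EE n → ℝ, ContDiff ℝ (⊤ : ℕ∞) φ → HasCompactSupport φ →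
        tsupport φ ⊆ Γᶜ → Adm Γ φ := fun φ h1 h2 h3 => ⟨h1.of_le (by exact_mod_cast le_top), h2, h3⟩
  rw [hrepr v G vc (fun φ h1 h2 h3 i => s.weak h u01 vu (hadm φ h1 h2 h3) i) s.energyW
    (fun φ h1 h2 h3 => frm_eq h m (hm φ (hadm φ h1 h2 h3))) X hX]
  refine integral_congr_ae ?_
  have : ∀ᵐ y ∂(ω X), y ∈ Γ := by
    rw [ae_iff]
    exact (hprob X hX).2
  filter_upwards [this] with y hy using vg y hy
end EMN
/-- Non-degeneracy of elliptic measure: there is C ≥ 1 such that for every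
ball B centered on Γ, ω^X(B ∩ Γ) ≥ C⁻¹ for X ∈ Ω ∩ (1/2)B and ω^Y(Γ \ B) ≥ C⁻¹ for
Y ∈ Ω \ 2B. -/
theorem elliptic_measure_nondegeneracy
    (n : ℕ) (d C₀ C₃ : ℝ) (hd₀ : 0 ≤ d) (hd : d < (n : ℝ) - 1) (hC₀ : 0 < C₀) (hC₃ : 0 < C₃)
    (Γ : Set (EuclideanSpace ℝ (Fin n))) (hclosed : IsClosed Γ) (hΓne : Γ.Nonempty)
    (hunb : ¬ Bornology.IsBounded Γ)
    (hAR : ∀ x ∈ Γ, ∀ r : ℝ, 0 < r →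
      ENNReal.ofReal (C₀⁻¹ * r ^ d) ≤ μH[d] (Γ ∩ ball x r) ∧
      μH[d] (Γ ∩ ball x r) ≤ ENNReal.ofReal (C₀ * r ^ d))
    (A : EuclideanSpace ℝ (Fin n) → Matrix (Fin n) (Fin n) ℝ)
    -- degenerate ellipticity and boundedness with weight w(X) = dist(X,Γ)^{d+1-n}
    (hell : ∀ X ∉ Γ, ∀ ξ ζ : EuclideanSpace ℝ (Fin n),
      C₃⁻¹ * Metric.infDist X Γ ^ (d + 1 - (n : ℝ)) * ‖ξ‖ ^ 2 ≤
          ∑ i, ∑ j, A X i j * ξ j * ξ i ∧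
      |∑ i, ∑ j, A X i j * ξ j * ζ i| ≤
          C₃ * Metric.infDist X Γ ^ (d + 1 - (n : ℝ)) * ‖ξ‖ * ‖ζ‖)
    (ω : EuclideanSpace ℝ (Fin n) → Measure (EuclideanSpace ℝ (Fin n)))
    -- ω X is a Borel probability measure carried by Γ, for each pole X ∈ Ω
    (hprob : ∀ X ∉ Γ, IsProbabilityMeasure (ω X) ∧ ω X Γᶜ = 0)
    -- defining property of the elliptic measure: it represents continuous solutions
    -- of Lu = 0 in Ω lying in the energy space W, via their boundary values
    (hrepr : ∀ (u : EuclideanSpace ℝ (Fin n) → ℝ)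
      (G : EuclideanSpace ℝ (Fin n) → EuclideanSpace ℝ (Fin n)),
      Continuous u →
      (∀ φ : EuclideanSpace ℝ (Fin n) → ℝ, ContDiff ℝ (⊤ : ℕ∞) φ → HasCompactSupport φ →
        tsupport φ ⊆ Γᶜ → ∀ i : Fin n,
          ∫ X, u X * fderiv ℝ φ X (EuclideanSpace.single i 1) = - ∫ X, G X i * φ X) →
      ((∫⁻ X in Γᶜ,
          ENNReal.ofReal (‖G X‖ ^ 2 * Metric.infDist X Γ ^ (d + 1 - (n : ℝ)))) < ⊤) →
      (∀ φ : EuclideanSpace ℝ (Fin n) → ℝ, ContDiff ℝ (⊤ : ℕ∞) φ → HasCompactSupport φ →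
        tsupport φ ⊆ Γᶜ →
          ∫ X, ∑ i, (∑ j, A X i j * G X j) * fderiv ℝ φ X (EuclideanSpace.single i 1) = 0) →
      ∀ X ∉ Γ, u X = ∫ y, u y ∂(ω X))
 :
    ∃ C : ℝ, 1 ≤ C ∧
      ∀ x ∈ Γ, ∀ r : ℝ, 0 < r →
        (∀ X ∉ Γ, X ∈ ball x (r / 2) → ENNReal.ofReal C⁻¹ ≤ ω X (ball x r ∩ Γ)) ∧
        (∀ Y ∉ Γ, Y ∉ ball x (2 * r) → ENNReal.ofReal C⁻¹ ≤ ω Y (Γ \ ball x r)) := by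
  have h : EMN.AR n d C₀ Γ := ⟨hd₀, hd, hC₀, hclosed, hΓne, hAR⟩
  obtain ⟨c, hc, H1⟩ := EMN.ptA h hC₃
  obtain ⟨c', hc', H2⟩ := EMN.ptB h (h.d_pos hunb) hC₃
  have hcc : 0 < min c c' := lt_min hc hc'
  refine ⟨max 1 (min c c')⁻¹, le_max_left _ _, fun x hx r hr => ?_⟩
  have hCi : (max 1 (min c c')⁻¹)⁻¹ ≤ min c c' := by
    rw [inv_le_comm₀ (by positivity) hcc]
    exact le_max_right _ _
  refine ⟨fun X hX hXb => ?_, fun Y hY hYb => ?_⟩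
  · have ha : 0 ≤ 0.9 * r := by positivity
    have hab : 0.9 * r < 0.95 * r := by linarith
    obtain ⟨u, G, v, s, s', u01, vc, vu, hv⟩ := EMN.rep h hC₃ A hell ω hprob hrepr
      (EMN.cut_smooth x (0.9 * r) (0.95 * r)) (EMN.cut_compact ha hab)
      (EMN.cut_nonneg x _ _) (EMN.cut_le_one x _ _)
    have h1 := H1 _ u G v s' u01 vc vu x hx r hr
      (fun y hy => EMN.cut_one ha hab (mem_ball.1 hy).le) X hX hXb
    obtain ⟨hp, hz⟩ := hprob X hX
    have hms : MeasurableSet (ball x r ∩ Γ) := measurableSet_ball.inter hclosed.measurableSet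
    have h2 : ∫ y, EMN.cut x (0.9 * r) (0.95 * r) y ∂(ω X) ≤ ∫ y, (ball x r ∩ Γ).indicator 1 y ∂(ω X) := by
      refine integral_mono_ae ?_ ((integrable_const (1:ℝ)).indicator hms) ?_
      · refine (EMN.cut_smooth x (0.9 * r) (0.95 * r)).continuous.integrable_of_hasCompactSupport
          (EMN.cut_compact ha hab)
      · have : ∀ᵐ y ∂(ω X), y ∈ Γ := by
          rw [ae_iff]
          exact hz
        filter_upwards [this] with y hy
        by_cases hb : y ∈ ball x r
        · rw [indicator_of_mem (show y ∈ ball x r ∩ Γ from ⟨hb, hy⟩)]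
          exact EMN.cut_le_one x _ _ y
        · rw [indicator_of_notMem (fun h => hb h.1)]
          rw [mem_ball, not_lt] at hb
          exact (EMN.cut_zero ha hab (by linarith)).le
    rw [integral_indicator_one hms, ← hv X hX] at h2
    rw [← ofReal_measureReal (measure_ne_top _ _)]
    exact ENNReal.ofReal_le_ofReal (by linarith [min_le_left c c'])
  · have hab : r < 1.25 * r := by linarith
    obtain ⟨u, G, v, s, s', u01, vc, vu, hv⟩ := EMN.rep h hC₃ A hell ω hprob hrepr
      (EMN.cut_smooth x r (1.25 * r)) (EMN.cut_compact hr.le hab)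
      (EMN.cut_nonneg x _ _) (EMN.cut_le_one x _ _)
    have h1 := H2 _ u G v s u01 vc vu x hx r hr
      (fun y hy => EMN.cut_zero hr.le hab hy) Y hY hYb
    obtain ⟨hp, hz⟩ := hprob Y hY
    have h2 : ∫ y, (ball x r).indicator 1 y ∂(ω Y) ≤ ∫ y, EMN.cut x r (1.25 * r) y ∂(ω Y) := by
      refine integral_mono ((integrable_const (1:ℝ)).indicator measurableSet_ball) ?_ fun y => ?_
      · exact (EMN.cut_smooth x r (1.25 * r)).continuous.integrable_of_hasCompactSupport
          (EMN.cut_compact hr.le hab)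
      · by_cases hb : y ∈ ball x r
        · rw [indicator_of_mem hb]
          exact (EMN.cut_one hr.le hab (mem_ball.1 hb).le).ge
        · rw [indicator_of_notMem hb]
          exact EMN.cut_nonneg x _ _ y
    rw [integral_indicator_one measurableSet_ball, ← hv Y hY] at h2
    have h3 : (ω Y).real (ball x r)ᶜ = 1 - (ω Y).real (ball x r) := probReal_compl_eq_one_sub measurableSet_ball
    have h4 : ω Y (Γ \ ball x r) = ω Y (ball x r)ᶜ := by
      refine measure_congr ?_
      have : ∀ᵐ y ∂(ω Y), y ∈ Γ := by
        rw [ae_iff]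
        exact hz
      filter_upwards [this] with y hy
      exact propext ⟨fun h => h.2, fun h => ⟨hy, h⟩⟩
    rw [h4, ← ofReal_measureReal (measure_ne_top _ _)]
    exact ENNReal.ofReal_le_ofReal (by linarith [min_le_right c c'])
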